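/- There exists a natural number N such that every integer n ≥ N that is not a perfect square can be written as n = x² + y² − z² for some integers x, y, z satisfying max(x², y², z²) < n (strict inequality). -/

import Mathlib

namespace E1148
open Finset

/-- divisor bound -/
theorem divisor_bound (ε : ℝ) (hε : 0 < ε) :
    ∃ C : ℝ, 1 ≤ C ∧ ∀ m : ℕ, 0 < m → (m.divisors.card : ℝ) ≤ C * (m : ℝ) ^ ε := by
  set K : ℕ := ⌈(2:ℝ) ^ (1 / ε)⌉₊ with hK
  obtain ⟨A, hA1, hA⟩ : ∃ A : ℝ, 1 ≤ A ∧ ∀ k : ℕ, (k + 1 : ℝ) ≤ A * (2:ℝ) ^ (ε * k) := by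
    refine ⟨1 + 1 / (ε * Real.log 2), ?_, ?_⟩
    · have : 0 < ε * Real.log 2 := mul_pos hε (Real.log_pos (by norm_num))
      have := (one_div_pos.mpr this).le
      linarith
    · intro k
      have hl : 0 < ε * Real.log 2 := mul_pos hε (Real.log_pos (by norm_num))
      have h1 : (2:ℝ) ^ (ε * k) = Real.exp (Real.log 2 * (ε * k)) := by
        rw [Real.rpow_def_of_pos (by norm_num)]
      have h2 := Real.add_one_le_exp (Real.log 2 * (ε * k))
      rw [h1]
      have hk : (0:ℝ) ≤ k := Nat.cast_nonneg k
      have h3 : (1 + 1 / (ε * Real.log 2)) * (Real.log 2 * (ε * k) + 1)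
          ≤ (1 + 1 / (ε * Real.log 2)) * Real.exp (Real.log 2 * (ε * k)) := by
        gcongr
      refine le_trans ?_ h3
      have h4 : (1 / (ε * Real.log 2)) * (Real.log 2 * (ε * k)) = k := by
        field_simp
      have h5 : 0 ≤ Real.log 2 * (ε * k) := by
        have := mul_nonneg hl.le hk
        nlinarith
      have h6 := (one_div_pos.mpr hl).le
      nlinarith
  refine ⟨A ^ K, one_le_pow₀ hA1, ?_⟩
  intro m hm
  have hm0 : m ≠ 0 := hm.ne'
  rw [Nat.card_divisors hm0]
  have hmfac : (m : ℝ) ^ ε = ∏ p ∈ m.primeFactors, ((p:ℝ) ^ ε) ^ (m.factorization p) := by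
    conv_lhs => rw [← Nat.prod_factorization_pow_eq_self hm0]
    rw [Finsupp.prod, Nat.cast_prod, ← Real.finsetProd_rpow]
    · rw [Nat.support_factorization]
      refine Finset.prod_congr rfl fun p hp => ?_
      rw [Nat.cast_pow, ← Real.rpow_natCast, ← Real.rpow_mul (by positivity), mul_comm,
        Real.rpow_mul (by positivity), Real.rpow_natCast]
    · intros; positivity
  rw [hmfac]
  push_cast
  have hstep : ∀ p ∈ m.primeFactors, ((m.factorization p : ℝ) + 1)
      ≤ (if p < K then A else 1) * ((p:ℝ) ^ ε) ^ (m.factorization p) := by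
    intro p hp
    have hpp := Nat.prime_of_mem_primeFactors hp
    have hp2 : (2:ℝ) ≤ p := by exact_mod_cast hpp.two_le
    split_ifs with h
    · refine (hA _).trans ?_
      rw [Real.rpow_mul (by norm_num), Real.rpow_natCast]
      gcongr
    · push Not at h
      have h2 : (2:ℝ) ≤ (p:ℝ) ^ ε := by
        have : (2:ℝ) ^ (1/ε) ≤ p := (Nat.le_ceil _).trans (by exact_mod_cast h)
        calc (2:ℝ) = ((2:ℝ) ^ (1/ε)) ^ ε := by
              rw [← Real.rpow_mul (by norm_num)]; simp [hε.ne']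
          _ ≤ _ := by gcongr
      rw [one_mul]
      calc ((m.factorization p : ℝ) + 1) ≤ (2:ℝ) ^ (m.factorization p) := by
            exact_mod_cast Nat.lt_two_pow_self
        _ ≤ _ := by gcongr
  refine (Finset.prod_le_prod (fun i _ => by positivity) hstep).trans ?_
  rw [Finset.prod_mul_distrib]
  gcongr
  rw [Finset.prod_ite]
  simp only [prod_const, mul_one, one_pow]
  refine pow_le_pow_right₀ hA1 ?_
  calc _ ≤ (Finset.range K).card := Finset.card_le_card (by intro p; simp)
    _ = K := by simp

/-- trivial residue classes -/
theorem rep_of_AB (n X A B : ℤ) (h : n = X ^ 2 + A * B) (hA : 0 < A) (hB : 0 < B)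
    (hpar : (2:ℤ) ∣ A - B) (hlt : |A - B| < 2 * |X|) :
    ∃ x y z : ℤ, n = x ^ 2 + y ^ 2 - z ^ 2 ∧ max (x ^ 2) (max (y ^ 2) (z ^ 2)) < n := by
  obtain ⟨z, hz⟩ := hpar
  have hAz : A = B + 2 * z := by linarith
  subst hAz
  refine ⟨X, B + z, z, by rw [h]; ring, ?_⟩
  have hz2 : z ^ 2 < X ^ 2 := by
    apply sq_lt_sq.mpr
    have : |B + 2 * z - B| = 2 * |z| := by
      rw [add_sub_cancel_left, abs_mul]; norm_num
    linarith
  have : 0 < (B + 2 * z) * B := mul_pos hA hB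
  rw [max_lt_iff, max_lt_iff]
  refine ⟨by linarith, ?_, by linarith⟩
  nlinarith

theorem rep_mod01 (n : ℤ) (hn : 100 ≤ n) (hsq : ¬ IsSquare n) (hmod : n % 4 = 0 ∨ n % 4 = 1) :
    ∃ x y z : ℤ, n = x ^ 2 + y ^ 2 - z ^ 2 ∧ max (x ^ 2) (max (y ^ 2) (z ^ 2)) < n := by
  obtain ⟨m, rfl⟩ : ∃ m : ℕ, n = m := ⟨n.toNat, by omega⟩
  obtain ⟨r, hr⟩ : ∃ r : ℤ, r = (Nat.sqrt m : ℤ) := ⟨_, rfl⟩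
  have h1 : r * r ≤ m := by rw [hr]; exact_mod_cast Nat.sqrt_le m
  have h2 : (m:ℤ) < (r+1) * (r+1) := by rw [hr]; exact_mod_cast Nat.lt_succ_sqrt m
  have h3 : r * r ≠ m := fun h => hsq ⟨r, h.symm⟩
  have hr0 : 0 ≤ r := by rw [hr]; positivity
  have hr9 : 9 ≤ r := by nlinarith
  obtain ⟨x, hx0, hx1, hx2, hx3⟩ : ∃ x : ℤ, 0 < x ∧ x ^ 2 < m ∧ (m:ℤ) < (x+2)^2 ∧
      (x - m) % 2 = 0 := by
    rcases Int.emod_two_eq_zero_or_one (r - m) with h | h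
    · exact ⟨r, by omega, lt_of_le_of_ne (by nlinarith) (by rw [pow_two]; exact h3),
        by nlinarith, h⟩
    · exact ⟨r - 1, by omega, by nlinarith, by nlinarith, by omega⟩
  obtain ⟨j, hj⟩ : ∃ j : ℤ, (m:ℤ) = x ^ 2 + 4 * j := by
    have : (4:ℤ) ∣ m - x ^ 2 := by
      rcases Int.emod_two_eq_zero_or_one x with h | h
      · obtain ⟨t, ht⟩ : ∃ t, x = 2 * t := ⟨x / 2, by omega⟩
        have hm0 : (m:ℤ) % 4 = 0 := by omega
        rw [ht, mul_pow]
        omega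
      · obtain ⟨t, ht⟩ : ∃ t, x = 2 * t + 1 := ⟨x / 2, by omega⟩
        have hm0 : (m:ℤ) % 4 = 1 := by omega
        have : x ^ 2 = 4 * (t ^ 2 + t) + 1 := by rw [ht]; ring
        omega
    obtain ⟨j, hj⟩ := this
    exact ⟨j, by linarith⟩
  have hj0 : 0 < j := by linarith
  have hjx : j < x + 1 := by nlinarith
  refine rep_of_AB m x 2 (2 * j) (by rw [hj]; ring) (by norm_num) (by linarith)
    ⟨1 - j, by ring⟩ ?_
  rw [abs_of_pos hx0, abs_lt]
  constructor <;> linarith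
end E1148

namespace E1148
open Finset

noncomputable def Ener (S : Finset ℝ) : ℝ := ∑ i ∈ S, ∑ j ∈ S, |i - j|⁻¹

theorem Ener_nonneg (S : Finset ℝ) : 0 ≤ Ener S :=
  sum_nonneg fun _ _ => sum_nonneg fun _ _ => by positivity

theorem Ener_union (S₁ S₂ : Finset ℝ) (h : Disjoint S₁ S₂) :
    Ener S₁ + Ener S₂ ≤ Ener (S₁ ∪ S₂) := by
  unfold Ener
  rw [sum_union h]
  gcongr with i hi i hi
  · exact subset_union_left
  · exact subset_union_right

noncomputable def Phi (q r : ℝ) : ℝ := (q + r) ^ (1/4:ℝ) / (q * r)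

theorem rpow_quarter_le (t u : ℝ) (ht : 0 < t) (hu : 0 ≤ u) :
    (t + u) ^ (1/4:ℝ) ≤ t ^ (1/4:ℝ) * (1 + u / (4 * t)) := by
  have h1 : t + u = t * (1 + u / t) := by field_simp
  have h2 : 0 ≤ u / t := by positivity
  rw [h1, Real.mul_rpow ht.le (by linarith)]
  gcongr
  have := rpow_one_add_le_one_add_mul_self (s := u / t) (by linarith) (p := 1/4)
    (by norm_num) (by norm_num)
  refine this.trans (le_of_eq ?_)
  field_simp

theorem Phi_child (q r : ℝ) (hq : 0 < q) (hr : 0 < r) :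
    Phi q (q + r) + Phi (q + 2 * r) r ≤ Phi q r := by
  unfold Phi
  have ht : 0 < q + r := by linarith
  have h1 := rpow_quarter_le (q + r) q ht hq.le
  have h2 := rpow_quarter_le (q + r) (2 * r) ht (by linarith)
  have e1 : q + (q + r) = q + r + q := by ring
  have e2 : q + 2 * r + r = q + r + 2 * r := by ring
  rw [e1, e2]
  have h0 : 0 < (q + r) ^ (1/4:ℝ) := by positivity
  set W := (q + r) ^ (1/4:ℝ) with hW
  calc (q + r + q) ^ (1/4:ℝ) / (q * (q + r)) + (q + r + 2 * r) ^ (1/4:ℝ) / ((q + 2 * r) * r)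
      ≤ W * (1 + q / (4 * (q + r))) / (q * (q + r))
        + W * (1 + 2 * r / (4 * (q + r))) / ((q + 2 * r) * r) := by gcongr
    _ = W / (q * r) - W * ((1 / (4 * (q + r))) * (1 / (q + 2 * r)) * (q / (q + r))) := by
        field_simp
        ring
    _ ≤ W / (q * r) := by
        have : 0 ≤ W * ((1 / (4 * (q + r))) * (1 / (q + 2 * r)) * (q / (q + r))) := by positivity
        linarith

/-- The gap property of a set of reals. -/
def GapProp (S : Finset ℝ) : Prop :=
  ∀ β ∈ S, ∀ p q p' r : ℕ, Even p → Odd q → 0 < r → p' * q = p * r + 1 →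
    (p:ℝ) / q < β → β < (p':ℝ) / r →
    (β < ((p + p' : ℕ):ℝ) / ((q + r : ℕ):ℝ) ∨
      ((p + 2 * p' : ℕ):ℝ) / ((q + 2 * r : ℕ):ℝ) < β)

theorem tree_leaf (Q : ℕ) (S : Finset ℝ) (p q p' r : ℕ) (hQ0 : 0 < Q) (hQ : Q ≤ q + r)
    (hQ3 : q + r ≤ 3 * Q) (hq : 0 < q) (hr : 0 < r) (hdet : p' * q = p * r + 1)
    (hS : ∀ β ∈ S, (p:ℝ) / q < β ∧ β < (p':ℝ) / r) :
    (#S : ℝ) ^ 2 ≤ Phi q r * ((Q:ℝ) ^ (-(1/4):ℝ)) * (3 * (Q:ℝ) ^ 2 * #S + Ener S) := by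
  have hq' : (0:ℝ) < q := by exact_mod_cast hq
  have hr' : (0:ℝ) < r := by exact_mod_cast hr
  have hQ' : (0:ℝ) < Q := by exact_mod_cast hQ0
  have hE := Ener_nonneg S
  have hdet' : (p':ℝ) * q = p * r + 1 := by exact_mod_cast hdet
  have hlen : (p':ℝ) / r - p / q = 1 / (q * r) := by
    field_simp; linarith
  have hphi : 1 / (q * r : ℝ) ≤ Phi q r * ((Q:ℝ) ^ (-(1/4):ℝ)) := by
    unfold Phi
    rw [Real.rpow_neg hQ'.le, div_mul_eq_mul_div]
    gcongr
    rw [← div_eq_mul_inv, one_le_div (by positivity)]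
    gcongr
    exact_mod_cast hQ
  have hqr : (q * r : ℝ) ≤ 3 * (Q:ℝ) ^ 2 := by
    have : (q + r : ℝ) ≤ 3 * Q := by exact_mod_cast hQ3
    have h4 : (q + r : ℝ)^2 ≤ (3 * Q)^2 := by gcongr
    nlinarith [sq_nonneg ((q:ℝ) - r)]
  have hpair : (#S : ℝ) ^ 2 ≤ #S + Ener S / (q * r) := by
    unfold Ener
    have e1 : (#S : ℝ) ^ 2 = ∑ i ∈ S, ∑ j ∈ S, (1:ℝ) := by
      simp [pow_two]
    have e2 : (#S : ℝ) = ∑ i ∈ S, ∑ j ∈ S, (if i = j then (1:ℝ) else 0) := by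
      simp
    rw [e1]
    conv_rhs => rw [e2]
    rw [sum_div, ← sum_add_distrib]
    refine sum_le_sum fun i hi => ?_
    rw [sum_div, ← sum_add_distrib]
    refine sum_le_sum fun j hj => ?_
    split_ifs with h
    · have : 0 ≤ |i - j|⁻¹ / (q * r) := by positivity
      linarith
    · rw [zero_add, le_div_iff₀ (by positivity), one_mul]
      have hpos : 0 < |i - j| := abs_pos.mpr (sub_ne_zero.mpr h)
      rw [le_inv_comm₀ (by positivity) hpos, ← one_div, ← hlen]
      rw [abs_le]
      constructor <;> linarith [(hS i hi).1, (hS i hi).2, (hS j hj).1, (hS j hj).2]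
  calc (#S : ℝ) ^ 2 ≤ #S + Ener S / (q * r) := hpair
    _ = 1 / (q * r) * (q * r * #S + Ener S) := by field_simp
    _ ≤ _ := by
      have : 0 ≤ Phi q r := by unfold Phi; positivity
      gcongr

theorem tree_aux (Q : ℕ) (hQ0 : 0 < Q) (m : ℕ) : ∀ (S : Finset ℝ) (p q p' r : ℕ), GapProp S →
    Q ≤ q + r + m → q + r ≤ 3 * Q → Even p → Odd q → 0 < r → p' * q = p * r + 1 →
    (∀ β ∈ S, (p:ℝ) / q < β ∧ β < (p':ℝ) / r) →
    (#S : ℝ) ^ 2 ≤ Phi q r * ((Q:ℝ) ^ (-(1/4):ℝ)) * (3 * (Q:ℝ) ^ 2 * #S + Ener S) := by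
  induction m with
  | zero =>
    intro S p q p' r hG hQ hQ3 hp hq hr hdet hS
    exact tree_leaf Q S p q p' r hQ0 (by omega) hQ3 hq.pos hr hdet hS
  | succ m ih =>
    intro S p q p' r hG hQ hQ3 hp hq hr hdet hS
    by_cases hle : Q ≤ q + r
    · exact tree_leaf Q S p q p' r hQ0 hle hQ3 hq.pos hr hdet hS
    push Not at hle
    have hqp := hq.pos
    have hdet' : (p':ℝ) * q = p * r + 1 := by exact_mod_cast hdet
    have hq' : (0:ℝ) < q := by exact_mod_cast hqp
    have hr' : (0:ℝ) < r := by exact_mod_cast hr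
    classical
    set c : ℝ := ((p + p' : ℕ):ℝ) / ((q + r : ℕ):ℝ) with hc
    set S₁ := S.filter (fun β => β < c) with hS₁
    set S₂ := S.filter (fun β => ¬ β < c) with hS₂
    have hun : S₁ ∪ S₂ = S := filter_union_filter_not_eq _ _
    have hdis : Disjoint S₁ S₂ := disjoint_filter_filter_not _ _ _
    have hcard : #S = #S₁ + #S₂ := by rw [← hun, card_union_of_disjoint hdis]
    have hG1 : GapProp S₁ := fun β hβ => hG β (filter_subset _ _ hβ)
    have hG2 : GapProp S₂ := fun β hβ => hG β (filter_subset _ _ hβ)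
    have i1 := ih S₁ p q (p + p') (q + r) hG1 (by omega) (by omega) hp hq (by omega)
      (by nlinarith) (by
        intro β hβ
        rw [hS₁, mem_filter] at hβ
        exact ⟨(hS β hβ.1).1, hβ.2⟩)
    have i2 := ih S₂ (p + 2 * p') (q + 2 * r) p' r hG2 (by omega) (by omega)
      (hp.add (even_two_mul _)) (hq.add_even (even_two_mul _)) hr (by nlinarith) (by
        intro β hβ
        rw [hS₂, mem_filter] at hβ
        refine ⟨?_, (hS β hβ.1).2⟩
        rcases hG β hβ.1 p q p' r hp hq hr hdet (hS β hβ.1).1 (hS β hβ.1).2 with h | h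
        · exact absurd h hβ.2
        · exact h)
    have hE := Ener_union S₁ S₂ hdis
    rw [hun] at hE
    have hPhi := Phi_child q r hq' hr'
    rw [hcard]
    push_cast at i1 i2 ⊢
    set W := (Q:ℝ) ^ (-(1/4):ℝ) with hW
    have hW0 : 0 < W := by rw [hW]; have : (0:ℝ) < Q := by exact_mod_cast hQ0
                           positivity
    have hP1 : 0 ≤ Phi q (q + r) := by unfold Phi; positivity
    have hP2 : 0 ≤ Phi (q + 2 * r) r := by unfold Phi; positivity
    have hE1 := Ener_nonneg S₁
    have hE2 := Ener_nonneg S₂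
    set K1 := 3 * (Q:ℝ) ^ 2 * #S₁ + Ener S₁ with hK1
    set K2 := 3 * (Q:ℝ) ^ 2 * #S₂ + Ener S₂ with hK2
    have hK1' : 0 ≤ K1 := by positivity
    have hK2' : 0 ≤ K2 := by positivity
    set F1 := Phi q (q + r)
    set F2 := Phi (q + 2 * r) r
    have hcross : 2 * ((#S₁ : ℝ) * #S₂) ≤ W * (F1 * K2 + F2 * K1) := by
      refine le_trans (le_abs_self _) (abs_le_of_sq_le_sq ?_ (by positivity))
      have := mul_le_mul i1 i2 (by positivity) (by positivity)
      nlinarith [sq_nonneg (W * (F1 * K2 - F2 * K1))]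
    have key : ((#S₁ : ℝ) + #S₂) ^ 2 ≤ (F1 + F2) * W * (K1 + K2) := by nlinarith
    refine key.trans ?_
    have : K1 + K2 ≤ 3 * (Q:ℝ) ^ 2 * (#S₁ + #S₂) + Ener S := by
      rw [hK1, hK2]; linarith
    have hF : 0 ≤ Phi q r := by unfold Phi; positivity
    gcongr

/-- Entropy bound. -/
theorem tree_bound (Q : ℕ) (hQ0 : 0 < Q) (S : Finset ℝ) (hG : GapProp S)
    (hS : ∀ β ∈ S, 0 < β ∧ β < 1) :
    (#S : ℝ) ^ 2 ≤ 2 * ((Q:ℝ) ^ (-(1/4):ℝ)) * (3 * (Q:ℝ) ^ 2 * #S + Ener S) := by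
  have := tree_aux Q hQ0 Q S 0 1 1 1 hG (by omega) (by omega) (by simp) (by simp) (by simp)
    (by simp) (by simpa using hS)
  refine this.trans ?_
  have hE := Ener_nonneg S
  gcongr
  unfold Phi
  norm_num
  calc (2:ℝ) ^ (1/4:ℝ) ≤ 2 ^ (1:ℝ) := by
        apply Real.rpow_le_rpow_of_exponent_le <;> norm_num
    _ = 2 := by norm_num
end E1148

namespace E1148
open Finset

/-- `n` has a strict representation. -/
def Rep (n : ℤ) : Prop :=
  ∃ x y z : ℤ, n = x ^ 2 + y ^ 2 - z ^ 2 ∧ max (x ^ 2) (max (y ^ 2) (z ^ 2)) < n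

def IsP (n a x : ℤ) : Prop :=
  Odd a ∧ 0 < a ∧ 0 < x ∧ 2 * a ∣ n - x ^ 2 ∧ x ^ 2 < n ∧ n < (a + x) ^ 2 ∧ (a - x) ^ 2 < n

noncomputable def bet (n : ℕ) (a x : ℤ) : ℝ := (√(n:ℝ) - x) / a

theorem IsP.bounds {n : ℕ} {a x : ℤ} (h : IsP n a x) :
    (0:ℝ) < a ∧ (0:ℝ) < x ∧ (x:ℝ) < √(n:ℝ) ∧ √(n:ℝ) - x < a ∧ (a:ℝ) < √(n:ℝ) + x := by
  obtain ⟨-, ha, hx, -, h1, h2, h3⟩ := h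
  have ha' : (0:ℝ) < a := by exact_mod_cast ha
  have hx' : (0:ℝ) < x := by exact_mod_cast hx
  refine ⟨ha', hx', ?_, ?_, ?_⟩
  · apply Real.lt_sqrt_of_sq_lt
    exact_mod_cast h1
  · have : √(n:ℝ) < a + x := by
      rw [Real.sqrt_lt' (by linarith)]
      exact_mod_cast h2
    linarith
  · have : (a:ℝ) - x < √(n:ℝ) := by
      apply Real.lt_sqrt_of_sq_lt
      exact_mod_cast h3
    linarith

theorem bet_mem {n : ℕ} {a x : ℤ} (h : IsP n a x) : 0 < bet n a x ∧ bet n a x < 1 := by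
  obtain ⟨ha, hx, h1, h2, h3⟩ := h.bounds
  unfold bet
  constructor
  · apply div_pos <;> linarith
  · rw [div_lt_one ha]; exact h2

theorem gap_int (n a x b p q p' r : ℤ) (hn : n = x ^ 2 + a * b) (ha : Odd a) (hb : Even b)
    (hp : Even p) (hq : Odd q) (hdet : p' * q = p * r + 1)
    (f1 : 0 < a * p' ^ 2 + 2 * x * p' * r - b * r ^ 2)
    (f2 : a * (p + p') ^ 2 + 2 * x * (p + p') * (q + r) - b * (q + r) ^ 2 < 0)
    (f3 : a * p ^ 2 + 2 * x * p * q - b * q ^ 2 < 0)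
    (f4 : 0 < a * (p + 2 * p') ^ 2 + 2 * x * (p + 2 * p') * (q + 2 * r) - b * (q + 2 * r) ^ 2) :
    Rep n := by
  have hp' : Odd p' := by
    have : Odd (p' * q) := by rw [hdet]; exact (hp.mul_right r).add_one
    exact (Int.odd_mul.mp this).1
  set A := a * p' ^ 2 + 2 * x * p' * r - b * r ^ 2 with hA
  set B := -(a * (p + p') ^ 2 + 2 * x * (p + p') * (q + r) - b * (q + r) ^ 2) with hB
  set X := a * p' * (p + p') + x * (p' * (q + r) + (p + p') * r) - b * r * (q + r) with hX
  have oA : Odd A := by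
    have h1 : Odd (a * p' ^ 2) := ha.mul hp'.pow
    have h2 : Even (2 * x * p' * r) := ⟨x * p' * r, by ring⟩
    exact (h1.add_even h2).sub_even (hb.mul_right _)
  have oB : Odd B := by
    have h1 : Odd (a * (p + p') ^ 2) := ha.mul (hp.add_odd hp').pow
    have h2 : Even (2 * x * (p + p') * (q + r)) := ⟨x * (p + p') * (q + r), by ring⟩
    exact ((h1.add_even h2).sub_even (hb.mul_right _)).neg
  have key : n = X ^ 2 + A * B := by
    have e : X ^ 2 + A * B = (x ^ 2 + a * b) * (p' * q - p * r) ^ 2 := by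
      rw [hA, hB, hX]; ring
    rw [e, hdet, hn]; ring
  have g3 : A - B - 2 * X < 0 := by
    have : A - B - 2 * X = a * p ^ 2 + 2 * x * p * q - b * q ^ 2 := by
      rw [hA, hB, hX]; ring
    rw [this]; exact f3
  have g4 : 0 < A - B + 2 * X := by
    have : A - B + 2 * X = a * (p + 2 * p') ^ 2 + 2 * x * (p + 2 * p') * (q + 2 * r)
        - b * (q + 2 * r) ^ 2 := by
      rw [hA, hB, hX]; ring
    rw [this]; exact f4
  refine rep_of_AB n X A B key f1 (by rw [hB]; linarith) (even_iff_two_dvd.mp (oA.sub_odd oB)) ?_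
  have : X ≤ |X| := le_abs_self X
  rw [abs_lt]
  constructor <;> linarith

theorem form_sign (n : ℕ) (a x b T U : ℤ) (hn : (n:ℤ) = x ^ 2 + a * b) (ha : (0:ℝ) < a)
    (hx : (0:ℝ) < x) (hxs : (x:ℝ) < √(n:ℝ)) (hT : 0 ≤ T) (hU : 0 < U) :
    ((T:ℝ) / U < bet n a x → a * T ^ 2 + 2 * x * T * U - b * U ^ 2 < 0) ∧
    (bet n a x < (T:ℝ) / U → 0 < a * T ^ 2 + 2 * x * T * U - b * U ^ 2) := by
  have hU' : (0:ℝ) < U := by exact_mod_cast hU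
  have hT' : (0:ℝ) ≤ T := by exact_mod_cast hT
  have hs : √(n:ℝ) * √(n:ℝ) = n := Real.mul_self_sqrt (Nat.cast_nonneg n)
  have hn' : (n:ℝ) = x ^ 2 + a * b := by exact_mod_cast hn
  have e : (a:ℝ) * ((a * T ^ 2 + 2 * x * T * U - b * U ^ 2 : ℤ) : ℝ)
      = (a * T - (√(n:ℝ) - x) * U) * (a * T + (√(n:ℝ) + x) * U) := by
    push_cast
    have : (a:ℝ) * b = √(n:ℝ) * √(n:ℝ) - x ^ 2 := by rw [hs]; linarith
    linear_combination (-(U:ℝ)^2) * this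
  have hpos : 0 < a * T + (√(n:ℝ) + x) * U := by
    have : 0 < (√(n:ℝ) + x) * U := by apply mul_pos <;> linarith
    have : 0 ≤ (a:ℝ) * T := by positivity
    linarith
  constructor
  · intro h
    unfold bet at h
    rw [div_lt_div_iff₀ hU' ha] at h
    have h1 : a * T - (√(n:ℝ) - x) * U < 0 := by linarith
    have h2 := mul_neg_of_neg_of_pos h1 hpos
    rw [← e] at h2
    have := neg_of_mul_neg_right h2 ha.le
    exact_mod_cast this
  · intro h
    unfold bet at h
    rw [div_lt_div_iff₀ ha hU'] at h
    have h1 : 0 < a * T - (√(n:ℝ) - x) * U := by linarith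
    have h2 := mul_pos h1 hpos
    rw [← e] at h2
    have := pos_of_mul_pos_right h2 ha.le
    exact_mod_cast this

theorem bet_irr (n : ℕ) (hsq : ¬ IsSquare n) (a x : ℤ) (ha : a ≠ 0) : Irrational (bet n a x) := by
  have : Irrational (√(n:ℝ)) := irrational_sqrt_natCast_iff.mpr hsq
  exact (this.sub_intCast x).div_intCast ha

theorem gap_of_bad (n : ℕ) (hsq : ¬ IsSquare n) (hbad : ¬ Rep n) (S : Finset ℝ)
    (hS : ∀ β ∈ S, ∃ a x : ℤ, IsP n a x ∧ β = bet n a x) : GapProp S := by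
  intro β hβ p q p' r hp hq hr hdet hb1 hb2
  obtain ⟨a, x, hP, rfl⟩ := hS β hβ
  by_contra hcon
  push Not at hcon
  obtain ⟨h1, h2⟩ := hcon
  have hirr := bet_irr n hsq a x hP.2.1.ne'
  have h1' : ((p + p' : ℕ):ℝ) / ((q + r : ℕ):ℝ) < bet n a x := by
    refine lt_of_le_of_ne h1 fun h => hirr ⟨((p + p' : ℕ):ℚ) / ((q + r : ℕ):ℚ), ?_⟩
    rw [← h]; push_cast; rfl
  have h2' : bet n a x < ((p + 2 * p' : ℕ):ℝ) / ((q + 2 * r : ℕ):ℝ) := by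
    refine lt_of_le_of_ne h2 fun h => hirr ⟨((p + 2 * p' : ℕ):ℚ) / ((q + 2 * r : ℕ):ℚ), ?_⟩
    rw [h]; push_cast; rfl
  obtain ⟨ha, hx, hxs, -, -⟩ := hP.bounds
  obtain ⟨b', hb'⟩ := hP.2.2.2.1
  have hn : (n:ℤ) = x ^ 2 + a * (2 * b') := by linarith
  have hq0 := hq.pos
  refine hbad (gap_int n a x (2 * b') p q p' r hn hP.1 (even_two_mul _) (by exact_mod_cast hp)
    (by exact_mod_cast hq) (by exact_mod_cast hdet) ?_ ?_ ?_ ?_)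
  · exact (form_sign n a x _ p' r hn ha hx hxs (by positivity) (by exact_mod_cast hr)).2
      (by simpa using hb2)
  · have := (form_sign n a x _ (p + p' : ℕ) (q + r : ℕ) hn ha hx hxs (by positivity)
      (by positivity)).1 (by simpa using h1')
    exact_mod_cast this
  · exact (form_sign n a x _ p q hn ha hx hxs (by positivity) (by exact_mod_cast hq0)).1
      (by simpa using hb1)
  · have := (form_sign n a x _ (p + 2 * p' : ℕ) (q + 2 * r : ℕ) hn ha hx hxs (by positivity)
      (by positivity)).2 (by simpa using h2')
    exact_mod_cast this
end E1148

namespace E1148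
open Finset

/-- roots of `r² ≡ n` modulo `q` in `[0,q)` -/
def rootSet (n : ℤ) (q : ℕ) : Finset ℕ := (range q).filter (fun r => (q:ℤ) ∣ (r:ℤ) ^ 2 - n)

theorem card_class_le (q m w : ℕ) (hw : q = w * m) (c : ℤ) :
    ((range q).filter (fun r : ℕ => (m:ℤ) ∣ (r:ℤ) - c)).card ≤ w := by
  rcases Nat.eq_zero_or_pos m with hm | hm
  · subst hm; simp [hw]
  calc _ ≤ (range w).card := by
        refine card_le_card_of_injOn (fun r => r / m) ?_ ?_
        · intro r hr
          simp only [coe_filter, mem_range, Set.mem_ofPred_eq] at hr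
          simp only [coe_range, Set.mem_Iio]
          rw [Nat.div_lt_iff_lt_mul hm]
          omega
        · intro r hr r' hr' h
          simp only [coe_filter, mem_range, Set.mem_ofPred_eq] at hr hr'
          simp only at h
          have h1 : (m:ℤ) ∣ (r:ℤ) - r' := by
            have := dvd_sub hr.2 hr'.2
            simpa using this
          have h2 : (r:ℤ) % m = (r':ℤ) % m := Int.emod_eq_emod_iff_emod_sub_eq_zero.mpr
            (Int.emod_eq_zero_of_dvd h1)
          have h3 : r % m = r' % m := by exact_mod_cast h2
          rw [← Nat.div_add_mod r m, ← Nat.div_add_mod r' m, h, h3]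
    _ = w := card_range w

theorem root_bound (n : ℤ) (q : ℕ) (hq : 0 < q) (W : ℕ)
    (hW : ∀ w : ℕ, w ^ 2 ∣ q → ((w:ℤ) ^ 2 ∣ 4 * n) → w ≤ W) :
    (rootSet n q).card ≤ q.divisors.card * W := by
  rcases (rootSet n q).eq_empty_or_nonempty with h | ⟨s0, hs0⟩
  · simp [h]
  have hs0' : (q:ℤ) ∣ (s0:ℤ) ^ 2 - n := (mem_filter.mp hs0).2
  refine card_le_mul_card_image_of_maps_to (f := fun s : ℕ => Int.gcd ((s:ℤ) - s0) q)
    (t := q.divisors) ?_ W ?_ |>.trans (by rw [mul_comm])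
  · intro s _
    rw [Nat.mem_divisors]
    exact ⟨Int.natCast_dvd_natCast.mp (Int.gcd_dvd_right ((s:ℤ) - s0) q), hq.ne'⟩
  · intro u hu
    obtain ⟨⟨v, hv⟩, -⟩ := Nat.mem_divisors.mp hu
    have hu0 : 0 < u := by
      rcases Nat.eq_zero_or_pos u with h | h
      · subst h; simp at hv; omega
      · exact h
    have hv0 : 0 < v := by
      rcases Nat.eq_zero_or_pos v with h | h
      · subst h; simp at hv; omega
      · exact h
    set w := Nat.gcd u v with hw
    have hfib : ∀ s ∈ (rootSet n q).filter (fun s : ℕ => Int.gcd ((s:ℤ) - s0) q = u),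
        (u:ℤ) ∣ (s:ℤ) - s0 ∧ (v:ℤ) ∣ (s:ℤ) + s0 := by
      intro s hs
      rw [mem_filter] at hs
      obtain ⟨hs1, hs2⟩ := hs
      have hs1' : (q:ℤ) ∣ (s:ℤ) ^ 2 - n := (mem_filter.mp hs1).2
      have hd : (u:ℤ) ∣ (s:ℤ) - s0 := by rw [← hs2]; exact Int.gcd_dvd_left _ _
      refine ⟨hd, ?_⟩
      obtain ⟨z, hz⟩ := hd
      have h1 : (q:ℤ) ∣ ((s:ℤ) - s0) * (s + s0) := by
        have := dvd_sub hs1' hs0'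
        have e : ((s:ℤ) - s0) * (s + s0) = ((s:ℤ) ^ 2 - n) - ((s0:ℤ) ^ 2 - n) := by ring
        rw [e]; exact this
      have hcop : IsCoprime (v:ℤ) z := by
        rw [Int.isCoprime_iff_gcd_eq_one]
        have h3 : Int.gcd (u * z) (u * v) = u := by
          rw [← hz]; have : ((u:ℤ) * v) = (q:ℤ) := by rw [hv]; push_cast; ring
          rw [this]; exact hs2
        rw [Int.gcd_mul_left] at h3
        have h4 : Int.gcd z v = 1 := by
          have : u * Int.gcd z v = u * 1 := by simpa using h3
          exact Nat.eq_of_mul_eq_mul_left hu0 this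
        rw [Int.gcd_comm]; exact h4
      rw [hz, hv] at h1
      push_cast at h1
      rw [mul_assoc] at h1
      have h2 : (v:ℤ) ∣ z * (s + s0) :=
        (mul_dvd_mul_iff_left (by exact_mod_cast hu0.ne')).mp h1
      exact hcop.dvd_of_dvd_mul_left h2
    rcases ((rootSet n q).filter (fun s : ℕ => Int.gcd ((s:ℤ) - s0) q = u)).eq_empty_or_nonempty
      with h | ⟨s1, hs1⟩
    · rw [h]; simp
    have hwW : w ≤ W := by
      apply hW
      · rw [hv, pow_two]; exact mul_dvd_mul (Nat.gcd_dvd_left _ _) (Nat.gcd_dvd_right _ _)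
      · obtain ⟨h1, h2⟩ := hfib s1 hs1
        have hwu : (w:ℤ) ∣ u := by exact_mod_cast Nat.gcd_dvd_left _ _
        have hwv : (w:ℤ) ∣ v := by exact_mod_cast Nat.gcd_dvd_right _ _
        have h3 : (w:ℤ) ∣ 2 * s0 := by
          have := dvd_sub (hwv.trans h2) (hwu.trans h1)
          have e : (2:ℤ) * s0 = ((s1:ℤ) + s0) - (s1 - s0) := by ring
          rw [e]; exact this
        have h4 : (w:ℤ) ^ 2 ∣ (2 * s0) ^ 2 := pow_dvd_pow_of_dvd h3 2
        have h5 : (w:ℤ) ^ 2 ∣ q := by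
          rw [hv, pow_two]; push_cast; exact mul_dvd_mul hwu hwv
        have h6 : (w:ℤ) ^ 2 ∣ 4 * ((s0:ℤ) ^ 2 - n) := (h5.trans hs0').mul_left 4
        have e : 4 * n = (2 * (s0:ℤ)) ^ 2 - 4 * ((s0:ℤ) ^ 2 - n) := by ring
        rw [e]; exact dvd_sub h4 h6
    refine le_trans ?_ hwW
    have hlcm : q = w * Nat.lcm u v := by rw [hv, hw, Nat.gcd_mul_lcm]
    refine le_trans (card_le_card ?_) (card_class_le q (Nat.lcm u v) w hlcm s1)
    intro s hs
    obtain ⟨h1, h2⟩ := hfib s1 hs1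
    obtain ⟨h3, h4⟩ := hfib s hs
    rw [mem_filter]
    refine ⟨(mem_filter.mp (mem_filter.mp hs).1).1, ?_⟩
    have d1 : (u:ℤ) ∣ (s:ℤ) - s1 := by
      have := dvd_sub h3 h1; simpa using this
    have d2 : (v:ℤ) ∣ (s:ℤ) - s1 := by
      have := dvd_sub h4 h2; simpa using this
    have := lcm_dvd d1 d2
    rw [← Int.natAbs_dvd_natAbs] at this ⊢
    simpa using Nat.lcm_dvd (by simpa using Int.natAbs_dvd_natAbs.mpr d1)
      (by simpa using Int.natAbs_dvd_natAbs.mpr d2)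

/-- labels -/
def labSet (n : ℤ) (Q : ℕ) : Finset (ℕ × ℕ) :=
  (Q.divisors ×ˢ range Q).filter (fun qr => qr.2 ∈ rootSet n qr.1)

def HasLabel (Q : ℕ) (y e : ℤ) (qr : ℕ × ℕ) : Prop :=
  ∃ (c : ℕ) (G y' e' : ℤ), Q = c * qr.1 ∧ y = G * y' ∧ e = G * e' ∧ (c:ℤ) ∣ G ^ 2 ∧
    (qr.1:ℤ) ∣ y' - qr.2 * e'

theorem label_exists (n : ℤ) (Q : ℕ) (hQ : 0 < Q) (y e : ℤ) (hye : ¬ (y = 0 ∧ e = 0))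
    (hdvd : (Q:ℤ) ∣ y ^ 2 - n * e ^ 2) : ∃ qr ∈ labSet n Q, HasLabel Q y e qr := by
  set G := Int.gcd y e with hG
  have hG0 : 0 < G := by
    rw [hG, Int.gcd_pos_iff]; by_contra h; push Not at h; exact hye h
  obtain ⟨y', hy'⟩ : (G:ℤ) ∣ y := Int.gcd_dvd_left _ _
  obtain ⟨e', he'⟩ : (G:ℤ) ∣ e := Int.gcd_dvd_right _ _
  have hcop : IsCoprime y' e' := by
    rw [Int.isCoprime_iff_gcd_eq_one]
    have h : Int.gcd (G * y') (G * e') = G := by rw [← hy', ← he']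
    rw [Int.gcd_mul_left] at h
    have : G * Int.gcd y' e' = G * 1 := by simpa using h
    exact Nat.eq_of_mul_eq_mul_left hG0 this
  set c := Nat.gcd Q (G ^ 2) with hc
  have hc0 : 0 < c := Nat.gcd_pos_of_pos_left _ hQ
  obtain ⟨q, hq⟩ : c ∣ Q := Nat.gcd_dvd_left _ _
  obtain ⟨g2, hg2⟩ : c ∣ G ^ 2 := Nat.gcd_dvd_right _ _
  have hq0 : 0 < q := by
    rcases Nat.eq_zero_or_pos q with h | h
    · subst h; simp at hq; omega
    · exact h
  have hqg : IsCoprime (q:ℤ) (g2:ℤ) := by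
    rw [Nat.isCoprime_iff_coprime]
    have : Nat.gcd (c * q) (c * g2) = c := by rw [← hq, ← hg2]
    rw [Nat.gcd_mul_left] at this
    exact Nat.eq_of_mul_eq_mul_left hc0 (by simpa using this)
  have hdv : (q:ℤ) ∣ y' ^ 2 - n * e' ^ 2 := by
    have e1 : y ^ 2 - n * e ^ 2 = (c:ℤ) * (g2 * (y' ^ 2 - n * e' ^ 2)) := by
      have : ((G:ℤ)) ^ 2 = c * g2 := by exact_mod_cast hg2
      rw [hy', he']
      linear_combination (y' ^ 2 - n * e' ^ 2) * this
    rw [e1, hq] at hdvd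
    push_cast at hdvd
    have := (mul_dvd_mul_iff_left (by exact_mod_cast hc0.ne')).mp hdvd
    exact hqg.dvd_of_dvd_mul_left this
  have hce : IsCoprime e' (q:ℤ) := by
    have h1 : IsCoprime e' (y' ^ 2) := hcop.symm.pow_right
    have h2 : IsCoprime e' (y' ^ 2 - n * e' ^ 2) := by
      have e1 : y' ^ 2 - n * e' ^ 2 = y' ^ 2 + e' * (-(n * e')) := by ring
      rw [e1]; exact h1.add_mul_left_right _
    exact h2.of_isCoprime_of_dvd_right hdv
  obtain ⟨a, b, hab⟩ := hce
  set r : ℕ := ((a * y') % q).toNat with hr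
  have hqz : (q:ℤ) ≠ 0 := by exact_mod_cast hq0.ne'
  have hr1 : (r:ℤ) = (a * y') % q := Int.toNat_of_nonneg (Int.emod_nonneg _ hqz)
  have hrq : r < q := by
    have : (r:ℤ) < q := by rw [hr1]; exact Int.emod_lt_of_pos _ (by exact_mod_cast hq0)
    exact_mod_cast this
  obtain ⟨m, hm⟩ : (q:ℤ) ∣ a * y' - r := by
    rw [hr1]; exact Int.dvd_self_sub_emod
  have hd1 : (q:ℤ) ∣ y' - r * e' := by
    refine ⟨y' * b + m * e', ?_⟩
    linear_combination (-y') * hab + e' * hm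
  have hd2 : (q:ℤ) ∣ (r:ℤ) ^ 2 - n := by
    have h3 : (q:ℤ) ∣ e' ^ 2 * ((r:ℤ) ^ 2 - n) := by
      have e1 : e' ^ 2 * ((r:ℤ) ^ 2 - n) = (y' ^ 2 - n * e' ^ 2) - (y' - r * e') * (y' + r * e') := by
        ring
      rw [e1]; exact dvd_sub hdv (hd1.mul_right _)
    have hce' : IsCoprime (q:ℤ) (e' ^ 2) := (IsCoprime.pow_left ⟨a, b, hab⟩).symm
    exact hce'.dvd_of_dvd_mul_left h3
  refine ⟨(q, r), ?_, c, G, y', e', hq, hy', he', by exact_mod_cast Dvd.intro _ hg2.symm, hd1⟩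
  unfold labSet rootSet
  simp only [mem_filter, mem_product, Nat.mem_divisors, mem_range]
  refine ⟨⟨⟨⟨c, by rw [hq, mul_comm]⟩, hQ.ne'⟩, ?_⟩, hrq, hd2⟩
  calc r < q := hrq
    _ ≤ Q := Nat.le_of_dvd hQ ⟨c, by rw [hq, mul_comm]⟩

theorem label_eq (Q : ℕ) (hQ : 0 < Q) (y₁ e₁ y₂ e₂ : ℤ) (qr : ℕ × ℕ) (h₁ : HasLabel Q y₁ e₁ qr)
    (h₂ : HasLabel Q y₂ e₂ qr) : (Q:ℤ) ∣ y₁ * e₂ - y₂ * e₁ := by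
  obtain ⟨c, G, y, e, hQ1, rfl, rfl, hc, hd⟩ := h₁
  obtain ⟨c2, G2, z, f, hQ2, rfl, rfl, hc2, hd2⟩ := h₂
  have hq0 : 0 < qr.1 := by
    rcases Nat.eq_zero_or_pos qr.1 with h | h
    · rw [h] at hQ1; omega
    · exact h
  have hcc : c = c2 := Nat.eq_of_mul_eq_mul_right hq0 (hQ1.symm.trans hQ2)
  subst hcc
  have h1 : (c:ℤ) ∣ G * G2 := by
    have : (c:ℤ) ^ 2 ∣ (G * G2) ^ 2 := by
      rw [mul_pow, pow_two (c:ℤ)]; exact mul_dvd_mul hc hc2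
    exact (Int.pow_dvd_pow_iff (by norm_num)).mp this
  have h2 : (qr.1:ℤ) ∣ y * f - z * e := by
    have e1 : y * f - z * e = (y - qr.2 * e) * f - (z - qr.2 * f) * e := by ring
    rw [e1]; exact dvd_sub (hd.mul_right _) (hd2.mul_right _)
  have e2 : G * y * (G2 * f) - G2 * z * (G * e) = G * G2 * (y * f - z * e) := by ring
  rw [e2, hQ1]
  push_cast
  exact mul_dvd_mul h1 h2

theorem labSet_card (n : ℤ) (Q : ℕ) (hQ : 0 < Q) (W : ℕ)
    (hW : ∀ w : ℕ, w ^ 2 ∣ Q → ((w:ℤ) ^ 2 ∣ 4 * n) → w ≤ W) :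
    (labSet n Q).card ≤ Q.divisors.card ^ 2 * W := by
  refine (card_le_mul_card_image_of_maps_to (f := Prod.fst) (t := Q.divisors) ?_
    (Q.divisors.card * W) ?_).trans (by rw [pow_two]; ring_nf; rfl)
  · intro qr h
    unfold labSet at h
    simp only [mem_filter, mem_product] at h
    exact h.1.1
  · intro q hq
    have hqQ := (Nat.mem_divisors.mp hq).1
    have hq0 : 0 < q := Nat.pos_of_dvd_of_pos hqQ hQ
    calc _ ≤ (rootSet n q).card := by
          refine card_le_card_of_injOn Prod.snd ?_ ?_
          · intro qr h
            simp only [labSet, coe_filter, mem_filter, Set.mem_ofPred_eq] at h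
            rw [← h.2]; exact h.1.2
          · intro qr h qr' h' hh
            simp only [labSet, coe_filter, mem_filter, Set.mem_ofPred_eq] at h h'
            exact Prod.ext (h.2.trans h'.2.symm) hh
      _ ≤ q.divisors.card * W := root_bound n q hq0 W fun w h1 h2 => hW w (h1.trans hqQ) h2
      _ ≤ _ := by
          gcongr
end E1148

namespace E1148
open Finset

def PairK (n : ℕ) (k a₁ x₁ a₂ x₂ : ℤ) : Prop :=
  IsP n a₁ x₁ ∧ IsP n a₂ x₂ ∧ (a₁ * x₂ - a₂ * x₁) ^ 2 - n * (a₁ - a₂) ^ 2 = -2 * k * a₁ * a₂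

theorem nonsq_zero (n : ℕ) (hsq : ¬ IsSquare n) (y e : ℤ) (h : y ^ 2 = n * e ^ 2) :
    y = 0 ∧ e = 0 := by
  by_cases he : e = 0
  · subst he; simpa using h
  exfalso
  apply hsq
  have h1 : e ^ 2 ∣ y ^ 2 := ⟨n, by rw [h]; ring⟩
  obtain ⟨w, hw⟩ := (Int.pow_dvd_pow_iff (by norm_num)).mp h1
  have h2 : (n:ℤ) = w * w := by
    have : e ^ 2 * (n:ℤ) = e ^ 2 * (w * w) := by
      rw [hw] at h; linear_combination -h
    exact mul_left_cancel₀ (pow_ne_zero 2 he) this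
  refine ⟨w.natAbs, ?_⟩
  zify
  rw [h2, abs_mul_abs_self]

theorem pair_exists (n : ℕ) (hsq : ¬ IsSquare n) (a₁ x₁ a₂ x₂ : ℤ) (h₁ : IsP n a₁ x₁)
    (h₂ : IsP n a₂ x₂) (hne : ¬ (a₁ = a₂ ∧ x₁ = x₂)) :
    ∃ k : ℤ, PairK n k a₁ x₁ a₂ x₂ ∧ k ≠ 0 ∧ -(n:ℤ) < k ∧ k < 4 * n ∧
      |bet n a₁ x₁ - bet n a₂ x₂|⁻¹ ≤ 2 * n / |(k:ℝ)| := by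
  have b₁ := h₁.bounds
  have b₂ := h₂.bounds
  obtain ⟨c₁, hc₁⟩ := h₁.2.2.2.1
  obtain ⟨c₂, hc₂⟩ := h₂.2.2.2.1
  have hk : PairK n (x₁ * x₂ + a₁ * c₂ + a₂ * c₁ - n) a₁ x₁ a₂ x₂ := by
    refine ⟨h₁, h₂, ?_⟩
    linear_combination (-a₁ ^ 2) * hc₂ + (-a₂ ^ 2) * hc₁
  obtain ⟨A₁, X₁, s₁, t₁, r₁⟩ := b₁
  obtain ⟨A₂, X₂, s₂, t₂, r₂⟩ := b₂
  have hss : √(n:ℝ) * √(n:ℝ) = n := Real.mul_self_sqrt (Nat.cast_nonneg n)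
  set s := √(n:ℝ) with hs
  have hs0 : 0 < s := by linarith
  have R₁ : (s - x₁) * (s + x₁) = 2 * a₁ * c₁ := by
    have : (n:ℝ) - x₁ ^ 2 = 2 * a₁ * c₁ := by exact_mod_cast hc₁
    linear_combination hss + this
  have R₂ : (s - x₂) * (s + x₂) = 2 * a₂ * c₂ := by
    have : (n:ℝ) - x₂ ^ 2 = 2 * a₂ * c₂ := by exact_mod_cast hc₂
    linear_combination hss + this
  have C₁ : (0:ℝ) < c₁ := by
    have : 0 < (s - x₁) * (s + x₁) := by apply mul_pos <;> linarith
    rw [R₁] at this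
    exact pos_of_mul_pos_right this (by linarith)
  have C₂ : (0:ℝ) < c₂ := by
    have : 0 < (s - x₂) * (s + x₂) := by apply mul_pos <;> linarith
    rw [R₂] at this
    exact pos_of_mul_pos_right this (by linarith)
  have C₁' : (c₁:ℝ) < s := by
    have : a₁ * (2 * (c₁:ℝ)) < a₁ * (s + x₁) := by
      have : (s - x₁) * (s + x₁) < a₁ * (s + x₁) := by
        apply mul_lt_mul_of_pos_right t₁; linarith
      linarith
    have := lt_of_mul_lt_mul_left this A₁.le
    linarith
  have C₂' : (c₂:ℝ) < s := by
    have : a₂ * (2 * (c₂:ℝ)) < a₂ * (s + x₂) := by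
      have : (s - x₂) * (s + x₂) < a₂ * (s + x₂) := by
        apply mul_lt_mul_of_pos_right t₂; linarith
      linarith
    have := lt_of_mul_lt_mul_left this A₂.le
    linarith
  generalize hkd : x₁ * x₂ + a₁ * c₂ + a₂ * c₁ - (n:ℤ) = k at hk
  have hkr : (k:ℝ) = x₁ * x₂ + a₁ * c₂ + a₂ * c₁ - n := by rw [← hkd]; push_cast; ring
  have hk0 : k ≠ 0 := by
    rintro rfl
    have h0 := hk.2.2
    obtain ⟨hy, he⟩ := nonsq_zero n hsq (a₁ * x₂ - a₂ * x₁) (a₁ - a₂) (by linarith)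
    apply hne
    have e1 : a₁ = a₂ := by linarith
    refine ⟨e1, ?_⟩
    rw [e1] at hy
    have : a₂ * (x₂ - x₁) = 0 := by linarith
    rcases mul_eq_zero.mp this with h | h
    · exact absurd h h₂.2.1.ne'
    · linarith
  refine ⟨k, hk, hk0, ?_, ?_, ?_⟩
  · have : -(n:ℝ) < k := by
      have := mul_pos X₁ X₂
      have := mul_pos A₁ C₂
      have := mul_pos A₂ C₁
      linarith
    exact_mod_cast this
  · have : (k:ℝ) < 4 * n := by
      have q1 : (x₁:ℝ) * x₂ < s * s := mul_lt_mul'' s₁ s₂ X₁.le X₂.le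
      have q2 : (a₁:ℝ) * c₂ < (2 * s) * s := mul_lt_mul'' (by linarith) C₂' A₁.le C₂.le
      have q3 : (a₂:ℝ) * c₁ < (2 * s) * s := mul_lt_mul'' (by linarith) C₁' A₂.le C₁.le
      linarith
    exact_mod_cast this
  · have hM1 : (a₁:ℝ) * (x₂ + s) < (2 * s) * (2 * s) :=
      mul_lt_mul'' (by linarith) (by linarith) A₁.le (by linarith)
    have hM2 : (a₂:ℝ) * (x₁ + s) < (2 * s) * (2 * s) :=
      mul_lt_mul'' (by linarith) (by linarith) A₂.le (by linarith)
    have hM1' : 0 < (a₁:ℝ) * (x₂ + s) := mul_pos A₁ (by linarith)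
    have hM2' : 0 < (a₂:ℝ) * (x₁ + s) := mul_pos A₂ (by linarith)
    set M : ℝ := a₁ * (x₂ + s) - a₂ * (x₁ + s) with hM
    have hMabs : |M| ≤ 4 * n := by
      rw [abs_le]; constructor <;> linarith
    have hprod : (bet n a₁ x₁ - bet n a₂ x₂) * M = -2 * k := by
      unfold bet
      rw [← hs, hkr, hM]
      have hc₁' : (n:ℝ) - x₁ ^ 2 = 2 * a₁ * c₁ := by exact_mod_cast hc₁
      have hc₂' : (n:ℝ) - x₂ ^ 2 = 2 * a₂ * c₂ := by exact_mod_cast hc₂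
      field_simp
      linear_combination (-(a₁:ℝ)^2 + 2 * a₁ * a₂ - a₂^2) * hss + (-(a₁:ℝ) ^ 2) * hc₂' + (-(a₂:ℝ) ^ 2) * hc₁'
    have hkr0 : 0 < |(k:ℝ)| := abs_pos.mpr (by exact_mod_cast hk0)
    have habs : |bet n a₁ x₁ - bet n a₂ x₂| * |M| = 2 * |(k:ℝ)| := by
      rw [← abs_mul, hprod, abs_mul]; norm_num
    have hb0 : 0 < |bet n a₁ x₁ - bet n a₂ x₂| := by
      rcases (abs_nonneg (bet n a₁ x₁ - bet n a₂ x₂)).eq_or_lt with h | h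
      · rw [← h] at habs; linarith
      · exact h
    rw [inv_le_comm₀ hb0 (by have : (0:ℝ) < n := by rw [← hss]; positivity
                             positivity), inv_div]
    rw [div_le_iff₀ (by have : (0:ℝ) < n := by rw [← hss]; positivity
                        positivity)]
    nlinarith

theorem pair_t {n : ℕ} {k a₁ x₁ a₂ x₂ : ℤ} (h : PairK n k a₁ x₁ a₂ x₂) (t : ℤ) (ht₁ : t ∣ a₁)
    (ht₂ : t ∣ a₂) : t ∣ k * (k + 2 * n) := by
  obtain ⟨h₁, h₂, h₃⟩ := h
  obtain ⟨c₁, hc₁⟩ := h₁.2.2.2.1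
  obtain ⟨c₂, hc₂⟩ := h₂.2.2.2.1
  have hk : k = x₁ * x₂ + a₁ * c₂ + a₂ * c₁ - n := by
    have h0 : (2 * a₁ * a₂) * k = (2 * a₁ * a₂) * (x₁ * x₂ + a₁ * c₂ + a₂ * c₁ - n) := by
      linear_combination h₃ + (a₁ ^ 2) * hc₂ + (a₂ ^ 2) * hc₁
    refine mul_left_cancel₀ ?_ h0
    have := h₁.2.1.ne'
    have := h₂.2.1.ne'
    positivity
  obtain ⟨α₁, e₁⟩ := ht₁
  obtain ⟨α₂, e₂⟩ := ht₂
  have e3 : (n:ℤ) = x₁ ^ 2 + 2 * (t * α₁) * c₁ := by rw [← e₁]; linarith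
  have e4 : (n:ℤ) = x₂ ^ 2 + 2 * (t * α₂) * c₂ := by rw [← e₂]; linarith
  have e5 : k * (k + 2 * n) = (x₁ * x₂ + t * (α₁ * c₂ + α₂ * c₁)) ^ 2
      - (x₁ ^ 2 + 2 * (t * α₁) * c₁) * (x₂ ^ 2 + 2 * (t * α₂) * c₂) := by
    rw [← e3, ← e4, hk, e₁, e₂]; ring
  rw [e5]
  exact ⟨2 * x₁ * x₂ * (α₁ * c₂ + α₂ * c₁) + t * (α₁ * c₂ + α₂ * c₁) ^ 2 - 2 * x₁ ^ 2 * α₂ * c₂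
    - 2 * α₁ * c₁ * x₂ ^ 2 - 4 * t * α₁ * c₁ * α₂ * c₂, by ring⟩

noncomputable def uu (n : ℕ) (a₁ x₁ a₂ x₂ : ℤ) : ℝ :=
  ((a₁ * x₂ - a₂ * x₁ : ℤ) - √(n:ℝ) * (a₁ - a₂)) / a₁

structure UFacts (n : ℕ) (k : ℤ) (s a₁ a₂ y u : ℝ) : Prop where
  a1 : 0 < a₁
  a2 : 0 < a₂
  y_eq : y = u * a₁ + s * (a₁ - a₂)
  u_ne : u ≠ 0
  c_ne : s * u - k ≠ 0
  rel : 2 * (s * u - k) * a₂ = (u ^ 2 + 2 * s * u) * a₁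
  ac : |a₁ / (s * u - k)| ≤ 4 / |u|
  lo : 1 / (2 * n) ≤ |u|
  hi : |u| ≤ 2 * n

theorem pair_u (n : ℕ) (k a₁ x₁ a₂ x₂ : ℤ) (h : PairK n k a₁ x₁ a₂ x₂) (hk : k ≠ 0) :
    UFacts n k (√(n:ℝ)) a₁ a₂ ((a₁ * x₂ - a₂ * x₁ : ℤ)) (uu n a₁ x₁ a₂ x₂) := by
  obtain ⟨h₁, h₂, h₃⟩ := h
  obtain ⟨A₁, X₁, s₁, t₁, r₁⟩ := h₁.bounds
  obtain ⟨A₂, X₂, s₂, t₂, r₂⟩ := h₂.bounds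
  have hss : √(n:ℝ) * √(n:ℝ) = n := Real.mul_self_sqrt (Nat.cast_nonneg n)
  obtain ⟨u, hu⟩ : ∃ u, u = uu n a₁ x₁ a₂ x₂ := ⟨_, rfl⟩
  rw [← hu]
  unfold uu at hu
  have h₃' : ((a₁:ℝ) * x₂ - a₂ * x₁) ^ 2 - n * (a₁ - a₂) ^ 2 = -2 * k * a₁ * a₂ := by
    exact_mod_cast h₃
  push_cast at hu ⊢
  set s := √(n:ℝ) with hs
  have hs0 : 0 < s := by linarith
  have hyu : (a₁:ℝ) * x₂ - a₂ * x₁ = u * a₁ + s * (a₁ - a₂) := by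
    rw [hu]; field_simp; ring
  have hn0 : (0:ℝ) < n := by rw [← hss]; positivity
  have hn1 : (1:ℝ) ≤ n := by exact_mod_cast (by exact_mod_cast hn0 : 0 < n)
  have hk' : (k:ℝ) ≠ 0 := by exact_mod_cast hk
  have hrel : 2 * (s * u - k) * a₂ = (u ^ 2 + 2 * s * u) * a₁ := by
    have : (a₁:ℝ) * (2 * (s * u - k) * a₂) = a₁ * ((u ^ 2 + 2 * s * u) * a₁) := by
      rw [hyu] at h₃'
      linear_combination -h₃' + (((a₁:ℝ) - a₂) ^ 2) * hss
    exact mul_left_cancel₀ A₁.ne' this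
  set M : ℝ := a₁ * (x₂ + s) - a₂ * (x₁ + s) with hM
  have huM : u * M = -2 * k * a₂ := by
    have : (a₁:ℝ) * (u * M) = a₁ * (-2 * k * a₂) := by
      have e : (a₁:ℝ) * u = a₁ * x₂ - a₂ * x₁ - s * (a₁ - a₂) := by linarith
      rw [← mul_assoc, e, hM]
      linear_combination h₃' + (-((a₁:ℝ) - a₂) ^ 2) * hss
    exact mul_left_cancel₀ A₁.ne' this
  have hu0 : u ≠ 0 := by
    rintro rfl
    rw [zero_mul] at huM
    have : (-2 * k * a₂ : ℝ) ≠ 0 := by positivity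
    exact this huM.symm
  set w : ℝ := a₁ * (x₂ + s) + a₂ * (s - x₁) with hw
  have hw1 : a₁ * s ≤ w := by
    have q1 : 0 < (a₁:ℝ) * x₂ := mul_pos A₁ X₂
    have q2 : 0 < a₂ * (s - x₁) := mul_pos A₂ (by linarith)
    rw [hw]; linarith
  have hw0 : 0 < w := lt_of_lt_of_le (mul_pos A₁ hs0) hw1
  have hcw : (s * u - k) * (2 * a₂) = u * w := by
    have : w = M + 2 * s * a₂ := by rw [hw, hM]; ring
    rw [this, mul_add, huM]; ring
  have hc0 : s * u - k ≠ 0 := by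
    intro h
    rw [h, zero_mul] at hcw
    exact (mul_ne_zero hu0 hw0.ne') hcw.symm
  have hM1 : (a₁:ℝ) * (x₂ + s) < (2 * s) * (2 * s) :=
    mul_lt_mul'' (by linarith) (by linarith) A₁.le (by linarith)
  have hM2 : (a₂:ℝ) * (x₁ + s) < (2 * s) * (2 * s) :=
    mul_lt_mul'' (by linarith) (by linarith) A₂.le (by linarith)
  have hM1' : 0 < (a₁:ℝ) * (x₂ + s) := mul_pos A₁ (by linarith)
  have hM2' : 0 < (a₂:ℝ) * (x₁ + s) := mul_pos A₂ (by linarith)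
  have hMabs : |M| ≤ 4 * n := by
    rw [abs_le]; constructor <;> linarith
  have hk1 : (1:ℝ) ≤ |(k:ℝ)| := by exact_mod_cast Int.one_le_abs hk
  have ha21 : (1:ℝ) ≤ a₂ := by exact_mod_cast h₂.2.1
  have hupos : 0 < |u| := abs_pos.mpr hu0
  refine ⟨A₁, A₂, hyu, hu0, hc0, hrel, ?_, ?_, ?_⟩
  · rw [abs_div, abs_of_pos A₁, div_le_div_iff₀ (abs_pos.mpr hc0) hupos]
    have e : |s * u - k| * (2 * a₂) = |u| * w := by
      rw [← abs_of_pos hw0, ← abs_mul, ← hcw, abs_mul, abs_of_pos (by linarith : (0:ℝ) < 2 * a₂)]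
    have e2 : |u| * (a₁ * s) ≤ |s * u - k| * (2 * (2 * s)) := by
      calc |u| * (a₁ * s) ≤ |u| * w := by gcongr
        _ = |s * u - k| * (2 * a₂) := e.symm
        _ ≤ _ := by gcongr; linarith
    have : (a₁ * |u|) * s ≤ (4 * |s * u - k|) * s := by linarith
    exact le_of_mul_le_mul_right this hs0
  · have e : |u| * |M| = 2 * |(k:ℝ)| * a₂ := by
      rw [← abs_mul, huM, abs_mul, abs_mul, abs_of_pos A₂]; norm_num
    rw [div_le_iff₀ (by positivity)]
    have : |u| * |M| ≤ |u| * (4 * n) := by gcongr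
    nlinarith
  · -- u = a₂ (β₁ - β₂)
    have e : u * a₁ = a₂ * (s - x₁) - a₁ * (s - x₂) := by linarith
    have q1 : a₂ * (s - x₁) < a₂ * a₁ := by gcongr
    have q2 : 0 < a₂ * (s - x₁) := mul_pos A₂ (by linarith)
    have q3 : a₁ * (s - x₂) < a₁ * a₂ := by gcongr
    have q4 : 0 < a₁ * (s - x₂) := mul_pos A₁ (by linarith)
    have q5 : |u| * a₁ ≤ a₂ * a₁ := by
      rw [← abs_of_pos A₁, ← abs_mul, e, abs_of_pos A₁, abs_le]
      constructor <;> linarith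
    have q6 : |u| ≤ a₂ := le_of_mul_le_mul_right q5 A₁
    have q8 : 1 ≤ s := Real.one_le_sqrt.mpr hn1
    have q7 : s ≤ n := by
      rw [← hss]; exact le_mul_of_one_le_left hs0.le q8
    linarith

theorem det_identity (n : ℕ) (k : ℤ) (s a b y u a' b' y' u' a'' b'' y'' u'' : ℝ)
    (hs : s * s = n) (h : UFacts n k s a b y u) (h' : UFacts n k s a' b' y' u')
    (h'' : UFacts n k s a'' b'' y'' u'') :
    (y * ((a' - b') * (a'' + b'') - (a'' - b'') * (a' + b'))
      - y' * ((a - b) * (a'' + b'') - (a'' - b'') * (a + b))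
      + y'' * ((a - b) * (a' + b') - (a' - b') * (a + b))) *
      ((s * u - k) * (s * u' - k) * (s * u'' - k))
    = -(k * (k + 2 * n)) * ((u - u') * (u' - u'') * (u'' - u)) * (a * a' * a'') := by
  rw [← hs, h.y_eq, h'.y_eq, h''.y_eq]
  have r := h.rel
  have r' := h'.rel
  have r'' := h''.rel
  linear_combination ((a' * (s * u' - k)) * (a'' * (s * u'' - k)) * (u' - u'')) * r
    + ((a * (s * u - k)) * (a'' * (s * u'' - k)) * (u'' - u)) * r'
    + ((a * (s * u - k)) * (a' * (s * u' - k)) * (u - u')) * r''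

end E1148

namespace E1148
open Finset

abbrev Pr := (ℤ × ℤ) × (ℤ × ℤ)

def Pr.y (p : Pr) : ℤ := p.1.1 * p.2.2 - p.2.1 * p.1.2
def Pr.e (p : Pr) : ℤ := p.1.1 - p.2.1
def Pr.X (p : Pr) : ℤ := p.1.1 + p.2.1
noncomputable def Pr.u (n : ℕ) (p : Pr) : ℝ := uu n p.1.1 p.1.2 p.2.1 p.2.2
def Pr.K (n : ℕ) (k : ℤ) (p : Pr) : Prop := PairK n k p.1.1 p.1.2 p.2.1 p.2.2

theorem Pr.K.facts {n : ℕ} {k : ℤ} {p : Pr} (h : p.K n k) (hk : k ≠ 0) :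
    UFacts n k (√(n:ℝ)) p.1.1 p.2.1 p.y (p.u n) := pair_u n k _ _ _ _ h hk

theorem near_of_sector (u v δ : ℝ) (hδ : 0 < δ) (hδ1 : δ ≤ 1) (hu : u ≠ 0) (hv : v ≠ 0)
    (hsign : 0 < u ↔ 0 < v) (hfl : ⌊Real.log |u| / δ⌋ = ⌊Real.log |v| / δ⌋) :
    |u - v| ≤ 2 * δ * |u| := by
  have h1 := Int.abs_sub_lt_one_of_floor_eq_floor hfl
  have h2 : |(Real.log |v|) - (Real.log |u|)| ≤ δ := by
    rw [← sub_div, abs_div, abs_of_pos hδ, div_lt_one hδ] at h1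
    rw [abs_sub_comm]; exact h1.le
  have h3 := Real.abs_exp_sub_one_le (x := Real.log |v| - Real.log |u|) (h2.trans hδ1)
  have hu' : 0 < |u| := abs_pos.mpr hu
  have hv' : 0 < |v| := abs_pos.mpr hv
  rw [Real.exp_sub, Real.exp_log hu', Real.exp_log hv'] at h3
  have h4 : |v| / |u| = v / u := by
    rcases lt_or_gt_of_ne hu with h | h
    · have hv2 : v < 0 := by
        rcases lt_or_gt_of_ne hv with h' | h'
        · exact h'
        · exact absurd (hsign.mpr h') (by linarith)
      rw [abs_of_neg h, abs_of_neg hv2, neg_div_neg_eq]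
    · rw [abs_of_pos h, abs_of_pos (hsign.mp h)]
  rw [h4] at h3
  have h5 : |u - v| = |v / u - 1| * |u| := by
    rw [← abs_mul, abs_sub_comm]; congr 1; field_simp
  rw [h5]
  have : |v / u - 1| ≤ 2 * δ := h3.trans (by linarith)
  gcongr

theorem cell_lemma (n : ℕ) (k : ℤ) (hk : k ≠ 0) (hh : 0 < k + 2 * (n:ℤ)) (Q₁ Q₂ g : ℕ) (hg : 0 < g)
    (hcop : Nat.Coprime Q₁ Q₂) (hQ₁ : 0 < Q₁) (hQ₂ : 0 < Q₂)
    (hprod : ((Q₁ * Q₂ * g : ℕ):ℤ) = |k| * (k + 2 * n))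
    (δ : ℝ) (hδ : δ = 1 / (9 * √(g:ℝ)))
    (p p' p'' : Pr) (h : p.K n k) (h' : p'.K n k) (h'' : p''.K n k) (l₁ l₂ : ℕ × ℕ)
    (a₁ : HasLabel Q₁ p.y p.e l₁) (a₁' : HasLabel Q₁ p'.y p'.e l₁) (a₁'' : HasLabel Q₁ p''.y p''.e l₁)
    (a₂ : HasLabel Q₂ p.y p.X l₂) (a₂' : HasLabel Q₂ p'.y p'.X l₂) (a₂'' : HasLabel Q₂ p''.y p''.X l₂)
    (n₁ : |p.u n - p'.u n| ≤ 2 * δ * |p.u n|) (n₂ : |p'.u n - p''.u n| ≤ 2 * δ * |p'.u n|)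
    (n₃ : |p''.u n - p.u n| ≤ 2 * δ * |p''.u n|) :
    p.u n = p'.u n ∨ p'.u n = p''.u n ∨ p''.u n = p.u n := by
  have f := h.facts hk
  have f' := h'.facts hk
  have f'' := h''.facts hk
  by_contra hcon
  push Not at hcon
  obtain ⟨ne1, ne2, ne3⟩ := hcon
  obtain ⟨D, hD⟩ : ∃ D : ℤ, D = p.y * (p'.e * p''.X - p''.e * p'.X)
      - p'.y * (p.e * p''.X - p''.e * p.X) + p''.y * (p.e * p'.X - p'.e * p.X) := ⟨_, rfl⟩
  have hd1 : (Q₁:ℤ) ∣ D := by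
    have m1 := label_eq Q₁ hQ₁ _ _ _ _ l₁ a₁ a₁'
    have m2 := label_eq Q₁ hQ₁ _ _ _ _ l₁ a₁ a₁''
    have m3 := label_eq Q₁ hQ₁ _ _ _ _ l₁ a₁' a₁''
    have : D = (p.y * p'.e - p'.y * p.e) * p''.X - (p.y * p''.e - p''.y * p.e) * p'.X
        + (p'.y * p''.e - p''.y * p'.e) * p.X := by rw [hD]; ring
    rw [this]
    exact dvd_add (dvd_sub (m1.mul_right _) (m2.mul_right _)) (m3.mul_right _)
  have hd2 : (Q₂:ℤ) ∣ D := by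
    have m1 := label_eq Q₂ hQ₂ _ _ _ _ l₂ a₂ a₂'
    have m2 := label_eq Q₂ hQ₂ _ _ _ _ l₂ a₂ a₂''
    have m3 := label_eq Q₂ hQ₂ _ _ _ _ l₂ a₂' a₂''
    have : D = (p.y * p''.X - p''.y * p.X) * p'.e - (p.y * p'.X - p'.y * p.X) * p''.e
        - (p'.y * p''.X - p''.y * p'.X) * p.e := by rw [hD]; ring
    rw [this]
    exact dvd_sub (dvd_sub (m2.mul_right _) (m1.mul_right _)) (m3.mul_right _)
  have hd : ((Q₁:ℤ) * Q₂) ∣ D :=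
    IsCoprime.mul_dvd (Nat.isCoprime_iff_coprime.mpr hcop) hd1 hd2
  have hs : √(n:ℝ) * √(n:ℝ) = n := Real.mul_self_sqrt (Nat.cast_nonneg n)
  have key := det_identity n k _ _ _ _ _ _ _ _ _ _ _ _ _ hs f f' f''
  set s := √(n:ℝ)
  have hDr : (D:ℝ) = (p.y * (((p'.1.1:ℝ) - p'.2.1) * (p''.1.1 + p''.2.1) - (p''.1.1 - p''.2.1) * (p'.1.1 + p'.2.1))
      - p'.y * ((p.1.1 - p.2.1) * (p''.1.1 + p''.2.1) - (p''.1.1 - p''.2.1) * (p.1.1 + p.2.1))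
      + p''.y * ((p.1.1 - p.2.1) * (p'.1.1 + p'.2.1) - (p'.1.1 - p'.2.1) * (p.1.1 + p.2.1))) := by
    rw [hD]; simp only [Pr.e, Pr.X]; push_cast; ring
  rw [← hDr] at key
  generalize Pr.u n p = u at *
  generalize Pr.u n p' = u' at *
  generalize Pr.u n p'' = u'' at *
  have hkr : (k:ℝ) ≠ 0 := by exact_mod_cast hk
  have hhr : (0:ℝ) < k + 2 * n := by exact_mod_cast hh
  have hD0 : D ≠ 0 := by
    rintro rfl
    have h1 : (k * (k + 2 * n) : ℝ) ≠ 0 := mul_ne_zero hkr hhr.ne'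
    have h2 : (u - u') * (u' - u'') * (u'' - u) ≠ 0 :=
      mul_ne_zero (mul_ne_zero (sub_ne_zero.mpr ne1) (sub_ne_zero.mpr ne2)) (sub_ne_zero.mpr ne3)
    have h3 : ((p.1.1:ℝ) * p'.1.1 * p''.1.1) ≠ 0 :=
      (mul_pos (mul_pos f.a1 f'.a1) f''.a1).ne'
    rw [Int.cast_zero, zero_mul] at key
    exact (mul_ne_zero (mul_ne_zero (neg_ne_zero.mpr h1) h2) h3) key.symm
  have hDge : ((Q₁ * Q₂ : ℕ):ℝ) ≤ |(D:ℝ)| := by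
    have := Int.le_of_dvd (abs_pos.mpr hD0) ((dvd_abs _ _).mpr hd)
    exact_mod_cast this
  have hc := f.c_ne
  have hc' := f'.c_ne
  have hc'' := f''.c_ne
  have hDeq : (D:ℝ) = -(k * (k + 2 * n)) * ((u - u') * (u' - u'') * (u'' - u)) *
      ((p.1.1 / (s * u - k)) * (p'.1.1 / (s * u' - k)) * (p''.1.1 / (s * u'' - k))) := by
    rw [div_mul_div_comm, div_mul_div_comm, ← mul_div_assoc,
      eq_div_iff (mul_ne_zero (mul_ne_zero hc hc') hc'')]
    exact key
  have up := abs_pos.mpr f.u_ne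
  have up' := abs_pos.mpr f'.u_ne
  have up'' := abs_pos.mpr f''.u_ne
  have hδ0 : 0 < δ := by rw [hδ]; positivity
  have hDle : |(D:ℝ)| ≤ (|(k:ℝ)| * (k + 2 * n)) * (512 * δ ^ 3) := by
    rw [hDeq]
    simp only [abs_mul, abs_neg]
    rw [abs_of_pos hhr]
    calc _ ≤ |(k:ℝ)| * (k + 2 * n) * ((2 * δ * |u|) * (2 * δ * |u'|) * (2 * δ * |u''|)) *
          ((4 / |u|) * (4 / |u'|) * (4 / |u''|)) := by
          gcongr
          · exact f.ac
          · exact f'.ac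
          · exact f''.ac
      _ = _ := by field_simp; ring
  have hgr : (0:ℝ) < g := by exact_mod_cast hg
  have hprodr : ((Q₁ * Q₂ : ℕ):ℝ) * g = |(k:ℝ)| * (k + 2 * n) := by
    exact_mod_cast hprod
  rw [← hprodr] at hDle
  have hQQ : (0:ℝ) < ((Q₁ * Q₂ : ℕ):ℝ) := by exact_mod_cast Nat.mul_pos hQ₁ hQ₂
  have hsmall : (g:ℝ) * (512 * δ ^ 3) < 1 := by
    have hsg : √(g:ℝ) * √(g:ℝ) = g := Real.mul_self_sqrt hgr.le
    have hsg1 : 1 ≤ √(g:ℝ) := Real.one_le_sqrt.mpr (by exact_mod_cast hg)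
    have e : (g:ℝ) * (512 * δ ^ 3) = 512 / 729 / √(g:ℝ) := by
      rw [hδ]
      nth_rewrite 1 [← hsg]
      field_simp
      norm_num
    rw [e, div_lt_one (by linarith)]
    linarith
  have : ((Q₁ * Q₂ : ℕ):ℝ) * ((g:ℝ) * (512 * δ ^ 3)) < ((Q₁ * Q₂ : ℕ):ℝ) * 1 := by gcongr
  linarith

theorem dir_lemma (n : ℕ) (k : ℤ) (hk : k ≠ 0) (p p' : Pr) (h : p.K n k) (h' : p'.K n k)
    (hu : p.u n = p'.u n) (ht : Int.gcd p.1.1 p.2.1 = Int.gcd p'.1.1 p'.2.1) :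
    p.1.1 = p'.1.1 ∧ p.2.1 = p'.2.1 ∧ p.y = p'.y := by
  have f := h.facts hk
  have f' := h'.facts hk
  have r1 := f.rel
  have r2 := f'.rel
  have cr : (p.2.1:ℝ) * p'.1.1 = p'.2.1 * p.1.1 := by
    rw [← hu] at r2
    have : 2 * (√(n:ℝ) * p.u n - k) * ((p.2.1:ℝ) * p'.1.1) =
        2 * (√(n:ℝ) * p.u n - k) * (p'.2.1 * p.1.1) := by
      linear_combination (p'.1.1:ℝ) * r1 - (p.1.1:ℝ) * r2
    exact mul_left_cancel₀ (mul_ne_zero two_ne_zero f.c_ne) this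
  have cr' : p.2.1 * p'.1.1 = p'.2.1 * p.1.1 := by exact_mod_cast cr
  have A : 0 < p.1.1 := h.1.2.1
  have A' : 0 < p'.1.1 := h'.1.2.1
  have e1 : p.1.1 = p'.1.1 := by
    have c1 : Int.gcd (p.1.1 * p'.1.1) (p.1.1 * p'.2.1) = p.1.1.natAbs * Int.gcd p'.1.1 p'.2.1 :=
      Int.gcd_mul_left _ _ _
    have c2 : Int.gcd (p'.1.1 * p.1.1) (p'.1.1 * p.2.1) = p'.1.1.natAbs * Int.gcd p.1.1 p.2.1 :=
      Int.gcd_mul_left _ _ _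
    have c3 : p.1.1 * p'.2.1 = p'.1.1 * p.2.1 := by linarith
    rw [c3, mul_comm, c2, ht] at c1
    have hpos : 0 < Int.gcd p'.1.1 p'.2.1 := Int.gcd_pos_of_ne_zero_left _ A'.ne'
    have := Nat.eq_of_mul_eq_mul_right hpos c1
    omega
  have e2 : p.2.1 = p'.2.1 := by
    rw [e1] at cr'
    exact mul_right_cancel₀ A'.ne' cr'
  refine ⟨e1, e2, ?_⟩
  have y1 := f.y_eq
  have y2 := f'.y_eq
  rw [e1, e2, hu, ← y2] at y1
  exact_mod_cast y1
end E1148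

namespace E1148
open Finset

theorem fibx (n : ℕ) (k : ℤ) (T : Finset Pr) (hT : ∀ p ∈ T, p.K n k) (A : ℕ) (B Y : ℤ)
    (hA : ∀ p ∈ T, p.1.1 = A ∧ p.2.1 = B ∧ p.y = Y) (Z : ℕ)
    (hZ : ∀ w : ℕ, w ^ 2 ∣ A → w ^ 2 ∣ n → w ≤ Z) :
    #T ≤ A.divisors.card * Z := by
  rcases T.eq_empty_or_nonempty with h | ⟨p₀, hp₀⟩
  · simp [h]
  have hA0 : 0 < A := by
    have h1 := (hT p₀ hp₀).1.2.1
    rw [(hA p₀ hp₀).1] at h1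
    exact_mod_cast h1
  have hAodd : Odd A := by
    have h1 := (hT p₀ hp₀).1.1
    rw [(hA p₀ hp₀).1] at h1
    exact_mod_cast h1
  have hroot : #(rootSet n A) ≤ A.divisors.card * Z := by
    refine root_bound n A hA0 Z fun w hw1 hw2 => hZ w hw1 ?_
    have hwo : Odd w := by
      have := Odd.of_dvd_nat hAodd hw1
      exact (Nat.odd_pow_iff (by norm_num)).mp this
    have hc : Nat.Coprime (w ^ 2) 4 := by
      have : Nat.Coprime w 2 := hwo.coprime_two_right
      exact Nat.Coprime.pow 2 2 this
    have hw3 : w ^ 2 ∣ 4 * n := by exact_mod_cast hw2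
    exact hc.dvd_of_dvd_mul_left hw3
  refine le_trans ?_ hroot
  have hAz : (0:ℤ) < A := by exact_mod_cast hA0
  refine card_le_card_of_injOn (fun p => (p.1.2 % A).toNat) ?_ ?_
  · intro p hp
    have hp' := hp
    simp only [mem_coe] at hp'
    have hd := (hT p hp').1.2.2.2.1
    rw [(hA p hp').1] at hd
    have h1 : (((p.1.2 % A).toNat : ℕ) : ℤ) = p.1.2 % A :=
      Int.toNat_of_nonneg (Int.emod_nonneg _ hAz.ne')
    simp only [rootSet, coe_filter, mem_range, Set.mem_ofPred_eq, h1]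
    constructor
    · have := Int.emod_lt_of_pos p.1.2 hAz
      omega
    · have h2 : (A:ℤ) ∣ n - p.1.2 ^ 2 := (Dvd.intro_left _ rfl).trans hd
      obtain ⟨m, hm⟩ : (A:ℤ) ∣ p.1.2 - p.1.2 % A := Int.dvd_self_sub_emod
      have e : (p.1.2 % A) ^ 2 - (n:ℤ) = -(n - p.1.2 ^ 2) - A * (m * (p.1.2 + p.1.2 % A)) := by
        linear_combination (-(p.1.2 + p.1.2 % (A:ℤ))) * hm
      rw [e]
      exact dvd_sub ((dvd_neg).mpr h2) (Dvd.intro _ rfl)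
  · intro p hp p' hp' h
    simp only [mem_coe] at hp hp'
    simp only at h
    have a1 := Int.emod_nonneg p.1.2 hAz.ne'
    have a2 := Int.emod_nonneg p'.1.2 hAz.ne'
    have h1 : p.1.2 % A = p'.1.2 % A := by omega
    obtain ⟨e1, e2, e3⟩ := hA p hp
    obtain ⟨f1, f2, f3⟩ := hA p' hp'
    have hP := (hT p hp).1
    have hP' := (hT p' hp').1
    have hx : p.1.2 = p'.1.2 := by
      obtain ⟨m, hm⟩ : (A:ℤ) ∣ p.1.2 - p'.1.2 := Int.ModEq.dvd h1.symm
      have x0 := hP.2.2.1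
      have x0' := hP'.2.2.1
      have y1 := hP.2.2.2.2.1
      have y1' := hP'.2.2.2.2.1
      have y2 := hP.2.2.2.2.2.1
      have y2' := hP'.2.2.2.2.2.1
      rw [e1] at y2
      rw [f1] at y2'
      have hm0 : m = 0 := by
        by_contra hne
        rcases lt_or_gt_of_ne hne with h | h
        · have : p'.1.2 ≥ A + p.1.2 := by nlinarith
          nlinarith
        · have : p.1.2 ≥ A + p'.1.2 := by nlinarith
          nlinarith
      rw [hm0] at hm; linarith
    have hx2 : p.2.2 = p'.2.2 := by
      have : p.y = p'.y := by rw [e3, f3]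
      unfold Pr.y at this
      rw [e1, e2, f1, f2, hx] at this
      have : (A:ℤ) * p.2.2 = A * p'.2.2 := by linarith
      exact mul_left_cancel₀ hAz.ne' this
    exact Prod.ext (Prod.ext (by rw [e1, f1]) hx) (Prod.ext (by rw [e2, f2]) hx2)

/-- number of pairs with the same `u` -/
theorem fibu (n : ℕ) (k : ℤ) (hk : k ≠ 0) (hh : k + 2 * (n:ℤ) ≠ 0) (T : Finset Pr)
    (hT : ∀ p ∈ T, p.K n k) (v : ℝ) (hv : ∀ p ∈ T, p.u n = v) (Z Tb : ℕ)
    (hZ : ∀ p ∈ T, ∀ w : ℕ, ((w:ℤ) ^ 2 ∣ p.1.1) → w ^ 2 ∣ n → w ≤ Z)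
    (hTb : (k * (k + 2 * n)).natAbs.divisors.card ≤ Tb)
    (hTb2 : ∀ p ∈ T, p.1.1.natAbs.divisors.card ≤ Tb) :
    #T ≤ (Tb * Z) * Tb := by
  refine (card_le_mul_card_image_of_maps_to (f := fun p : Pr => Int.gcd p.1.1 p.2.1)
    (t := (k * (k + 2 * n)).natAbs.divisors) ?_ (Tb * Z) ?_).trans (by gcongr)
  · intro p hp
    rw [Nat.mem_divisors]
    refine ⟨?_, by simpa using ⟨hk, hh⟩⟩
    have := pair_t (hT p hp) (Int.gcd p.1.1 p.2.1) (Int.gcd_dvd_left _ _) (Int.gcd_dvd_right _ _)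
    exact Int.natCast_dvd.mp this
  · intro t _
    rcases (T.filter (fun p : Pr => Int.gcd p.1.1 p.2.1 = t)).eq_empty_or_nonempty with h | ⟨p₀, hp₀⟩
    · rw [h]; simp
    have hp₀' := mem_filter.mp hp₀
    have ha0 := (hT p₀ hp₀'.1).1.2.1
    have hcast : ((p₀.1.1.natAbs : ℕ) : ℤ) = p₀.1.1 := Int.natAbs_of_nonneg ha0.le
    refine (fibx n k _ (fun p hp => hT p (mem_filter.mp hp).1) p₀.1.1.natAbs p₀.2.1 p₀.y ?_ Z ?_).trans ?_
    · intro p hp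
      have hp' := mem_filter.mp hp
      rw [hcast]
      exact dir_lemma n k hk p p₀ (hT p hp'.1) (hT p₀ hp₀'.1)
        ((hv p hp'.1).trans (hv p₀ hp₀'.1).symm) (hp'.2.trans hp₀'.2.symm)
    · intro w h1 h2
      refine hZ p₀ hp₀'.1 w ?_ h2
      rw [← hcast]; exact_mod_cast h1
    · gcongr
      exact hTb2 p₀ hp₀'.1
end E1148

namespace E1148
open Finset

theorem exists_maxW (Q m : ℕ) (hQ : 0 < Q) : ∃ W : ℕ, W ^ 2 ∣ Q ∧ W ^ 2 ∣ m ∧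
    ∀ w : ℕ, w ^ 2 ∣ Q → w ^ 2 ∣ m → w ≤ W := by
  classical
  refine ⟨Nat.findGreatest (fun w => w ^ 2 ∣ Q ∧ w ^ 2 ∣ m) Q, ?_, ?_, ?_⟩
  · exact (Nat.findGreatest_spec (P := fun w => w ^ 2 ∣ Q ∧ w ^ 2 ∣ m) (m := 1) hQ (by simp)).1
  · exact (Nat.findGreatest_spec (P := fun w => w ^ 2 ∣ Q ∧ w ^ 2 ∣ m) (m := 1) hQ (by simp)).2
  · intro w h1 h2
    refine Nat.le_findGreatest ?_ ⟨h1, h2⟩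
    exact (Nat.le_self_pow (by norm_num) w).trans (Nat.le_of_dvd hQ h1)

theorem two_vals {α : Type*} (C : Finset α) (u : α → ℝ) (B : ℕ)
    (h3 : ∀ p ∈ C, ∀ q ∈ C, ∀ r ∈ C, u p = u q ∨ u q = u r ∨ u r = u p)
    (hB : ∀ v, #(C.filter (fun p => u p = v)) ≤ B) : #C ≤ B * 2 := by
  classical
  refine (card_le_mul_card_image (f := u) C B (fun v _ => hB v)).trans ?_
  gcongr
  by_contra hcon
  push Not at hcon
  obtain ⟨a, ha, b, hb, c, hc, hab, hac, hbc⟩ := two_lt_card.mp hcon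
  obtain ⟨p, hp, rfl⟩ := mem_image.mp ha
  obtain ⟨q, hq, rfl⟩ := mem_image.mp hb
  obtain ⟨r, hr, rfl⟩ := mem_image.mp hc
  rcases h3 p hp q hq r hr with h | h | h
  · exact hab h
  · exact hbc h
  · exact hac h.symm

theorem cells_card (L g : ℝ) (hL : 0 ≤ L) (hg : 1 ≤ g) (δ : ℝ) (hδ : δ = 1 / (9 * √g)) :
    ((#(Icc ⌊-L / δ⌋ ⌊L / δ⌋) : ℕ) : ℝ) ≤ 18 * √g * (1 + L) := by
  have hs : 1 ≤ √g := Real.one_le_sqrt.mpr hg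
  have h1 : L / δ = 9 * √g * L := by rw [hδ]; field_simp
  have h2 : -L / δ = -(9 * √g * L) := by rw [neg_div, h1]
  rw [h1, h2, Int.card_Icc]
  have a1 := Int.floor_le (9 * √g * L)
  have a2 := Int.lt_floor_add_one (-(9 * √g * L))
  have h0 : 0 ≤ 9 * √g * L := by positivity
  have a3 : ⌊-(9 * √g * L)⌋ ≤ ⌊9 * √g * L⌋ := Int.floor_mono (by linarith)
  have : (((⌊9 * √g * L⌋ + 1 - ⌊-(9 * √g * L)⌋).toNat : ℕ) : ℝ)
      = (⌊9 * √g * L⌋ : ℝ) + 1 - (⌊-(9 * √g * L)⌋:ℝ) := by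
    have h : (((⌊9 * √g * L⌋ + 1 - ⌊-(9 * √g * L)⌋).toNat : ℕ) : ℤ)
      = ⌊9 * √g * L⌋ + 1 - ⌊-(9 * √g * L)⌋ := Int.toNat_of_nonneg (by linarith)
    exact_mod_cast h
  rw [this]
  nlinarith

set_option maxHeartbeats 1000000 in
theorem pair_count (n : ℕ) (hn : 0 < n) (k : ℤ) (hk : k ≠ 0) (hk1 : -(n:ℤ) < k) (hk2 : k < 4 * n)
    (Tb Z : ℕ) (hTb : ∀ m : ℕ, 0 < m → m ≤ 24 * n ^ 2 → m.divisors.card ≤ Tb) (T : Finset Pr)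
    (hT : ∀ p ∈ T, p.K n k)
    (hZ : ∀ p ∈ T, ∀ w : ℕ, ((w:ℤ) ^ 2 ∣ p.1.1) → w ^ 2 ∣ n → w ≤ Z) :
    (#T : ℝ) ≤ 144 * Tb ^ 6 * Z * (Nat.gcd k.natAbs (2 * n)) * (1 + Real.log (2 * n)) := by
  classical
  have hh : 0 < k + 2 * (n:ℤ) := by linarith
  obtain ⟨h, hhz⟩ : ∃ h : ℕ, (h:ℤ) = k + 2 * n := ⟨(k + 2 * n).toNat, Int.toNat_of_nonneg hh.le⟩
  have hh0 : 0 < h := by omega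
  obtain ⟨A, hA⟩ : ∃ A : ℕ, A = k.natAbs := ⟨_, rfl⟩
  rw [← hA]
  have hA0 : 0 < A := by omega
  have hAz : (A:ℤ) = |k| := by rw [hA]; simp
  have hAk : (A:ℤ) ∣ k := by rw [hAz]; exact (abs_dvd _ _).mpr dvd_rfl
  have hgg : Nat.gcd A h = Nat.gcd A (2 * n) := by
    apply Nat.dvd_antisymm
    · refine Nat.dvd_gcd (Nat.gcd_dvd_left _ _) ?_
      have h1 : ((Nat.gcd A h : ℕ):ℤ) ∣ k := (Int.natCast_dvd_natCast.mpr (Nat.gcd_dvd_left A h)).trans hAk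
      have h2 : ((Nat.gcd A h : ℕ):ℤ) ∣ k + 2 * n := by
        rw [← hhz]; exact (Int.natCast_dvd_natCast.mpr (Nat.gcd_dvd_right A h))
      have := dvd_sub h2 h1
      rw [add_sub_cancel_left] at this
      exact_mod_cast this
    · refine Nat.dvd_gcd (Nat.gcd_dvd_left _ _) ?_
      have h1 : ((Nat.gcd A (2 * n) : ℕ):ℤ) ∣ k :=
        (Int.natCast_dvd_natCast.mpr (Nat.gcd_dvd_left A _)).trans hAk
      have h2 : ((Nat.gcd A (2 * n) : ℕ):ℤ) ∣ 2 * n := by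
        exact_mod_cast (Int.natCast_dvd_natCast.mpr (Nat.gcd_dvd_right A (2 * n)))
      have := dvd_add h1 h2
      rw [← hhz] at this
      exact_mod_cast this
  obtain ⟨g, hg⟩ : ∃ g, g = Nat.gcd A h := ⟨_, rfl⟩
  have hg0 : 0 < g := by rw [hg]; exact Nat.gcd_pos_of_pos_left _ hA0
  rw [← hgg, ← hg]
  obtain ⟨Q₁, hQ₁⟩ : ∃ Q, Q = Nat.factorizationLCMLeft A h := ⟨_, rfl⟩
  obtain ⟨Q₂, hQ₂⟩ : ∃ Q, Q = Nat.factorizationLCMRight A h := ⟨_, rfl⟩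
  have hQ₁0 : 0 < Q₁ := hQ₁ ▸ Nat.factorizationLCMLeft_pos A h
  have hQ₂0 : 0 < Q₂ := hQ₂ ▸ Nat.factorizationLCMRight_pos A h
  have hcop : Nat.Coprime Q₁ Q₂ := by
    rw [hQ₁, hQ₂]; exact Nat.coprime_factorizationLCMLeft_factorizationLCMRight A h
  have hd1 : Q₁ ∣ A := hQ₁ ▸ Nat.factorizationLCMLeft_dvd_left A h
  have hd2 : Q₂ ∣ h := hQ₂ ▸ Nat.factorizationLCMRight_dvd_right A h
  have hprod : ((Q₁ * Q₂ * g : ℕ):ℤ) = |k| * (k + 2 * n) := by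
    rw [← hhz, ← hAz, hQ₁, hQ₂, Nat.factorizationLCMLeft_mul_factorizationLCMRight hA0.ne' hh0.ne', hg,
      mul_comm, Nat.gcd_mul_lcm]
    push_cast; rfl
  obtain ⟨W₁, w11, w12, w13⟩ := exists_maxW Q₁ (4 * n) hQ₁0
  obtain ⟨W₂, w21, w22, w23⟩ := exists_maxW Q₂ (4 * n) hQ₂0
  have hWW : (W₁ * W₂) ^ 2 ≤ 2 * g := by
    refine Nat.le_of_dvd (by omega) ?_
    rw [mul_pow]
    refine Nat.Coprime.mul_dvd_of_dvd_of_dvd ?_ ?_ ?_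
    · exact Nat.Coprime.of_dvd w11 w21 hcop
    · have h1 : W₁ ^ 2 ∣ Nat.gcd (2 * A) (2 * (2 * n)) :=
        Nat.dvd_gcd ((w11.trans hd1).mul_left 2) (by rw [← mul_assoc]; exact w12)
      rwa [Nat.gcd_mul_left, ← hgg, ← hg] at h1
    · have h3 : Nat.gcd h (2 * n) ∣ g := by
        rw [hg]
        refine Nat.dvd_gcd ?_ (Nat.gcd_dvd_left _ _)
        have h1 : ((Nat.gcd h (2 * n) : ℕ):ℤ) ∣ k + 2 * n := by
          rw [← hhz]; exact (Int.natCast_dvd_natCast.mpr (Nat.gcd_dvd_left h _))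
        have h2 : ((Nat.gcd h (2 * n) : ℕ):ℤ) ∣ 2 * n := by
          exact_mod_cast (Int.natCast_dvd_natCast.mpr (Nat.gcd_dvd_right h (2 * n)))
        have := dvd_sub h1 h2
        rw [add_sub_cancel_right] at this
        have h4 : ((Nat.gcd h (2 * n) : ℕ):ℤ) ∣ A := by rw [hAz]; exact (dvd_abs _ _).mpr this
        exact_mod_cast h4
      have h1 : W₂ ^ 2 ∣ Nat.gcd (2 * h) (2 * (2 * n)) :=
        Nat.dvd_gcd ((w21.trans hd2).mul_left 2) (by rw [← mul_assoc]; exact w22)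
      rw [Nat.gcd_mul_left] at h1
      exact h1.trans (Nat.mul_dvd_mul_left 2 h3)
  have hnz : (1:ℤ) ≤ n := by exact_mod_cast hn
  have hAle : A ≤ 4 * n := by omega
  have hhle : h ≤ 6 * n := by omega
  have hn2 : n ≤ n ^ 2 := Nat.le_self_pow (by norm_num) n
  have hQT1 : Q₁.divisors.card ≤ Tb :=
    hTb _ hQ₁0 ((Nat.le_of_dvd hA0 hd1).trans (by linarith))
  have hQT2 : Q₂.divisors.card ≤ Tb :=
    hTb _ hQ₂0 ((Nat.le_of_dvd hh0 hd2).trans (by linarith))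
  have hkT : (k * (k + 2 * n)).natAbs.divisors.card ≤ Tb := by
    have e : (k * (k + 2 * n)).natAbs = A * h := by
      rw [Int.natAbs_mul, ← hhz, ← hA]; simp
    rw [e]
    exact hTb _ (by positivity) (by nlinarith)
  have hlab1 : #(labSet n Q₁) ≤ Tb ^ 2 * W₁ := by
    refine (labSet_card n Q₁ hQ₁0 W₁ ?_).trans (by gcongr)
    intro w a b
    exact w13 w a (by exact_mod_cast b)
  have hlab2 : #(labSet n Q₂) ≤ Tb ^ 2 * W₂ := by
    refine (labSet_card n Q₂ hQ₂0 W₂ ?_).trans (by gcongr)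
    intro w a b
    exact w23 w a (by exact_mod_cast b)
  have hl1 : ∀ p ∈ T, ∃ l ∈ labSet n Q₁, HasLabel Q₁ p.y p.e l := by
    intro p hp
    have hp3 := (hT p hp).2.2
    have ha := (hT p hp).1.2.1
    have hb := (hT p hp).2.1.2.1
    refine label_exists n Q₁ hQ₁0 _ _ ?_ ?_
    · rintro ⟨e1, e2⟩
      simp only [Pr.y, Pr.e] at e1 e2
      rw [e1, e2] at hp3
      have : k * p.1.1 * p.2.1 ≠ 0 := mul_ne_zero (mul_ne_zero hk ha.ne') hb.ne'
      apply this; linarith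
    · simp only [Pr.y, Pr.e]
      rw [hp3]
      have : (Q₁:ℤ) ∣ k := (Int.natCast_dvd_natCast.mpr hd1).trans hAk
      rw [mul_assoc, mul_assoc]
      exact ((this.mul_right _).mul_left _)
  have hl2 : ∀ p ∈ T, ∃ l ∈ labSet n Q₂, HasLabel Q₂ p.y p.X l := by
    intro p hp
    have hp3 := (hT p hp).2.2
    have ha := (hT p hp).1.2.1
    have hb := (hT p hp).2.1.2.1
    refine label_exists n Q₂ hQ₂0 _ _ ?_ ?_
    · rintro ⟨e1, e2⟩
      simp only [Pr.X] at e2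
      linarith
    · have e : p.y ^ 2 - n * p.X ^ 2 = (k + 2 * n) * (-2 * p.1.1 * p.2.1) := by
        simp only [Pr.y, Pr.X]
        linear_combination hp3
      rw [e, ← hhz]
      exact (Int.natCast_dvd_natCast.mpr hd2).mul_right _
  choose! f₁ f₁m f₁l using hl1
  choose! f₂ f₂m f₂l using hl2
  obtain ⟨δ, hδ⟩ : ∃ δ : ℝ, δ = 1 / (9 * √(g:ℝ)) := ⟨_, rfl⟩
  have hg1 : (1:ℝ) ≤ g := by exact_mod_cast hg0
  have hsg : 1 ≤ √(g:ℝ) := Real.one_le_sqrt.mpr hg1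
  have hδ0 : 0 < δ := by rw [hδ]; positivity
  have hδ1 : δ ≤ 1 := by
    rw [hδ, div_le_one (by positivity)]; linarith
  obtain ⟨L, hL⟩ : ∃ L : ℝ, L = Real.log (2 * n) := ⟨_, rfl⟩
  have hn1 : (1:ℝ) ≤ n := by exact_mod_cast hn
  have hL0 : 0 ≤ L := by rw [hL]; exact Real.log_nonneg (by linarith)
  rw [← hL]
  set Ic := Icc ⌊-L / δ⌋ ⌊L / δ⌋ with hIc
  have hcell := cells_card L g hL0 hg1 δ hδ
  rw [← hIc] at hcell
  have hmain : #T ≤ ((Tb * Z) * Tb * 2) * #(((labSet n Q₁) ×ˢ (labSet n Q₂)) ×ˢ ((univ : Finset Bool) ×ˢ Ic)) := by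
    refine card_le_mul_card_image_of_maps_to
      (f := fun p : Pr => ((f₁ p, f₂ p), (decide (0 < p.u n), ⌊Real.log |p.u n| / δ⌋))) ?_ _ ?_
    · intro p hp
      have F := (hT p hp).facts hk
      have hup : 0 < |p.u n| := abs_pos.mpr F.u_ne
      simp only [mem_product, f₁m p hp, f₂m p hp, mem_univ, hIc, mem_Icc, true_and]
      constructor
      · apply Int.floor_mono
        have : -L ≤ Real.log |p.u n| := by
          rw [hL, ← Real.log_inv]
          apply Real.log_le_log (by positivity)
          have := F.lo; rwa [one_div] at this
        gcongr
      · apply Int.floor_mono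
        have : Real.log |p.u n| ≤ L := by
          rw [hL]
          exact Real.log_le_log hup F.hi
        gcongr
    · rintro ⟨⟨l₁, l₂⟩, ⟨b, i⟩⟩ -
      have hmem : ∀ p ∈ T.filter (fun p : Pr => ((f₁ p, f₂ p), (decide (0 < p.u n), ⌊Real.log |p.u n| / δ⌋))
          = ((l₁, l₂), (b, i))), p ∈ T ∧ f₁ p = l₁ ∧ f₂ p = l₂ ∧ decide (0 < p.u n) = b ∧
            ⌊Real.log |p.u n| / δ⌋ = i := by
        intro p hp
        rw [mem_filter] at hp
        simp only [Prod.mk.injEq] at hp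
        tauto
      refine two_vals _ (fun p => p.u n) _ ?_ ?_
      · have near : ∀ p q : Pr, p ∈ T → q ∈ T → decide (0 < p.u n) = b → decide (0 < q.u n) = b →
            ⌊Real.log |p.u n| / δ⌋ = i → ⌊Real.log |q.u n| / δ⌋ = i →
            |p.u n - q.u n| ≤ 2 * δ * |p.u n| := by
          intro p q hp hq d1 d2 e1 e2
          refine near_of_sector _ _ δ hδ0 hδ1 ((hT p hp).facts hk).u_ne ((hT q hq).facts hk).u_ne ?_
            (e1.trans e2.symm)
          have := d1.trans d2.symm
          rwa [decide_eq_decide] at this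
        intro p hp q hq r hr
        obtain ⟨p1, p2, p3, p4, p5⟩ := hmem p hp
        obtain ⟨q1, q2, q3, q4, q5⟩ := hmem q hq
        obtain ⟨r1, r2, r3, r4, r5⟩ := hmem r hr
        exact cell_lemma n k hk hh Q₁ Q₂ g hg0 hcop hQ₁0 hQ₂0 hprod δ hδ p q r (hT p p1) (hT q q1) (hT r r1)
          l₁ l₂ (p2 ▸ f₁l p p1) (q2 ▸ f₁l q q1) (r2 ▸ f₁l r r1)
          (p3 ▸ f₂l p p1) (q3 ▸ f₂l q q1) (r3 ▸ f₂l r r1)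
          (near p q p1 q1 p4 q4 p5 q5) (near q r q1 r1 q4 r4 q5 r5) (near r p r1 p1 r4 p4 r5 p5)
      · intro v
        have hsub : ∀ p ∈ filter (fun p : Pr => p.u n = v) (T.filter (fun p : Pr => ((f₁ p, f₂ p),
            (decide (0 < p.u n), ⌊Real.log |p.u n| / δ⌋)) = ((l₁, l₂), (b, i)))), p ∈ T := by
          intro p hp
          exact (mem_filter.mp (mem_filter.mp hp).1).1
        refine fibu n k hk hh.ne' _ (fun p hp => hT p (hsub p hp)) v (fun p hp => (mem_filter.mp hp).2) Z Tb
          (fun p hp => hZ p (hsub p hp)) hkT ?_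
        intro p hp
        have hP := (hT p (hsub p hp)).1
        have ha0 := hP.2.1
        refine hTb _ (by omega) ?_
        have hx : p.1.2 ≤ n := by
          have := hP.2.2.2.2.1
          have h3 := hP.2.2.1
          nlinarith
        have ha : p.1.1 - p.1.2 ≤ n := by
          have := hP.2.2.2.2.2.2
          by_contra hcon
          push Not at hcon
          nlinarith
        have : p.1.1.natAbs ≤ 2 * n := by omega
        linarith
  have hcard : #(((labSet n Q₁) ×ˢ (labSet n Q₂)) ×ˢ ((univ : Finset Bool) ×ˢ Ic)) ≤
      ((Tb ^ 2 * W₁) * (Tb ^ 2 * W₂)) * (2 * #Ic) := by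
    simp only [card_product, card_univ, Fintype.card_bool]
    gcongr
  have hWr : (W₁:ℝ) * W₂ ≤ 2 * √(g:ℝ) := by
    have h1 : ((W₁:ℝ) * W₂) ^ 2 ≤ 2 * g := by exact_mod_cast hWW
    have h2 : √(g:ℝ) ^ 2 = g := Real.sq_sqrt (by positivity)
    apply le_of_sq_le_sq _ (by positivity)
    nlinarith
  have hfin : (#T:ℝ) ≤ ((Tb * Z) * Tb * 2) * (((Tb ^ 2 * W₁) * (Tb ^ 2 * W₂)) * (2 * #Ic)) := by
    exact_mod_cast hmain.trans (Nat.mul_le_mul_left _ hcard)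
  calc (#T:ℝ) ≤ _ := hfin
    _ = 4 * Tb ^ 6 * Z * (W₁ * W₂) * #Ic := by ring
    _ ≤ 4 * Tb ^ 6 * Z * (2 * √(g:ℝ)) * (18 * √(g:ℝ) * (1 + L)) := by gcongr
    _ = 144 * Tb ^ 6 * Z * (√(g:ℝ) * √(g:ℝ)) * (1 + L) := by ring
    _ = _ := by rw [Real.mul_self_sqrt (by positivity)]

end E1148

namespace E1148
open Finset

theorem harm_le (N : ℕ) : ∑ j ∈ Icc 1 N, (1:ℝ) / j ≤ 1 + Real.log N := by
  have := harmonic_le_one_add_log N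
  rw [harmonic_eq_sum_Icc] at this
  push_cast at this
  simpa [one_div] using this

theorem gcd_sum (N m : ℕ) (hm : 0 < m) (hN : 0 < N) :
    ∑ j ∈ Icc 1 N, (Nat.gcd j m : ℝ) / j ≤ m.divisors.card * (1 + Real.log N) := by
  have h1 : ∀ j ∈ Icc 1 N, (Nat.gcd j m : ℝ) / j ≤
      ∑ d ∈ m.divisors, if d ∣ j then (d:ℝ) / j else 0 := by
    intro j hj
    have hg : Nat.gcd j m ∈ m.divisors := Nat.mem_divisors.mpr ⟨Nat.gcd_dvd_right _ _, hm.ne'⟩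
    refine le_trans ?_ (single_le_sum (f := fun d : ℕ => if d ∣ j then (d:ℝ) / j else 0) ?_ hg)
    · simp [Nat.gcd_dvd_left]
    · intro d _
      split_ifs <;> positivity
  refine (sum_le_sum h1).trans ?_
  rw [sum_comm, ← nsmul_eq_mul]
  refine sum_le_card_nsmul _ _ _ ?_
  intro d hd
  have hd0 : 0 < d := Nat.pos_of_mem_divisors hd
  rw [← sum_filter]
  have : ∑ a ∈ (Icc 1 N).filter (fun j => d ∣ j), (d:ℝ) / a ≤ ∑ i ∈ Icc 1 N, (1:ℝ) / i := by
    have hsub : (Icc 1 N).filter (fun j => d ∣ j) ⊆ (Icc 1 N).image (fun i => d * i) := by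
      intro j hj
      rw [mem_filter, mem_Icc] at hj
      obtain ⟨⟨a, b⟩, c, rfl⟩ := hj
      rw [mem_image]
      refine ⟨c, mem_Icc.mpr ⟨?_, ?_⟩, rfl⟩
      · rcases Nat.eq_zero_or_pos c with h | h
        · subst h; simp at a
        · exact h
      · nlinarith
    refine (sum_le_sum_of_subset_of_nonneg hsub (fun _ _ _ => by positivity)).trans ?_
    rw [sum_image (fun a _ b _ h => Nat.eq_of_mul_eq_mul_left hd0 h)]
    refine le_of_eq (sum_congr rfl fun i _ => ?_)
    have : (d:ℝ) ≠ 0 := by positivity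
    push_cast
    rw [div_mul_eq_div_div, div_self this]
  exact this.trans (harm_le N)

theorem bet_inj (n : ℕ) (hsq : ¬ IsSquare n) (a x a' x' : ℤ) (h : IsP n a x) (h' : IsP n a' x')
    (e : bet n a x = bet n a' x') : a = a' ∧ x = x' := by
  have b := h.bounds
  have b' := h'.bounds
  unfold bet at e
  rw [div_eq_div_iff b.1.ne' b'.1.ne'] at e
  have hs : √(n:ℝ) ^ 2 = n := Real.sq_sqrt (Nat.cast_nonneg n)
  have key : ((a * x' - a' * x : ℤ)) ^ 2 = (n:ℤ) * (a - a') ^ 2 := by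
    have : (((a * x' - a' * x : ℤ) ^ 2 : ℤ):ℝ) = ((n:ℤ) * (a - a') ^ 2 : ℤ) := by
      have h1 : ((a:ℝ) * x' - a' * x) = √(n:ℝ) * (a - a') := by linarith
      push_cast
      rw [h1, mul_pow, hs]
    exact_mod_cast this
  have h0 := nonsq_zero n hsq _ _ key
  have ha : a = a' := by linarith [h0.2]
  refine ⟨ha, ?_⟩
  have h1 := h0.1
  rw [← ha] at h1
  have h2 : a * (x' - x) = 0 := by linarith
  rcases mul_eq_zero.mp h2 with h3 | h3
  · exact absurd h3 h.2.1.ne'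
  · linarith

theorem ener_bound (n : ℕ) (hn : 0 < n) (hsq : ¬ IsSquare n)
    (Tb Z : ℕ) (hTb : ∀ m : ℕ, 0 < m → m ≤ 24 * n ^ 2 → m.divisors.card ≤ Tb) (S : Finset (ℤ × ℤ))
    (hS : ∀ p ∈ S, IsP n p.1 p.2)
    (hZ : ∀ p ∈ S, ∀ w : ℕ, ((w:ℤ) ^ 2 ∣ p.1) → w ^ 2 ∣ n → w ≤ Z) :
    #(S.image (fun p => bet n p.1 p.2)) = #S ∧
    Ener (S.image (fun p => bet n p.1 p.2)) ≤ 576 * n * Tb ^ 7 * Z * (1 + Real.log (4 * n)) ^ 2 := by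
  classical
  have hinj : Set.InjOn (fun p : ℤ × ℤ => bet n p.1 p.2) S := by
    intro p hp q hq e
    have := bet_inj n hsq _ _ _ _ (hS p hp) (hS q hq) e
    exact Prod.ext this.1 this.2
  refine ⟨card_image_of_injOn hinj, ?_⟩
  unfold Ener
  rw [sum_image hinj]
  have e1 : ∑ x ∈ S, ∑ j ∈ S.image (fun p => bet n p.1 p.2), |bet n x.1 x.2 - j|⁻¹
      = ∑ p ∈ S ×ˢ S, |bet n p.1.1 p.1.2 - bet n p.2.1 p.2.2|⁻¹ := by
    rw [sum_product]
    exact sum_congr rfl fun x _ => sum_image hinj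
  rw [e1]
  have hex : ∀ p ∈ S.offDiag, ∃ k : ℤ, PairK n k p.1.1 p.1.2 p.2.1 p.2.2 ∧ k ≠ 0 ∧ -(n:ℤ) < k ∧ k < 4 * n ∧
      |bet n p.1.1 p.1.2 - bet n p.2.1 p.2.2|⁻¹ ≤ 2 * n / |(k:ℝ)| := by
    intro p hp
    rw [mem_offDiag] at hp
    refine pair_exists n hsq _ _ _ _ (hS _ hp.1) (hS _ hp.2.1) ?_
    rintro ⟨a, b⟩
    exact hp.2.2 (Prod.ext a b)
  choose! K K1 K2 K3 K4 K5 using hex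
  have e2 : ∑ p ∈ S ×ˢ S, |bet n p.1.1 p.1.2 - bet n p.2.1 p.2.2|⁻¹
      = ∑ p ∈ S.offDiag, |bet n p.1.1 p.1.2 - bet n p.2.1 p.2.2|⁻¹ := by
    symm
    apply sum_subset
    · intro p hp; rw [mem_offDiag] at hp; exact mem_product.mpr ⟨hp.1, hp.2.1⟩
    · intro p hp hp'
      rw [mem_offDiag] at hp'
      rw [mem_product] at hp
      have : p.1 = p.2 := by by_contra h; exact hp' ⟨hp.1, hp.2, h⟩
      rw [this]; simp
  rw [e2]
  set I := (Ioo (-(n:ℤ)) (4 * n)).filter (fun k => k ≠ 0) with hI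
  have hmaps : ∀ p ∈ S.offDiag, K p ∈ I := by
    intro p hp
    rw [hI, mem_filter, mem_Ioo]
    exact ⟨⟨K3 p hp, K4 p hp⟩, K2 p hp⟩
  have hn1 : (1:ℝ) ≤ n := by exact_mod_cast hn
  set L := 1 + Real.log (4 * n) with hL
  have hL1 : 1 + Real.log (2 * n) ≤ L := by
    rw [hL]; gcongr; norm_num
  have hL0 : 0 ≤ L := by
    have : 0 ≤ Real.log (2 * n) := Real.log_nonneg (by linarith)
    linarith
  set c : ℝ := 144 * Tb ^ 6 * Z * L with hc
  have hc0 : 0 ≤ c := by positivity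
  have e3 : ∑ p ∈ S.offDiag, |bet n p.1.1 p.1.2 - bet n p.2.1 p.2.2|⁻¹ ≤
      ∑ k ∈ I, (2 * n / |(k:ℝ)|) * (c * Nat.gcd k.natAbs (2 * n)) := by
    refine (sum_le_sum (fun p hp => K5 p hp)).trans ?_
    rw [← sum_fiberwise_of_maps_to (g := K) hmaps]
    refine sum_le_sum fun k hk => ?_
    rw [hI, mem_filter, mem_Ioo] at hk
    have h1 : ∑ p ∈ S.offDiag.filter (fun p => K p = k), 2 * (n:ℝ) / |((K p : ℤ):ℝ)|
        = (2 * n / |(k:ℝ)|) * #(S.offDiag.filter (fun p => K p = k)) := by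
      rw [sum_congr rfl (g := fun _ => 2 * (n:ℝ) / |(k:ℝ)|), sum_const, nsmul_eq_mul, mul_comm]
      intro p hp
      rw [(mem_filter.mp hp).2]
    rw [h1]
    have h2 := pair_count n hn k hk.2 hk.1.1 hk.1.2 Tb Z hTb (S.offDiag.filter (fun p => K p = k)) ?_ ?_
    · refine mul_le_mul_of_nonneg_left (h2.trans ?_) (by positivity)
      rw [hc]
      calc _ ≤ 144 * (Tb:ℝ) ^ 6 * Z * (Nat.gcd k.natAbs (2 * n)) * L := by gcongr
        _ = _ := by ring
    · intro p hp
      obtain ⟨h3, h4⟩ := mem_filter.mp hp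
      have := K1 p h3
      rw [h4] at this
      exact this
    · intro p hp
      obtain ⟨h3, -⟩ := mem_filter.mp hp
      exact hZ _ (mem_offDiag.mp h3).1
  refine e3.trans ?_
  have e4 : ∑ k ∈ I, (2 * n / |(k:ℝ)|) * (c * Nat.gcd k.natAbs (2 * n)) ≤
      2 * ∑ j ∈ Icc 1 (4 * n), (2 * n / (j:ℝ)) * (c * Nat.gcd j (2 * n)) := by
    have hm : ∀ k ∈ I, k.natAbs ∈ Icc 1 (4 * n) := by
      intro k hk
      rw [hI, mem_filter, mem_Ioo] at hk
      rw [mem_Icc]; omega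
    rw [← sum_fiberwise_of_maps_to (g := Int.natAbs) hm, mul_sum]
    refine sum_le_sum fun j hj => ?_
    have h1 : ∑ k ∈ I.filter (fun k => k.natAbs = j), (2 * n / |(k:ℝ)|) * (c * Nat.gcd k.natAbs (2 * n))
        = #(I.filter (fun k => k.natAbs = j)) * ((2 * n / (j:ℝ)) * (c * Nat.gcd j (2 * n))) := by
      rw [← nsmul_eq_mul, ← sum_const]
      refine sum_congr rfl fun k hk => ?_
      have h := (mem_filter.mp hk).2
      have h2 : |(k:ℝ)| = j := by
        rw [← h, Nat.cast_natAbs, Int.cast_abs]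
      rw [h2, h]
    rw [h1]
    have h2 : #(I.filter (fun k => k.natAbs = j)) ≤ 2 := by
      refine (card_le_card (t := {(j:ℤ), -(j:ℤ)}) ?_).trans card_le_two
      intro k hk
      have h := (mem_filter.mp hk).2
      rw [mem_insert, mem_singleton]
      omega
    gcongr
    exact_mod_cast h2
  refine e4.trans ?_
  have e5 : ∑ j ∈ Icc 1 (4 * n), (2 * n / (j:ℝ)) * (c * Nat.gcd j (2 * n))
      = 2 * n * c * ∑ j ∈ Icc 1 (4 * n), (Nat.gcd j (2 * n) : ℝ) / j := by
    rw [mul_sum]; refine sum_congr rfl fun j _ => by ring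
  rw [e5]
  have e6 := gcd_sum (4 * n) (2 * n) (by omega) (by omega)
  have e7 : ((2 * n).divisors.card : ℝ) ≤ Tb := by
    exact_mod_cast hTb _ (by omega) (by nlinarith)
  have e8 : ∑ j ∈ Icc 1 (4 * n), (Nat.gcd j (2 * n) : ℝ) / j ≤ Tb * L := by
    refine e6.trans ?_
    push_cast
    rw [← hL]
    gcongr
  calc _ ≤ 2 * (2 * n * c * (Tb * L)) := by gcongr
    _ = _ := by rw [hc]; ring

end E1148

namespace E1148
open Finset

open Classical in
noncomputable def Pset (n : ℕ) : Finset (ℤ × ℤ) :=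
  ((Icc (1:ℤ) (2 * n)) ×ˢ (Icc (1:ℤ) n)).filter (fun p => IsP n p.1 p.2)

theorem mem_Pset (n : ℕ) (p : ℤ × ℤ) : p ∈ Pset n ↔ IsP n p.1 p.2 := by
  classical
  unfold Pset
  rw [mem_filter, mem_product, mem_Icc, mem_Icc]
  refine ⟨fun h => h.2, fun hP => ⟨?_, hP⟩⟩
  have ha0 := hP.2.1
  have h3 := hP.2.2.1
  have hx : p.2 ≤ n := by
    have := hP.2.2.2.2.1
    nlinarith
  have ha : p.1 - p.2 ≤ n := by
    have := hP.2.2.2.2.2.2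
    by_contra hcon
    push Not at hcon
    nlinarith
  refine ⟨⟨by omega, by omega⟩, by omega, hx⟩

/-- elements of `Pset` with `w ∣ x` -/
theorem Pset_w (n : ℕ) (Tb : ℕ) (hTb : ∀ m : ℕ, 0 < m → m ≤ 24 * n ^ 2 → m.divisors.card ≤ Tb)
    (w : ℕ) (hw : 0 < w) :
    #((Pset n).filter (fun p => (w:ℤ) ∣ p.2)) ≤ Tb * (Nat.sqrt n / w) := by
  have hcard : #((Icc 1 (Nat.sqrt n / w)).image (fun i : ℕ => (w:ℤ) * i)) ≤ Nat.sqrt n / w := by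
    refine card_image_le.trans ?_
    simp
  refine (card_le_mul_card_image_of_maps_to (f := Prod.snd)
    (t := (Icc 1 (Nat.sqrt n / w)).image (fun i : ℕ => (w:ℤ) * i)) ?_ Tb ?_).trans
    (Nat.mul_le_mul_left _ hcard)
  · intro p hp
    obtain ⟨hp1, hp2⟩ := mem_filter.mp hp
    rw [mem_Pset] at hp1
    have h3 := hp1.2.2.1
    have hlt := hp1.2.2.2.2.1
    obtain ⟨c, hc⟩ := hp2
    have hwz : (0:ℤ) < w := by exact_mod_cast hw
    have hc0 : 0 < c := by
      by_contra hcon; push Not at hcon; nlinarith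
    lift c to ℕ using hc0.le
    rw [mem_image]
    refine ⟨c, mem_Icc.mpr ⟨by exact_mod_cast hc0, ?_⟩, hc.symm⟩
    rw [Nat.le_div_iff_mul_le hw, Nat.le_sqrt]
    rw [hc] at hlt
    zify
    nlinarith
  · intro x _
    rcases (filter (fun p => p.2 = x) ((Pset n).filter (fun p => (w:ℤ) ∣ p.2))).eq_empty_or_nonempty with h | ⟨p₀, hp₀⟩
    · rw [h]; simp
    have hx := (mem_filter.mp hp₀).2
    have hP₀ := (mem_Pset n _).mp (mem_filter.mp (mem_filter.mp hp₀).1).1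
    rw [hx] at hP₀
    have hpos : 0 < (n:ℤ) - x ^ 2 := by linarith [hP₀.2.2.2.2.1]
    refine le_trans (card_le_card_of_injOn (t := ((n:ℤ) - x ^ 2).natAbs.divisors)
      (fun p => p.1.natAbs) ?_ ?_) (hTb _ (by omega) ?_)
    · intro p hp
      have hx' := (mem_filter.mp hp).2
      have hP := (mem_Pset n _).mp (mem_filter.mp (mem_filter.mp hp).1).1
      rw [hx'] at hP
      simp only [mem_coe, Nat.mem_divisors]
      refine ⟨Int.natAbs_dvd_natAbs.mpr ((Dvd.intro_left _ rfl).trans hP.2.2.2.1), by omega⟩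
    · intro p hp q hq e
      have hx' := (mem_filter.mp hp).2
      have hP := (mem_Pset n _).mp (mem_filter.mp (mem_filter.mp hp).1).1
      have hy' := (mem_filter.mp hq).2
      have hQ := (mem_Pset n _).mp (mem_filter.mp (mem_filter.mp hq).1).1
      have h1 := hP.2.1
      have h2 := hQ.2.1
      simp only at e
      exact Prod.ext (by omega) (hx'.trans hy'.symm)
    · have : ((n:ℤ) - x ^ 2).natAbs ≤ n := by
        have := sq_nonneg x
        omega
      nlinarith

theorem Pset_card (n : ℕ) (Tb : ℕ) (hTb : ∀ m : ℕ, 0 < m → m ≤ 24 * n ^ 2 → m.divisors.card ≤ Tb) :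
    (#(Pset n) : ℝ) ≤ Tb * √(n:ℝ) := by
  have := Pset_w n Tb hTb 1 one_pos
  rw [filter_true_of_mem (by simp)] at this
  have h2 : (Nat.sqrt n : ℝ) ≤ √(n:ℝ) := Real.nat_sqrt_le_real_sqrt
  calc (#(Pset n) : ℝ) ≤ ((Tb * (Nat.sqrt n / 1) : ℕ) : ℝ) := by exact_mod_cast this
    _ = Tb * (Nat.sqrt n : ℝ) := by push_cast [Nat.div_one]; ring
    _ ≤ _ := by gcongr

open Classical in
noncomputable def Pstar (n Z : ℕ) : Finset (ℤ × ℤ) :=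
  (Pset n).filter (fun p => ∀ w : ℕ, ((w:ℤ) ^ 2 ∣ p.1) → w ^ 2 ∣ n → w ≤ Z)

theorem Pstar_card (n : ℕ) (hn : 0 < n) (Tb : ℕ)
    (hTb : ∀ m : ℕ, 0 < m → m ≤ 24 * n ^ 2 → m.divisors.card ≤ Tb) (Z : ℕ) (hZ : 0 < Z) :
    (#(Pset n) : ℝ) ≤ #(Pstar n Z) + Tb ^ 2 * √(n:ℝ) / Z := by
  classical
  have hsub : Pset n ⊆ Pstar n Z ∪ ((n.divisors.filter (fun w => Z < w)).biUnion
      (fun w => (Pset n).filter (fun p => (w:ℤ) ∣ p.2))) := by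
    intro p hp
    rw [mem_union]
    by_cases h : p ∈ Pstar n Z
    · exact Or.inl h
    right
    unfold Pstar at h
    rw [mem_filter] at h
    push Not at h
    obtain ⟨w, h1, h2, h3⟩ := h hp
    rw [mem_biUnion]
    refine ⟨w, mem_filter.mpr ⟨Nat.mem_divisors.mpr ⟨(Dvd.intro_left (w ^ 1) (by ring)).trans h2, hn.ne'⟩, h3⟩,
      mem_filter.mpr ⟨hp, ?_⟩⟩
    have hP := (mem_Pset n p).mp hp
    have h4 : (w:ℤ) ^ 2 ∣ n - p.2 ^ 2 := h1.trans ((Dvd.intro_left _ rfl).trans hP.2.2.2.1)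
    have h5 : (w:ℤ) ^ 2 ∣ n := by exact_mod_cast (Int.natCast_dvd_natCast.mpr h2)
    have h6 : (w:ℤ) ^ 2 ∣ p.2 ^ 2 := by
      have := dvd_sub h5 h4
      simpa using this
    exact (Int.pow_dvd_pow_iff (by norm_num)).mp h6
  have h1 : (#(Pset n):ℝ) ≤ #(Pstar n Z) + ∑ w ∈ n.divisors.filter (fun w => Z < w),
      (#((Pset n).filter (fun p => (w:ℤ) ∣ p.2)) : ℝ) := by
    have := (card_le_card hsub).trans ((card_union_le _ _).trans (Nat.add_le_add_left card_biUnion_le _))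
    exact_mod_cast this
  refine h1.trans ?_
  gcongr
  have hZr : (0:ℝ) < Z := by exact_mod_cast hZ
  have h2 : ∀ w ∈ n.divisors.filter (fun w => Z < w),
      (#((Pset n).filter (fun p => (w:ℤ) ∣ p.2)) : ℝ) ≤ Tb * √(n:ℝ) / Z := by
    intro w hw
    have hw2 := (mem_filter.mp hw).2
    have := Pset_w n Tb hTb w (by omega)
    have h3 : (Nat.sqrt n : ℝ) ≤ √(n:ℝ) := Real.nat_sqrt_le_real_sqrt
    have hwr : (Z:ℝ) ≤ w := by exact_mod_cast hw2.le
    calc _ ≤ ((Tb * (Nat.sqrt n / w) : ℕ):ℝ) := by exact_mod_cast this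
      _ = Tb * ((Nat.sqrt n / w : ℕ):ℝ) := by push_cast; ring
      _ ≤ Tb * ((Nat.sqrt n : ℝ) / w) := by gcongr; exact Nat.cast_div_le
      _ ≤ Tb * (√(n:ℝ) / Z) := by gcongr
      _ = _ := by ring
  refine (sum_le_card_nsmul _ _ _ h2).trans ?_
  rw [nsmul_eq_mul]
  have h4 : (#(n.divisors.filter (fun w => Z < w)) : ℝ) ≤ Tb := by
    have := (card_filter_le n.divisors (fun w => Z < w)).trans (hTb n hn (by nlinarith))
    exact_mod_cast this
  calc _ ≤ (Tb:ℝ) * (Tb * √(n:ℝ) / Z) := by gcongr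
    _ = _ := by ring

theorem main_ineq (n : ℕ) (hn : 0 < n) (hsq : ¬ IsSquare n) (hbad : ¬ Rep n) (Tb : ℕ)
    (hTb : ∀ m : ℕ, 0 < m → m ≤ 24 * n ^ 2 → m.divisors.card ≤ Tb) (Z : ℕ) (Q : ℕ) (hQ : 0 < Q) :
    (#(Pstar n Z):ℝ) ^ 2 ≤ 2 * ((Q:ℝ) ^ (-(1/4):ℝ)) * (3 * (Q:ℝ) ^ 2 * #(Pstar n Z)
      + 576 * n * Tb ^ 7 * Z * (1 + Real.log (4 * n)) ^ 2) := by
  classical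
  have hS : ∀ p ∈ Pstar n Z, IsP n p.1 p.2 := by
    intro p hp
    unfold Pstar at hp
    exact (mem_Pset n p).mp (mem_filter.mp hp).1
  obtain ⟨h1, h2⟩ := ener_bound n hn hsq Tb Z hTb (Pstar n Z) hS (by
    intro p hp
    unfold Pstar at hp
    exact (mem_filter.mp hp).2)
  have h3 : ∀ β ∈ (Pstar n Z).image (fun p => bet n p.1 p.2), ∃ a x, IsP n a x ∧ β = bet n a x := by
    intro β hβ
    obtain ⟨p, hp, rfl⟩ := mem_image.mp hβ
    exact ⟨p.1, p.2, hS p hp, rfl⟩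
  have h4 := tree_bound Q hQ _ (gap_of_bad n hsq hbad _ h3) (by
    intro β hβ
    obtain ⟨a, x, hP, rfl⟩ := h3 β hβ
    exact bet_mem hP)
  rw [h1] at h4
  refine h4.trans ?_
  gcongr

end E1148

namespace E1148
open Finset Filter

theorem Tb_eventually (η : ℝ) (hη : 0 < η) : ∀ᶠ n : ℕ in atTop,
    ∀ m : ℕ, 0 < m → m ≤ 24 * n ^ 2 → (m.divisors.card : ℝ) ≤ (n:ℝ) ^ η := by
  obtain ⟨C, hC1, hC⟩ := divisor_bound (η / 4) (by positivity)
  have h1 : Tendsto (fun n : ℕ => (n:ℝ) ^ (η / 2)) atTop atTop :=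
    (tendsto_rpow_atTop (by positivity)).comp tendsto_natCast_atTop_atTop
  filter_upwards [h1.eventually_ge_atTop (C * (24:ℝ) ^ (η/4))] with n hn m hm hle
  have h2 : (m:ℝ) ≤ 24 * (n:ℝ) ^ 2 := by exact_mod_cast hle
  calc (m.divisors.card : ℝ) ≤ C * (m:ℝ) ^ (η/4) := hC m hm
    _ ≤ C * (24 * (n:ℝ) ^ 2) ^ (η/4) := by gcongr
    _ = C * 24 ^ (η/4) * (n:ℝ) ^ (η/2) := by
      rw [Real.mul_rpow (by norm_num) (by positivity), ← Real.rpow_natCast (n:ℝ) 2,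
        ← Real.rpow_mul (by positivity)]
      norm_num
      rw [mul_assoc]; congr 3; ring
    _ ≤ (n:ℝ) ^ (η/2) * (n:ℝ) ^ (η/2) := by gcongr
    _ = (n:ℝ) ^ η := by
      rw [← Real.rpow_add_of_nonneg (by positivity) (by positivity) (by positivity)]; congr 1; ring

theorem log_eventually (η : ℝ) (hη : 0 < η) : ∀ᶠ n : ℕ in atTop,
    (1 + Real.log (4 * n)) ≤ (n:ℝ) ^ η := by
  have h1 : Tendsto (fun n : ℕ => (n:ℝ) ^ (η / 2)) atTop atTop :=
    (tendsto_rpow_atTop (by positivity)).comp tendsto_natCast_atTop_atTop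
  filter_upwards [h1.eventually_ge_atTop (1 + Real.log 4 + 2 / η), eventually_ge_atTop 1] with n hn hn1
  have hn1' : (1:ℝ) ≤ n := by exact_mod_cast hn1
  have h2 : Real.log n ≤ (n:ℝ) ^ (η/2) / (η/2) := Real.log_le_rpow_div (by positivity) (by positivity)
  rw [Real.log_mul (by norm_num) (by positivity)]
  have h4 : 0 ≤ Real.log 4 := Real.log_nonneg (by norm_num)
  set t := (n:ℝ) ^ (η/2)
  have ht1 : 1 ≤ t := by
    have : 0 < 2 / η := by positivity
    linarith
  have e : (n:ℝ) ^ η = t * t := by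
    rw [← Real.rpow_add_of_nonneg (by positivity) (by positivity) (by positivity)]; congr 1; ring
  rw [e]
  have e2 : t / (η / 2) = (2 / η) * t := by field_simp
  rw [e2] at h2
  nlinarith

theorem aux_mono (q' A' p n' T' L' Z' q A B N T1 L1 Z3 : ℝ) (g1 : 0 ≤ q') (g2 : 0 ≤ A') (g3 : 0 ≤ p)
    (g4 : 0 ≤ n') (g5 : 0 ≤ T') (g6 : 0 ≤ L') (g7 : 0 ≤ Z')
    (h1 : q' ≤ q) (h2 : A' ≤ A) (h3 : p ≤ B) (h4 : n' = N)
    (h5 : T' ≤ T1) (h6 : L' ≤ L1) (h7 : Z' ≤ Z3) :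
    2 * q' * (3 * A' ^ 2 * p + 576 * n' * T' ^ 7 * Z' * L')
        ≤ 2 * q * (3 * A ^ 2 * B + 576 * N * T1 ^ 7 * Z3 * L1) := by
  have hA : 0 ≤ A := g2.trans h2
  have hq : 0 ≤ q := g1.trans h1
  have hZ3 : 0 ≤ Z3 := g7.trans h7
  have hT1 : 0 ≤ T1 := g5.trans h5
  rw [← h4]
  gcongr

theorem P_upper : ∀ᶠ n : ℕ in atTop, ¬ IsSquare n → ¬ Rep n →
    (#(Pset n) : ℝ) < (n:ℝ) ^ (1/2 - 1/1000 : ℝ) := by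
  have h1 : Tendsto (fun n : ℕ => (n:ℝ) ^ (1 / 1000 : ℝ)) atTop atTop :=
    (tendsto_rpow_atTop (by positivity)).comp tendsto_natCast_atTop_atTop
  filter_upwards [h1.eventually_ge_atTop 3, Tb_eventually (1/1000) (by norm_num),
    log_eventually (1/2000) (by norm_num), eventually_ge_atTop 1] with n ht hT hL hn1 hsq hbad
  have hn0 : (0:ℝ) < n := by exact_mod_cast hn1
  obtain ⟨t, htdef⟩ : ∃ t : ℝ, t = (n:ℝ) ^ (1/1000:ℝ) := ⟨_, rfl⟩
  rw [← htdef] at ht hT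
  have ht0 : 0 < t := by linarith
  have hnt : (n:ℝ) = t ^ 1000 := by
    rw [htdef, ← Real.rpow_natCast, ← Real.rpow_mul hn0.le]; norm_num
  have hst : √(n:ℝ) = t ^ 500 := by
    rw [hnt, Real.sqrt_eq_iff_mul_self_eq (by positivity) (by positivity), ← pow_add]
  have hgoal : (n:ℝ) ^ (1/2 - 1/1000 : ℝ) = t ^ 499 := by
    rw [htdef, ← Real.rpow_natCast, ← Real.rpow_mul hn0.le]; norm_num
  rw [hgoal]
  by_contra hcon
  push Not at hcon
  have hTb : ∀ m : ℕ, 0 < m → m ≤ 24 * n ^ 2 → m.divisors.card ≤ ⌊t⌋₊ :=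
    fun m a b => Nat.le_floor (hT m a b)
  have hTt : ((⌊t⌋₊ : ℕ):ℝ) ≤ t := Nat.floor_le ht0.le
  obtain ⟨Tb, hTbd⟩ : ∃ T, T = ⌊t⌋₊ := ⟨_, rfl⟩
  rw [← hTbd] at hTb hTt
  have hL2 : (1 + Real.log (4 * n)) ^ 2 ≤ t := by
    have h4n : 0 ≤ Real.log (4 * n) := Real.log_nonneg (by
      have : (1:ℝ) ≤ n := by exact_mod_cast hn1
      linarith)
    calc (1 + Real.log (4 * n)) ^ 2 ≤ ((n:ℝ) ^ (1/2000:ℝ)) ^ 2 := by gcongr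
      _ = t := by rw [htdef, ← Real.rpow_natCast, ← Real.rpow_mul hn0.le]; norm_num
  obtain ⟨Z, hZd⟩ : ∃ Z, Z = ⌈2 * t ^ 3⌉₊ := ⟨_, rfl⟩
  have hZ1 : 2 * t ^ 3 ≤ Z := by rw [hZd]; exact Nat.le_ceil _
  have ht1 : 1 ≤ t := by linarith
  have ht3 : 1 ≤ t ^ 3 := one_le_pow₀ ht1
  have hZ2 : (Z:ℝ) ≤ 3 * t ^ 3 := by
    have := Nat.ceil_lt_add_one (a := 2 * t ^ 3) (by positivity)
    rw [← hZd] at this; linarith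
  have hZ0 : 0 < Z := by
    have : (0:ℝ) < Z := by linarith
    exact_mod_cast this
  obtain ⟨Q, hQd⟩ : ∃ Q, Q = ⌊t ^ 125⌋₊ := ⟨_, rfl⟩
  have hQ2 : (Q:ℝ) ≤ t ^ 125 := by rw [hQd]; exact Nat.floor_le (by positivity)
  have hQ1 : t ^ 124 ≤ Q := by
    have := Nat.lt_floor_add_one (t ^ 125)
    rw [← hQd] at this
    have h2 : t ^ 125 = t ^ 124 * t := by rw [← pow_succ]
    have h3 : 1 ≤ t ^ 124 := one_le_pow₀ ht1
    nlinarith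
  have hQr : (0:ℝ) < Q := lt_of_lt_of_le (by positivity) hQ1
  have hQ0 : 0 < Q := by exact_mod_cast hQr
  have hQ4 : (Q:ℝ) ^ (-(1/4):ℝ) ≤ (t ^ 31)⁻¹ := by
    calc (Q:ℝ) ^ (-(1/4):ℝ) ≤ (t ^ 124) ^ (-(1/4):ℝ) :=
          Real.rpow_le_rpow_of_nonpos (by positivity) hQ1 (by norm_num)
      _ = (t ^ 31)⁻¹ := by
          rw [← Real.rpow_natCast, ← Real.rpow_mul ht0.le, ← Real.rpow_natCast t 31, ← Real.rpow_neg ht0.le]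
          norm_num
  have hup := Pset_card n Tb hTb
  have hst' := Pstar_card n hn1 Tb hTb Z hZ0
  have hmain := main_ineq n hn1 hsq hbad Tb hTb Z Q hQ0
  rw [hst] at hup hst'
  have hss : (#(Pstar n Z):ℝ) ≤ #(Pset n) := by
    exact_mod_cast card_le_card (by classical unfold Pstar; exact filter_subset _ _)
  set p := (#(Pstar n Z):ℝ)
  have hp0 : 0 ≤ p := Nat.cast_nonneg _
  have hup2 : p ≤ t ^ 501 := by
    calc p ≤ Tb * t ^ 500 := hss.trans hup
      _ ≤ t * t ^ 500 := by gcongr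
      _ = t ^ 501 := by ring
  have hlow : t ^ 499 / 2 ≤ p := by
    have : (Tb:ℝ) ^ 2 * t ^ 500 / Z ≤ t ^ 499 / 2 := by
      calc (Tb:ℝ) ^ 2 * t ^ 500 / Z ≤ t ^ 2 * t ^ 500 / (2 * t ^ 3) := by gcongr
        _ = t ^ 499 / 2 := by field_simp
    linarith
  have hr : p ^ 2 ≤ 2 * (t ^ 31)⁻¹ * (3 * (t ^ 125) ^ 2 * t ^ 501 + 576 * t ^ 1000 * t ^ 7 * (3 * t ^ 3) * t) := by
    refine hmain.trans ?_
    exact aux_mono _ _ _ _ _ _ _ _ _ _ _ _ _ _ (Real.rpow_nonneg (Nat.cast_nonneg _) _) (Nat.cast_nonneg _) hp0 hn0.le (Nat.cast_nonneg _) (sq_nonneg _) (Nat.cast_nonneg _)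
      hQ4 hQ2 hup2 hnt hTt hL2 hZ2
  have hl : (t ^ 499 / 2) ^ 2 ≤ p ^ 2 := by gcongr
  have h751 : t ^ 751 ≤ t ^ 1011 := pow_le_pow_right₀ ht1 (by norm_num)
  have hfin : (t ^ 499 / 2) ^ 2 ≤ 2 * (t ^ 31)⁻¹ * (1731 * t ^ 1011) := by
    refine (hl.trans hr).trans ?_
    gcongr
    nlinarith
  have h2 : t ^ 18 ≤ 13848 := by
    have e : 2 * (t ^ 31)⁻¹ * (1731 * t ^ 1011) = 3462 * t ^ 980 := by
      field_simp; norm_num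
    rw [e] at hfin
    have e2 : (t ^ 499 / 2) ^ 2 = t ^ 18 * t ^ 980 / 4 := by ring
    rw [e2] at hfin
    have : 0 < t ^ 980 := by positivity
    nlinarith
  have h3 : (3:ℝ) ^ 18 ≤ t ^ 18 := by gcongr
  norm_num at h3
  linarith

end E1148

namespace E1148
open Finset

/-- value of the character attached to `N` -/
noncomputable def jv (N m : ℕ) : ℤ := if Even m then 0 else jacobiSym N m

theorem jv_mod (N m : ℕ) : jv N (m % (4 * N)) = jv N m := by
  unfold jv
  have he : Even (m % (4 * N)) ↔ Even m := by
    rw [Nat.even_iff, Nat.even_iff, Nat.mod_mod_of_dvd _ (by omega)]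
  by_cases h : Even m
  · rw [if_pos h, if_pos (he.mpr h)]
  · rw [if_neg h, if_neg (fun h' => h (he.mp h'))]
    have := jacobiSym.mod_right (N:ℤ) (Nat.not_even_iff_odd.mp h)
    rw [this]; simp

theorem jv_mul (N m k : ℕ) : jv N (m * k) = jv N m * jv N k := by
  unfold jv
  by_cases h : Even m
  · rw [if_pos h, if_pos (h.mul_right k), zero_mul]
  by_cases h' : Even k
  · rw [if_pos h', if_pos (h'.mul_left m), mul_zero]
  · rw [if_neg h, if_neg h', if_neg (by rw [Nat.even_mul]; tauto)]
    have hm : m ≠ 0 := by rintro rfl; simp at h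
    have hk : k ≠ 0 := by rintro rfl; simp at h'
    exact jacobiSym.mul_right' _ hm hk

theorem jv_one (N : ℕ) : jv N 1 = 1 := by
  unfold jv; simp

theorem jv_tri (N m : ℕ) : jv N m = 0 ∨ jv N m = 1 ∨ jv N m = -1 := by
  unfold jv
  split_ifs
  · simp
  · exact jacobiSym.trichotomy _ _

theorem jv_prod (N M m : ℕ) : jv (N * M) m = jv N m * jv M m := by
  unfold jv
  split_ifs
  · simp
  · push_cast; exact jacobiSym.mul_left _ _ _

noncomputable def chi (N : ℕ) [NeZero N] : DirichletCharacter ℂ (4 * N) where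
  toFun a := ((jv N a.val : ℤ) : ℂ)
  map_one' := by
    have : Fact (1 < 4 * N) := ⟨by have := NeZero.pos N; omega⟩
    rw [ZMod.val_one, jv_one]; simp
  map_mul' a b := by
    rw [ZMod.val_mul, jv_mod, jv_mul]; push_cast; rfl
  map_nonunit' a ha := by
    have hN := NeZero.pos N
    have h1 : ¬ Nat.Coprime a.val (4 * N) := by
      intro h
      apply ha
      have := (ZMod.unitOfCoprime a.val h).isUnit
      simpa using this
    norm_cast
    unfold jv
    split_ifs with he
    · rfl
    · have hodd := Nat.not_even_iff_odd.mp he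
      have : a.val ≠ 0 := by intro h; rw [h] at hodd; simp at hodd
      have : NeZero a.val := ⟨this⟩
      rw [jacobiSym.eq_zero_iff_not_coprime]
      intro h2
      apply h1
      have h3 : Nat.Coprime a.val N := by
        rw [Nat.Coprime, Nat.gcd_comm]; rw [Int.gcd_natCast_natCast] at h2; exact h2
      refine Nat.Coprime.mul_right ?_ h3
      exact Nat.Coprime.pow_right 2 hodd.coprime_two_right

theorem chi_apply (N : ℕ) [NeZero N] (m : ℕ) : chi N (m : ZMod (4 * N)) = ((jv N m : ℤ) : ℂ) := by
  change ((jv N (m : ZMod (4 * N)).val : ℤ) : ℂ) = _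
  rw [ZMod.val_natCast, jv_mod]

theorem jv_ne (N : ℕ) (hN : 0 < N) (hsq : ¬ IsSquare N) : ∃ b : ℕ, jv N b = -1 := by
  obtain ⟨p, hp, hv⟩ : ∃ p : ℕ, p.Prime ∧ Odd (N.factorization p) := by
    obtain ⟨k, m, hk, hm⟩ := Nat.sq_mul_squarefree N
    have hk1 : k ≠ 1 := by
      rintro rfl
      exact hsq ⟨m, by rw [← hk]; ring⟩
    obtain ⟨p, hp, hpk⟩ := Nat.exists_prime_and_dvd hk1
    have hk0 : k ≠ 0 := by rintro rfl; simp at hk; omega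
    have hm0 : m ≠ 0 := by rintro rfl; simp at hk; omega
    refine ⟨p, hp, ?_⟩
    have h1 : k.factorization p = 1 := by
      apply le_antisymm
      · exact (Nat.squarefree_iff_factorization_le_one hk0).mp hm p
      · exact (hp.dvd_iff_one_le_factorization hk0).mp hpk
    rw [← hk, Nat.factorization_mul (by positivity) hk0, Nat.factorization_pow]
    simp [h1]
  obtain ⟨v, hvd⟩ : ∃ v, v = N.factorization p := ⟨_, rfl⟩
  obtain ⟨M, hM⟩ : ∃ M, M = N / p ^ v := ⟨_, rfl⟩
  have hN' : N = p ^ v * M := by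
    rw [hM, hvd]; exact (Nat.ordProj_mul_ordCompl_eq_self N p).symm
  have hpM : Nat.Coprime p M := by
    rw [hM, hvd]; exact Nat.coprime_ordCompl hp hN.ne'
  have hM0 : 0 < M := by
    rcases Nat.eq_zero_or_pos M with h | h
    · rw [h] at hN'; simp at hN'; omega
    · exact h
  rw [← hvd] at hv
  have hjpow : ∀ b, jv N b = (jv p b) ^ v * jv M b := by
    intro b
    rw [hN', jv_prod]
    congr 1
    clear hM hN' hvd
    obtain ⟨w, hw⟩ := hv
    have : ∀ w, jv (p ^ (w + 1)) b = jv p b ^ (w + 1) := by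
      intro w
      induction w with
      | zero => simp
      | succ w ih => rw [pow_succ, jv_prod, ih]; ring
    rw [hw]; exact this _
  suffices h : ∃ b, jv p b = -1 ∧ jv M b = 1 by
    obtain ⟨b, h1, h2⟩ := h
    exact ⟨b, by rw [hjpow, h1, h2, hv.neg_one_pow]; rfl⟩
  rcases hp.eq_two_or_odd' with h2 | hodd
  · subst h2
    have hMo : Odd M := Nat.coprime_two_left.mp hpM
    have hc : Nat.Coprime 8 M := Nat.Coprime.pow_left 3 hpM
    obtain ⟨b, hb1, hb2⟩ := Nat.chineseRemainder hc 5 1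
    have hb8 : b % 8 = 5 := hb1
    have hbo : Odd b := Nat.odd_iff.mpr (by omega)
    have hbe : ¬ Even b := Nat.not_even_iff_odd.mpr hbo
    refine ⟨b, ?_, ?_⟩
    · unfold jv
      rw [if_neg hbe]
      have := jacobiSym.at_two hbo
      push_cast
      rw [this, ZMod.χ₈_nat_eq_if_mod_eight, if_neg (by omega), if_neg (by omega)]
    · unfold jv
      rw [if_neg hbe, jacobiSym.quadratic_reciprocity_one_mod_four' hMo (by omega)]
      rw [jacobiSym.mod_left' (a₂ := 1), jacobiSym.one_left]
      exact_mod_cast hb2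
  · have hc : Nat.Coprime p (4 * M) := by
      refine Nat.Coprime.mul_right ?_ hpM
      exact Nat.Coprime.pow_right 2 hodd.coprime_two_right
    have : Fact p.Prime := ⟨hp⟩
    obtain ⟨c, hcns⟩ := FiniteField.exists_nonsquare (F := ZMod p) (by
      rw [ZMod.ringChar_zmod_n]; rintro rfl; revert hodd; decide)
    obtain ⟨b, hb1, hb2⟩ := Nat.chineseRemainder hc c.val 1
    have hb4 : b % 4 = 1 := by
      have : b ≡ 1 [MOD 4] := hb2.of_mul_right _
      exact this
    have hbo : Odd b := Nat.odd_iff.mpr (by omega)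
    have hbe : ¬ Even b := Nat.not_even_iff_odd.mpr hbo
    refine ⟨b, ?_, ?_⟩
    · unfold jv
      rw [if_neg hbe, jacobiSym.quadratic_reciprocity_one_mod_four' hodd hb4,
        ZMod.nonsquare_iff_jacobiSym_eq_neg_one]
      have : ((b:ℤ) : ZMod p) = c := by
        have h3 := (ZMod.natCast_eq_natCast_iff _ _ _).mpr hb1
        rw [ZMod.natCast_zmod_val] at h3
        exact_mod_cast h3
      rw [this]; exact hcns
    · rw [← jv_mod, hb2, jv_mod, jv_one]

theorem chi_ne_one (N : ℕ) [NeZero N] (hsq : ¬ IsSquare N) : chi N ≠ 1 := by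
  intro h
  obtain ⟨b, hb⟩ := jv_ne N (NeZero.pos N) hsq
  have h1 := chi_apply N b
  rw [hb, h] at h1
  by_cases hu : IsUnit (b : ZMod (4 * N))
  · rw [MulChar.one_apply hu] at h1
    norm_num at h1
    
  · rw [MulChar.map_nonunit _ hu] at h1
    norm_num at h1

theorem chi_sq (N : ℕ) [NeZero N] : (chi N) ^ 2 = 1 := by
  ext a
  rw [MulChar.pow_apply_coe, MulChar.one_apply_coe]
  have h := chi_apply N (a : ZMod (4 * N)).val
  rw [ZMod.natCast_zmod_val] at h
  have h2 : chi N (a : ZMod (4 * N)) ≠ 0 := by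
    have := (a.isUnit.map (chi N)).ne_zero
    exact this
  rw [h] at h2 ⊢
  rcases jv_tri N (a : ZMod (4 * N)).val with e | e | e <;> rw [e] at h2 ⊢ <;> simp at h2 ⊢

end E1148

namespace E1148
open Finset

section
variable (c : ℕ → ℂ)

/-- partial sums of the coefficients -/
noncomputable def pA (N : ℕ) : ℂ := ∑ k ∈ Icc 1 N, c k

noncomputable def hT (s : ℂ) (N : ℕ) : ℂ :=
  pA c (N + 1) * (((N + 1 : ℕ) : ℂ) ^ (-s) - ((N + 2 : ℕ) : ℂ) ^ (-s))

theorem abel_id (s : ℂ) (M : ℕ) :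
    ∑ k ∈ Icc 1 M, c k * (k : ℂ) ^ (-s) =
      pA c M * ((M + 1 : ℕ) : ℂ) ^ (-s) + ∑ N ∈ range M, hT c s N := by
  induction M with
  | zero => simp [pA]
  | succ M ih =>
    rw [Finset.sum_Icc_succ_top (by omega), ih, Finset.sum_range_succ]
    have : pA c (M + 1) = pA c M + c (M + 1) := by
      unfold pA; rw [Finset.sum_Icc_succ_top (by omega)]
    unfold hT
    rw [this]; ring

theorem cpow_diff (s : ℂ) (hs : 0 < s.re) (N : ℕ) :
    ‖((N + 1 : ℕ) : ℂ) ^ (-s) - ((N + 2 : ℕ) : ℂ) ^ (-s)‖ ≤ ‖s‖ * ((N + 1 : ℕ) : ℝ) ^ (-s.re - 1) := by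
  have hN : (0:ℝ) < ((N + 1 : ℕ) : ℝ) := by positivity
  have key := Convex.norm_image_sub_le_of_norm_hasDerivWithin_le (𝕜 := ℝ)
    (f := fun t : ℝ => (t : ℂ) ^ (-s)) (f' := fun t : ℝ => (-s) * (t : ℂ) ^ (-s - 1))
    (s := Set.Icc ((N + 1 : ℕ) : ℝ) ((N + 2 : ℕ) : ℝ))
    (C := ‖s‖ * ((N + 1 : ℕ) : ℝ) ^ (-s.re - 1))
    (x := ((N + 2 : ℕ) : ℝ)) (y := ((N + 1 : ℕ) : ℝ)) ?_ ?_ (convex_Icc _ _) ?_ ?_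
  · have e : ‖((N + 1 : ℕ) : ℝ) - ((N + 2 : ℕ) : ℝ)‖ = 1 := by
      push_cast
      rw [show ((N:ℝ) + 1 - (N + 2)) = -1 by ring]; simp
    rw [e, mul_one] at key
    simpa using key
  · intro t ht
    have ht0 : 0 < t := lt_of_lt_of_le hN ht.1
    apply HasDerivAt.hasDerivWithinAt
    apply HasDerivAt.comp_ofReal (e := fun y : ℂ => y ^ (-s))
    have := (hasDerivAt_id (t : ℂ)).cpow_const (c := -s) (by simp [ht0])
    simpa using this
  · intro t ht
    have ht0 : 0 < t := lt_of_lt_of_le hN ht.1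
    rw [norm_mul, norm_neg, Complex.norm_cpow_eq_rpow_re_of_pos ht0]
    gcongr ?_ * ?_
    simp only [Complex.sub_re, Complex.neg_re, Complex.one_re]
    exact Real.rpow_le_rpow_of_nonpos hN ht.1 (by linarith)
  · constructor <;> push_cast <;> linarith
  · constructor <;> push_cast <;> linarith

theorem hT_norm (B : ℝ) (hB : ∀ N, ‖pA c N‖ ≤ B) (s : ℂ) (hs : 0 < s.re) (N : ℕ) :
    ‖hT c s N‖ ≤ B * ‖s‖ * ((N + 1 : ℕ) : ℝ) ^ (-s.re - 1) := by
  unfold hT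
  rw [norm_mul, mul_assoc]
  exact mul_le_mul (hB _) (cpow_diff s hs N) (norm_nonneg _) ((norm_nonneg _).trans (hB 0))

theorem summable_rp (a : ℝ) (ha : 0 < a) : Summable (fun N : ℕ => ((N + 1 : ℕ) : ℝ) ^ (-a - 1)) := by
  have : Summable (fun N : ℕ => (N : ℝ) ^ (-a - 1)) := Real.summable_nat_rpow.mpr (by linarith)
  exact (summable_nat_add_iff 1).mpr this

theorem summable_hT (B : ℝ) (hB : ∀ N, ‖pA c N‖ ≤ B) (s : ℂ) (hs : 0 < s.re) :
    Summable (hT c s) :=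
  Summable.of_norm_bounded ((summable_rp s.re hs).mul_left (B * ‖s‖)) (hT_norm c B hB s hs)

noncomputable def Htot (s : ℂ) : ℂ := ∑' N, hT c s N

theorem Htot_norm (B : ℝ) (hB : ∀ N, ‖pA c N‖ ≤ B) (s : ℂ) (hs : 0 < s.re) :
    ‖Htot c s‖ ≤ B * ‖s‖ * ∑' N : ℕ, ((N + 1 : ℕ) : ℝ) ^ (-s.re - 1) := by
  unfold Htot
  rw [← tsum_mul_left]
  exact tsum_of_norm_bounded ((summable_rp s.re hs).mul_left (B * ‖s‖)).hasSum (hT_norm c B hB s hs)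

theorem tendsto_partial (B : ℝ) (hB : ∀ N, ‖pA c N‖ ≤ B) (s : ℂ) (hs : 0 < s.re) :
    Filter.Tendsto (fun M : ℕ => ∑ k ∈ Icc 1 M, c k * (k : ℂ) ^ (-s)) Filter.atTop
      (nhds (Htot c s)) := by
  have h1 := (summable_hT c B hB s hs).hasSum.tendsto_sum_nat
  have h2 : Filter.Tendsto (fun M : ℕ => pA c M * ((M + 1 : ℕ) : ℂ) ^ (-s)) Filter.atTop (nhds 0) := by
    have h3 : Filter.Tendsto (fun M : ℕ => B * ((M + 1 : ℕ) : ℝ) ^ (-s.re)) Filter.atTop (nhds 0) := by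
      have h4 := (tendsto_rpow_neg_atTop hs).comp
        ((tendsto_natCast_atTop_atTop (R := ℝ)).comp (Filter.tendsto_add_atTop_nat 1))
      have := h4.const_mul B
      rw [mul_zero] at this
      exact this
    refine squeeze_zero_norm (fun M => ?_) h3
    rw [norm_mul]
    have : ‖((M + 1 : ℕ) : ℂ) ^ (-s)‖ = ((M + 1 : ℕ) : ℝ) ^ (-s.re) := by
      rw [Complex.norm_natCast_cpow_of_pos (by omega)]; simp
    rw [this]
    gcongr
    exact hB M
  have := h2.add h1
  rw [zero_add] at this
  refine this.congr (fun M => ?_)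
  rw [abel_id]

theorem Htot_diff (B : ℝ) (hB : ∀ N, ‖pA c N‖ ≤ B) :
    DifferentiableOn ℂ (Htot c) {s : ℂ | 0 < s.re} := by
  intro s₀ hs₀
  have hs₀' : 0 < s₀.re := hs₀
  have hB0 : 0 ≤ B := (norm_nonneg _).trans (hB 0)
  have hopen : IsOpen ({s : ℂ | s₀.re / 2 < s.re} ∩ Metric.ball 0 (‖s₀‖ + 1)) :=
    (isOpen_lt continuous_const Complex.continuous_re).inter Metric.isOpen_ball
  have hd : DifferentiableOn ℂ (Htot c) ({s : ℂ | s₀.re / 2 < s.re} ∩ Metric.ball 0 (‖s₀‖ + 1)) := by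
    refine Complex.differentiableOn_tsum_of_summable_norm
      (u := fun N : ℕ => B * (‖s₀‖ + 1) * ((N + 1 : ℕ) : ℝ) ^ (-(s₀.re / 2) - 1))
      ((summable_rp _ (by linarith)).mul_left _) ?_ hopen ?_
    · intro N
      unfold hT
      apply Differentiable.differentiableOn
      have e1 : ((N + 1 : ℕ) : ℂ) ≠ 0 := by exact_mod_cast Nat.succ_ne_zero N
      have e2 : ((N + 2 : ℕ) : ℂ) ≠ 0 := by exact_mod_cast Nat.succ_ne_zero (N + 1)
      apply Differentiable.const_mul
      apply Differentiable.sub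
      · exact (differentiable_neg).const_cpow (Or.inl e1)
      · exact (differentiable_neg).const_cpow (Or.inl e2)
    · rintro N w ⟨hw1, hw2⟩
      have hw1' : s₀.re / 2 < w.re := hw1
      have hw3 : ‖w‖ < ‖s₀‖ + 1 := by simpa using hw2
      refine (hT_norm c B hB w (by linarith) N).trans ?_
      have : ((N + 1 : ℕ) : ℝ) ^ (-w.re - 1) ≤ ((N + 1 : ℕ) : ℝ) ^ (-(s₀.re / 2) - 1) := by
        apply Real.rpow_le_rpow_of_exponent_le
        · push_cast; linarith [(Nat.cast_nonneg N : (0:ℝ) ≤ N)]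
        · linarith
      gcongr
  have hmem : s₀ ∈ ({s : ℂ | s₀.re / 2 < s.re} ∩ Metric.ball 0 (‖s₀‖ + 1)) := by
    refine ⟨?_, by simp⟩
    change s₀.re / 2 < s₀.re
    linarith
  exact ((hd s₀ hmem).differentiableAt (hopen.mem_nhds hmem)).differentiableWithinAt

theorem tail_one (B : ℝ) (hB : ∀ N, ‖pA c N‖ ≤ B) (E : ℕ) :
    ‖Htot c 1 - ∑ k ∈ Icc 1 E, c k / k‖ ≤ 2 * B / (E + 1) := by
  have hB0 : 0 ≤ B := (norm_nonneg _).trans (hB 0)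
  have h1 := tendsto_partial c B hB 1 (by simp)
  have hterm : ∀ M, ∑ k ∈ Icc 1 M, c k * (k : ℂ) ^ (-(1:ℂ)) = ∑ k ∈ Icc 1 M, c k / k := by
    intro M
    apply Finset.sum_congr rfl
    intro k _
    rw [Complex.cpow_neg_one, div_eq_mul_inv]
  have h2 : Filter.Tendsto (fun M : ℕ => ‖∑ k ∈ Icc 1 M, c k * (k : ℂ) ^ (-(1:ℂ)) - ∑ k ∈ Icc 1 E, c k / k‖)
      Filter.atTop (nhds ‖Htot c 1 - ∑ k ∈ Icc 1 E, c k / k‖) := (h1.sub_const _).norm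
  refine le_of_tendsto h2 (Filter.eventually_atTop.mpr ⟨E, fun M hM => ?_⟩)
  rw [← hterm E, abel_id, abel_id]
  have hn : ∀ M : ℕ, ‖pA c M * ((M + 1 : ℕ) : ℂ) ^ (-(1:ℂ))‖ ≤ B / (M + 1) := by
    intro M
    rw [norm_mul, Complex.cpow_neg_one, norm_inv, Complex.norm_natCast, ← div_eq_mul_inv]
    push_cast
    gcongr
    exact hB M
  have hsum : ∀ M, E ≤ M → ‖∑ N ∈ range M, hT c 1 N - ∑ N ∈ range E, hT c 1 N‖ ≤
      B / (E + 1) - B / (M + 1) := by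
    intro M hM
    induction M, hM using Nat.le_induction with
    | base => simp
    | succ M hM ih =>
      rw [Finset.sum_range_succ, add_sub_right_comm]
      refine (norm_add_le _ _).trans ?_
      have : ‖hT c 1 M‖ ≤ B * (1 / (M + 1) - 1 / (M + 2)) := by
        unfold hT
        rw [norm_mul]
        have e : ‖((M + 1 : ℕ) : ℂ) ^ (-(1:ℂ)) - ((M + 2 : ℕ) : ℂ) ^ (-(1:ℂ))‖ =
            1 / (M + 1) - 1 / (M + 2) := by
          rw [Complex.cpow_neg_one, Complex.cpow_neg_one]
          have : (((M + 1 : ℕ) : ℂ)⁻¹ - ((M + 2 : ℕ) : ℂ)⁻¹) =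
            (((1 / (M + 1) - 1 / (M + 2) : ℝ)) : ℂ) := by push_cast; simp
          rw [this, Complex.norm_real, Real.norm_of_nonneg]
          rw [sub_nonneg]
          gcongr
          norm_num
        rw [e]
        have : (0:ℝ) ≤ 1 / (M + 1) - 1 / (M + 2) := by
          rw [sub_nonneg]
          gcongr
          norm_num
        gcongr
        exact hB _
      have e3 : B * (1 / ((M:ℝ) + 1) - 1 / (M + 2)) = B / (M + 1) - B / ((M + 1 : ℕ) + 1) := by
        push_cast
        ring
      linarith
  have e4 : pA c M * ((M + 1 : ℕ) : ℂ) ^ (-(1:ℂ)) + ∑ N ∈ range M, hT c 1 N -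
      (pA c E * ((E + 1 : ℕ) : ℂ) ^ (-(1:ℂ)) + ∑ N ∈ range E, hT c 1 N) =
      pA c M * ((M + 1 : ℕ) : ℂ) ^ (-(1:ℂ)) - pA c E * ((E + 1 : ℕ) : ℂ) ^ (-(1:ℂ)) +
      (∑ N ∈ range M, hT c 1 N - ∑ N ∈ range E, hT c 1 N) := by ring
  rw [e4]
  refine (norm_add_le _ _).trans ?_
  have := norm_sub_le (pA c M * ((M + 1 : ℕ) : ℂ) ^ (-(1:ℂ))) (pA c E * ((E + 1 : ℕ) : ℂ) ^ (-(1:ℂ)))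
  have h5 := hsum M hM
  have h6 := hn M
  have h7 := hn E
  have : 2 * B / ((E:ℝ) + 1) = B / (E + 1) + B / (E + 1) := by ring
  linarith
end
end E1148

namespace E1148
open Finset

section
variable {q : ℕ} [NeZero q] (χ : DirichletCharacter ℂ q)

noncomputable abbrev cf (k : ℕ) : ℂ := χ (k : ZMod q)

theorem sum_range_zmod (f : ZMod q → ℂ) : ∑ k ∈ range q, f (k : ZMod q) = ∑ a : ZMod q, f a := by
  refine Finset.sum_nbij' (fun k => (k : ZMod q)) ZMod.val ?_ ?_ ?_ ?_ ?_
  · intro a _; simp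
  · intro a _; simp [ZMod.val_lt]
  · intro a ha; exact ZMod.val_cast_of_lt (by simpa using ha)
  · intro a _; simp
  · intro a _; rfl

theorem pA_range (N : ℕ) : pA (cf χ) N = ∑ k ∈ range N, χ ((k : ZMod q) + 1) := by
  unfold pA
  rw [Finset.range_eq_Ico, ← Finset.Ico_add_one_right_eq_Icc, Finset.sum_Ico_add' (fun k : ℕ => χ (k : ZMod q)) 0 N 1 |>.symm]
  simp

theorem pA_period (hχ : χ ≠ 1) (N : ℕ) : pA (cf χ) (N + q) = pA (cf χ) N := by
  rw [pA_range, pA_range, Finset.sum_range_add]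
  have : ∑ x ∈ range q, χ (((N + x : ℕ) : ZMod q) + 1) = 0 := by
    have h := sum_range_zmod (fun a : ZMod q => χ ((N : ZMod q) + a + 1))
    have h2 : ∑ a : ZMod q, χ ((N : ZMod q) + a + 1) = ∑ a : ZMod q, χ a := by
      rw [← Equiv.sum_comp (Equiv.addLeft ((N : ZMod q) + 1)) (fun a => χ a)]
      apply Finset.sum_congr rfl
      intro a _
      simp only [Equiv.coe_addLeft]
      congr 1; ring
    rw [h2, MulChar.sum_eq_zero_of_ne_one hχ] at h
    rw [← h]
    apply Finset.sum_congr rfl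
    intro a _
    push_cast; rfl
  rw [this, add_zero]

theorem pA_le (hχ : χ ≠ 1) (N : ℕ) : ‖pA (cf χ) N‖ ≤ q := by
  have hq := NeZero.pos q
  have h1 : ∀ m r, pA (cf χ) (r + q * m) = pA (cf χ) r := by
    intro m r
    induction m with
    | zero => simp
    | succ m ih => rw [Nat.mul_succ, ← add_assoc, pA_period χ hχ, ih]
  rw [← Nat.mod_add_div N q, h1]
  unfold pA
  refine (norm_sum_le _ _).trans ?_
  calc ∑ k ∈ Icc 1 (N % q), ‖cf χ k‖ ≤ ∑ k ∈ Icc 1 (N % q), (1:ℝ) :=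
        Finset.sum_le_sum (fun k _ => χ.norm_le_one _)
    _ = (N % q : ℕ) := by simp
    _ ≤ q := by exact_mod_cast (Nat.mod_lt N hq).le

theorem L_eq_H (hχ : χ ≠ 1) (s : ℂ) (hs : 0 < s.re) :
    DirichletCharacter.LFunction χ s = Htot (cf χ) s := by
  have hopen : IsOpen {s : ℂ | 0 < s.re} := isOpen_lt continuous_const Complex.continuous_re
  have hpre : IsPreconnected {s : ℂ | 0 < s.re} := (convex_halfSpace_re_gt 0).isPreconnected
  have h1 : AnalyticOnNhd ℂ (DirichletCharacter.LFunction χ) {s : ℂ | 0 < s.re} :=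
    (DirichletCharacter.differentiable_LFunction hχ).differentiableOn.analyticOnNhd hopen
  have h2 : AnalyticOnNhd ℂ (Htot (cf χ)) {s : ℂ | 0 < s.re} :=
    (Htot_diff (cf χ) q (pA_le χ hχ)).analyticOnNhd hopen
  refine h1.eqOn_of_preconnected_of_eventuallyEq h2 hpre (z₀ := 2) (by simp) ?_ hs
  have : {s : ℂ | 1 < s.re} ∈ nhds (2:ℂ) :=
    (isOpen_lt continuous_const Complex.continuous_re).mem_nhds (by simp)
  filter_upwards [this] with w hw
  have hw1 : 1 < w.re := hw
  rw [DirichletCharacter.LFunction_eq_LSeries χ hw1]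
  have h3 := (DirichletCharacter.LSeriesSummable_of_one_lt_re χ hw1).hasSum.tendsto_sum_nat
  have h4 := tendsto_partial (cf χ) q (pA_le χ hχ) w (by linarith)
  have h5 := h3.comp (Filter.tendsto_add_atTop_nat 1)
  refine tendsto_nhds_unique h5 (h4.congr (fun M => ?_))
  simp only [Function.comp]
  rw [Finset.range_eq_Ico, Finset.sum_eq_sum_Ico_succ_bot (by omega), LSeries.term_zero, zero_add,
    zero_add, ← Finset.Ico_add_one_right_eq_Icc]
  apply Finset.sum_congr rfl
  intro k hk
  have : k ≠ 0 := by simp at hk; omega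
  rw [LSeries.term_of_ne_zero this, Complex.cpow_neg, div_eq_mul_inv]

/-- an absolute constant -/
noncomputable def cL : ℝ := 7 / 2 * ∑' N : ℕ, ((N + 1 : ℕ) : ℝ) ^ (-(1/2) - 1 : ℝ)

theorem L_bound (hχ : χ ≠ 1) (s : ℂ) (hs : ‖s - 2‖ ≤ 3 / 2) :
    ‖DirichletCharacter.LFunction χ s‖ ≤ cL * q := by
  have hre : 1 / 2 ≤ s.re := by
    have := Complex.abs_re_le_norm (s - 2)
    have h2 := neg_abs_le (s - 2).re
    simp at h2 this
    linarith
  have hn : ‖s‖ ≤ 7 / 2 := by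
    have := norm_add_le (s - 2) 2
    simp at this
    linarith
  rw [L_eq_H χ hχ s (by linarith)]
  refine (Htot_norm (cf χ) q (pA_le χ hχ) s (by linarith)).trans ?_
  have h3 : ∑' N : ℕ, ((N + 1 : ℕ) : ℝ) ^ (-s.re - 1) ≤ ∑' N : ℕ, ((N + 1 : ℕ) : ℝ) ^ (-(1/2) - 1 : ℝ) := by
    refine Summable.tsum_le_tsum (fun N => ?_) (summable_rp _ (by linarith)) (summable_rp _ (by norm_num))
    apply Real.rpow_le_rpow_of_exponent_le
    · push_cast; linarith [(Nat.cast_nonneg N : (0:ℝ) ≤ N)]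
    · linarith
  have h4 : 0 ≤ ∑' N : ℕ, ((N + 1 : ℕ) : ℝ) ^ (-s.re - 1) := tsum_nonneg (fun N => by positivity)
  unfold cL
  calc (q:ℝ) * ‖s‖ * ∑' N : ℕ, ((N + 1 : ℕ) : ℝ) ^ (-s.re - 1)
      ≤ q * (7/2) * ∑' N : ℕ, ((N + 1 : ℕ) : ℝ) ^ (-(1/2) - 1 : ℝ) := by gcongr
    _ = _ := by ring

theorem cL_pos : 0 < cL := by
  unfold cL
  have : (0:ℝ) < ∑' N : ℕ, ((N + 1 : ℕ) : ℝ) ^ (-(1/2) - 1 : ℝ) :=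
    (summable_rp _ (by norm_num)).tsum_pos (fun N => by positivity) 0 (by simp)
  positivity

theorem L_real (hχ : χ ≠ 1) (hr : ∀ k : ℕ, (χ (k : ZMod q)).im = 0) (b : ℝ) (hb : 0 < b) :
    (DirichletCharacter.LFunction χ b).im = 0 := by
  rw [L_eq_H χ hχ b (by simpa using hb)]
  have h := tendsto_partial (cf χ) q (pA_le χ hχ) b (by simpa using hb)
  have h2 := (Complex.continuous_im.tendsto _).comp h
  refine tendsto_nhds_unique h2 (tendsto_const_nhds.congr (fun M => ?_))
  simp only [Function.comp]
  rw [Complex.im_sum]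
  symm
  apply Finset.sum_eq_zero
  intro k _
  have e : ((k:ℂ) ^ (-(b:ℂ))) = (((k:ℝ) ^ (-b) : ℝ) : ℂ) := by
    rw [Complex.ofReal_cpow (by positivity)]; push_cast; rfl
  rw [e, Complex.mul_im]
  simp [hr k]

theorem L_tail (hχ : χ ≠ 1) (E : ℕ) :
    ‖DirichletCharacter.LFunction χ 1 - ∑ k ∈ Icc 1 E, χ (k : ZMod q) / k‖ ≤ 2 * q / (E + 1) := by
  rw [L_eq_H χ hχ 1 (by simp)]
  exact tail_one (cf χ) q (pA_le χ hχ) E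

theorem L_one_le (hχ : χ ≠ 1) : ‖DirichletCharacter.LFunction χ 1‖ ≤ 3 + Real.log q := by
  have h1 := L_tail χ hχ q
  have h2 : ‖∑ k ∈ Icc 1 q, χ (k : ZMod q) / k‖ ≤ 1 + Real.log q := by
    refine (norm_sum_le _ _).trans (le_trans (Finset.sum_le_sum (fun k _ => ?_)) (harm_le q))
    rw [norm_div, Complex.norm_natCast]
    gcongr
    exact χ.norm_le_one _
  have h3 : 2 * (q:ℝ) / (q + 1) ≤ 2 := by
    rw [div_le_iff₀ (by positivity)]; linarith
  have h4 := norm_le_norm_add_norm_sub' (DirichletCharacter.LFunction χ 1) (∑ k ∈ Icc 1 q, χ (k : ZMod q) / k)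
  linarith
end
end E1148

namespace E1148
open Finset

noncomputable def Zf : ℂ → ℂ := DirichletCharacter.LFunctionTrivChar₁ 1

theorem Zf_diff : Differentiable ℂ Zf := DirichletCharacter.differentiable_LFunctionTrivChar₁ 1

theorem Zf_one : Zf 1 = 1 := by
  unfold Zf; simp

theorem Zf_ne (s : ℂ) (hs : s ≠ 1) : Zf s = (s - 1) * riemannZeta s := by
  unfold Zf DirichletCharacter.LFunctionTrivChar₁
  rw [Function.update_of_ne hs, DirichletCharacter.LFunctionTrivChar,
    DirichletCharacter.LFunction_modOne_eq]

theorem Zf_bound : ∃ K : ℝ, 1 ≤ K ∧ ∀ s : ℂ, ‖s - 2‖ ≤ 3 / 2 → ‖Zf s‖ ≤ K := by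
  obtain ⟨K, hK⟩ := (isCompact_closedBall (2:ℂ) (3/2)).exists_bound_of_continuousOn
    Zf_diff.continuous.continuousOn
  refine ⟨max K 1, le_max_right _ _, fun s hs => (hK s ?_).trans (le_max_left _ _)⟩
  rw [Metric.mem_closedBall, dist_eq_norm]; exact hs

/-- real core of Estermann's argument -/
theorem ester_core (b : ℕ → ℝ) (hb : ∀ j, 0 ≤ b j) (hb0 : 1 ≤ b 0) (l M u S : ℝ)
    (hM : ∀ j, |b j - l| ≤ M * (2 / 3) ^ j) (hu : 1 < u) (hu2 : u ≤ 9 / 8)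
    (hS : HasSum (fun j => (b j - l) * u ^ j) S) (hS0 : S - l / (u - 1) ≤ 0) (J : ℕ) (hJ : 0 < J) :
    1 - l * u ^ J / (u - 1) - 4 * M * (3 / 4) ^ J ≤ 0 := by
  have hM0 : 0 ≤ M := by
    have := hM 0
    have h2 := abs_nonneg (b 0 - l)
    simp at this; linarith
  have h1 := hS.summable.sum_add_tsum_nat_add J
  rw [hS.tsum_eq] at h1
  have h2 : ∑ j ∈ range J, (b j - l) * u ^ j ≥ 1 - l * ((u ^ J - 1) / (u - 1)) := by
    have e : ∑ j ∈ range J, (b j - l) * u ^ j = ∑ j ∈ range J, b j * u ^ j - l * ∑ j ∈ range J, u ^ j := by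
      rw [Finset.mul_sum, ← Finset.sum_sub_distrib]
      apply Finset.sum_congr rfl; intros; ring
    rw [e, geom_sum_eq hu.ne']
    have : b 0 * u ^ 0 ≤ ∑ j ∈ range J, b j * u ^ j :=
      Finset.single_le_sum (f := fun j => b j * u ^ j)
        (fun j _ => mul_nonneg (hb j) (by positivity)) (by simpa using hJ)
    simp at this
    linarith
  have hgeo : HasSum (fun j : ℕ => M * (3/4:ℝ) ^ (j + J)) (4 * M * (3 / 4) ^ J) := by
    have := (hasSum_geometric_of_lt_one (r := (3/4:ℝ)) (by norm_num) (by norm_num)).mul_left (M * (3/4) ^ J)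
    have e1 : (fun j : ℕ => M * (3/4:ℝ) ^ (j + J)) = fun i => M * (3/4) ^ J * (3/4) ^ i := by
      funext j; ring
    rw [e1, show 4 * M * (3/4:ℝ) ^ J = M * (3/4) ^ J * (1 - 3/4)⁻¹ by norm_num; ring]
    exact this
  have h3 : ‖∑' i, (b (i + J) - l) * u ^ (i + J)‖ ≤ 4 * M * (3 / 4) ^ J := by
    refine tsum_of_norm_bounded hgeo (fun i => ?_)
    rw [Real.norm_eq_abs, abs_mul, abs_of_nonneg (by positivity : 0 ≤ u ^ (i + J))]
    calc |b (i + J) - l| * u ^ (i + J) ≤ (M * (2/3) ^ (i + J)) * (9/8) ^ (i + J) := by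
          gcongr
          exact hM _
      _ = M * (3/4) ^ (i + J) := by rw [mul_assoc, ← mul_pow]; norm_num
  have h4 := (abs_le.mp (by rwa [Real.norm_eq_abs] at h3)).1
  have e2 : l * u ^ J / (u - 1) = l * ((u ^ J - 1) / (u - 1)) + l / (u - 1) := by ring
  rw [e2]
  linarith

theorem ester_J (l M u : ℝ) (hM : 1 ≤ M) (hu : 1 < u) (hu2 : u ≤ 9 / 8)
    (h : ∀ J : ℕ, 0 < J → 1 - l * u ^ J / (u - 1) - 4 * M * (3 / 4) ^ J ≤ 0) :
    (u - 1) / 4 * (8 * M) ^ (-(4 * (u - 1))) ≤ l := by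
  obtain ⟨t, ht⟩ : ∃ t, t = Real.log (8 * M) * 4 := ⟨_, rfl⟩
  have hlog : 0 < Real.log (8 * M) := Real.log_pos (by linarith)
  have ht0 : 0 < t := by rw [ht]; linarith
  obtain ⟨J, hJ⟩ : ∃ J, J = ⌈t⌉₊ := ⟨_, rfl⟩
  have hJ1 : t ≤ J := by rw [hJ]; exact Nat.le_ceil t
  have hJ2 : (J:ℝ) < t + 1 := by rw [hJ]; exact Nat.ceil_lt_add_one ht0.le
  have hJ0 : 0 < J := by rw [hJ]; exact Nat.ceil_pos.mpr ht0
  have h1 := h J hJ0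
  have h34 : Real.log (3/4) ≤ -(1/4) := by
    have := Real.log_le_sub_one_of_pos (show (0:ℝ) < 3/4 by norm_num)
    linarith
  have h2 : (3/4 : ℝ) ^ J ≤ 1 / (8 * M) := by
    rw [← Real.rpow_natCast, Real.rpow_def_of_pos (by norm_num), one_div,
      ← Real.exp_log (show (0:ℝ) < (8 * M)⁻¹ by positivity), Real.log_inv]
    apply Real.exp_le_exp.mpr
    have : t * (1/4) ≤ -Real.log (3/4) * J := by nlinarith
    rw [ht] at this
    linarith
  have h3 : 4 * M * (3/4) ^ J ≤ 1 / 2 := by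
    calc 4 * M * (3/4) ^ J ≤ 4 * M * (1 / (8 * M)) := by gcongr
      _ = 1 / 2 := by field_simp; norm_num
  have h4 : 1 / 2 ≤ l * u ^ J / (u - 1) := by linarith
  have hu0 : 0 < u - 1 := by linarith
  rw [le_div_iff₀ hu0] at h4
  have h5 : u ^ J ≤ 2 * (8 * M) ^ (4 * (u - 1)) := by
    rw [← Real.rpow_natCast, Real.rpow_def_of_pos (by linarith), Real.rpow_def_of_pos (by linarith)]
    have hlu : Real.log u ≤ u - 1 := Real.log_le_sub_one_of_pos (by linarith)
    have hlu0 : 0 < Real.log u := Real.log_pos hu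
    have h6 : Real.log u * J ≤ Real.log u + Real.log (8 * M) * (4 * (u - 1)) := by
      calc Real.log u * J ≤ Real.log u * (t + 1) := by gcongr
        _ = Real.log u + Real.log u * t := by ring
        _ ≤ Real.log u + (u - 1) * t := by gcongr
        _ = _ := by rw [ht]; ring
    calc Real.exp (Real.log u * J) ≤ Real.exp (Real.log u + Real.log (8 * M) * (4 * (u - 1))) :=
          Real.exp_le_exp.mpr h6
      _ = u * Real.exp (Real.log (8 * M) * (4 * (u - 1))) := by
          rw [Real.exp_add, Real.exp_log (by linarith)]
      _ ≤ _ := by gcongr; linarith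
  have hl : 0 < l := by
    by_contra hl
    have : l * u ^ J ≤ 0 := mul_nonpos_of_nonpos_of_nonneg (by linarith) (by positivity)
    linarith
  have h7 : 1 / 2 * (u - 1) ≤ l * (2 * (8 * M) ^ (4 * (u - 1))) := h4.trans (by gcongr)
  rw [Real.rpow_neg (by positivity), ← div_eq_mul_inv, div_le_iff₀ (by positivity)]
  linarith

end E1148

namespace E1148
open Finset

theorem iter_inv (j : ℕ) : iteratedDeriv j (fun z : ℂ => (z - 1)⁻¹) 2 = (-1) ^ j * (j.factorial : ℂ) := by
  rw [iteratedDeriv_comp_sub_const (f := fun z : ℂ => z⁻¹)]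
  simp only
  rw [iteratedDeriv_eq_iterate]
  have := iter_deriv_inv (𝕜 := ℂ) j (2 - 1)
  rw [show (fun z : ℂ => z⁻¹) = Inv.inv from rfl, this]
  norm_num

open scoped ComplexOrder in
theorem estermann : ∃ K : ℝ, 1 ≤ K ∧ ∀ (f : ℕ → ℂ) (H : ℂ → ℂ) (M β : ℝ), 0 ≤ f → 1 ≤ f 1 →
    (∀ s : ℂ, 1 < s.re → LSeriesSummable f s) → Differentiable ℂ H →
    (∀ s : ℂ, 1 < s.re → LSeries f s = riemannZeta s * H s) →
    (∀ s : ℂ, ‖s - 2‖ ≤ 3 / 2 → ‖H s‖ ≤ M) → (H 1).im = 0 → 1 ≤ M → 7 / 8 ≤ β → β < 1 →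
    (riemannZeta β * H β).re ≤ 0 →
    (1 - β) / 4 * (8 * (K * M)) ^ (-(4 * (1 - β))) ≤ (H 1).re := by
  obtain ⟨K, hK1, hK⟩ := Zf_bound
  refine ⟨4 * K, by linarith, ?_⟩
  intro f H M β hf hf1 hsum hH hL hM him hM1 hβ hβ1 hre
  obtain ⟨l, hl⟩ : ∃ l, l = (H 1).re := ⟨_, rfl⟩
  have hHl : H 1 = (l : ℂ) := by
    rw [hl]; apply Complex.ext <;> simp [him]
  have habs : LSeries.abscissaOfAbsConv f < ((2:ℝ) : EReal) := by
    have : LSeries.abscissaOfAbsConv f ≤ (1:ℝ) := by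
      apply LSeries.abscissaOfAbsConv_le_of_forall_lt_LSeriesSummable
      intro y hy
      exact hsum y (by simpa using hy)
    exact lt_of_le_of_lt this (by exact_mod_cast one_lt_two)
  obtain ⟨W, hW⟩ : ∃ W : ℂ → ℂ, W = fun s => Zf s * H s := ⟨_, rfl⟩
  have hWd : Differentiable ℂ W := by rw [hW]; exact Zf_diff.mul hH
  have hW1 : W 1 = l := by rw [hW]; simp [Zf_one, hHl]
  obtain ⟨G, hG⟩ : ∃ G : ℂ → ℂ, G = dslope W 1 := ⟨_, rfl⟩
  have hGd : Differentiable ℂ G := by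
    rw [hG, ← differentiableOn_univ, Complex.differentiableOn_dslope Filter.univ_mem]
    exact hWd.differentiableOn
  have hGne : ∀ s : ℂ, s ≠ 1 → G s = riemannZeta s * H s - l * (s - 1)⁻¹ := by
    intro s hs
    have hs' : s - 1 ≠ 0 := sub_ne_zero.mpr hs
    rw [hG, dslope_of_ne _ hs, slope_def_field, hW1, hW]
    simp only
    rw [Zf_ne s hs]
    field_simp
  have hGb : ∀ s ∈ Metric.sphere (2:ℂ) (3/2), ‖G s‖ ≤ 4 * K * M := by
    intro s hs
    have hs2 : ‖s - 2‖ = 3 / 2 := by simpa [dist_eq_norm] using hs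
    have h12 : 1 / 2 ≤ ‖s - 1‖ := by
      have := norm_sub_le (s - 1) 1
      rw [show s - 1 - 1 = s - 2 by ring, hs2] at this
      simp at this
      linarith
    have hs1 : s ≠ 1 := by rintro rfl; norm_num at h12
    rw [hG, dslope_of_ne _ hs1, slope_def_field, norm_div, div_le_iff₀ (by linarith), hW1]
    have e1 : ‖W s‖ ≤ K * M := by
      rw [hW]; simp only; rw [norm_mul]
      exact mul_le_mul (hK s hs2.le) (hM s hs2.le) (norm_nonneg _) (by linarith)
    have e2 : ‖(l:ℂ)‖ ≤ K * M := by
      rw [← hHl]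
      refine (hM 1 (by norm_num)).trans ?_
      nlinarith
    have e3 := norm_sub_le (W s) l
    have : K * M ≥ 0 := by positivity
    nlinarith
  have hcau : ∀ j, ‖iteratedDeriv j G 2‖ ≤ j.factorial * (4 * K * M) / (3/2) ^ j := fun j =>
    Complex.norm_iteratedDeriv_le_of_forall_mem_sphere_norm_le j (by norm_num) hGd.diffContOnCl hGb
  have hiter : ∀ j, iteratedDeriv j G 2 = iteratedDeriv j (LSeries f) 2 - l * ((-1) ^ j * (j.factorial : ℂ)) := by
    intro j
    have hopen : IsOpen {s : ℂ | 1 < s.re} := isOpen_lt continuous_const Complex.continuous_re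
    have hmem : {s : ℂ | 1 < s.re} ∈ nhds (2:ℂ) := hopen.mem_nhds (by simp)
    have heq : G =ᶠ[nhds 2] (fun s => LSeries f s - l * (s - 1)⁻¹) := by
      filter_upwards [hmem] with s hs
      have hs' : 1 < s.re := hs
      rw [hL s hs', hGne]
      rintro rfl; simp at hs'
    rw [heq.iteratedDeriv_eq j]
    have hinv : ContDiffAt ℂ j (fun s : ℂ => l * (s - 1)⁻¹) 2 := by
      apply ContDiffAt.mul contDiffAt_const
      apply ContDiffAt.inv (by fun_prop) (by norm_num)
    have hLf : ContDiffAt ℂ j (LSeries f) 2 := by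
      have : AnalyticAt ℂ (LSeries f) 2 := LSeries_analyticOnNhd f 2 (by simpa using! habs)
      exact this.contDiffAt
    rw [iteratedDeriv_fun_sub hLf hinv, iteratedDeriv_const_mul_field, iter_inv]
  obtain ⟨b, hb⟩ : ∃ b : ℕ → ℝ, b = fun j => ((-1) ^ j * iteratedDeriv j (LSeries f) 2).re / j.factorial := ⟨_, rfl⟩
  have hpos : ∀ j, 0 ≤ (-1) ^ j * iteratedDeriv j (LSeries f) (2:ℂ) := by
    intro j
    have := LSeries.iteratedDeriv_alternating hf (x := 2) habs j
    simpa using this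
  have hbC : ∀ j, (b j : ℂ) = (-1) ^ j * iteratedDeriv j (LSeries f) 2 / j.factorial := by
    intro j
    rw [hb]
    push_cast
    congr 1
    obtain ⟨h1, h2⟩ := Complex.le_def.mp (hpos j)
    apply Complex.ext
    · simp
    · rw [← h2]; simp
  have hfac : ∀ j : ℕ, (j.factorial : ℂ) ≠ 0 := fun j => by exact_mod_cast j.factorial_ne_zero
  have hsgn : ∀ j : ℕ, ((-1:ℂ) ^ j) * (-1) ^ j = 1 := fun j => by rw [← mul_pow]; norm_num
  have hbl : ∀ j, ((b j - l : ℝ) : ℂ) = (-1) ^ j * iteratedDeriv j G 2 / j.factorial := by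
    intro j
    rw [hiter, mul_sub]
    push_cast
    rw [hbC, sub_div]
    congr 1
    rw [eq_div_iff (hfac j)]
    linear_combination -(l:ℂ) * (j.factorial : ℂ) * hsgn j
  have hb0 : ∀ j, 0 ≤ b j := by
    intro j
    rw [hb]
    have := (Complex.le_def.mp (hpos j)).1
    exact div_nonneg (by simpa using this) (by positivity)
  have hb1 : 1 ≤ b 0 := by
    have h0 : (b 0 : ℂ) = LSeries f 2 := by rw [hbC]; simp
    have hs := hsum 2 (by simp)
    have hle : LSeries.term f 2 1 ≤ LSeries f 2 := by
      have := hs.sum_le_tsum {1} (fun n _ => by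
        have := LSeries.term_nonneg (hf n) 2
        simpa using this)
      simpa [LSeries] using this
    have h2 : (1:ℂ) ≤ b 0 := by
      rw [h0]
      refine le_trans ?_ hle
      rw [LSeries.term_of_ne_zero one_ne_zero]
      simpa using hf1
    have := (Complex.le_def.mp h2).1
    simpa using this
  have hbM : ∀ j, |b j - l| ≤ (4 * K * M) * (2/3) ^ j := by
    intro j
    have h1 : ‖((b j - l : ℝ) : ℂ)‖ ≤ (4 * K * M) * (2/3) ^ j := by
      rw [hbl, norm_div, norm_mul, norm_pow, norm_neg, norm_one, one_pow, one_mul, Complex.norm_natCast,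
        div_le_iff₀ (by positivity)]
      refine (hcau j).trans (le_of_eq ?_)
      rw [show (2/3:ℝ) = (3/2)⁻¹ by norm_num, inv_pow]
      field_simp
    rwa [Complex.norm_real] at h1
  obtain ⟨u, hu⟩ : ∃ u : ℝ, u = 2 - β := ⟨_, rfl⟩
  have htay : HasSum (fun j => (((b j - l) * u ^ j : ℝ) : ℂ)) (G β) := by
    have := Complex.hasSum_taylorSeries_of_entire hGd 2 β
    have e : (fun j => (((b j - l) * u ^ j : ℝ) : ℂ)) = fun n : ℕ => (n.factorial : ℂ)⁻¹ • ((β:ℂ) - 2) ^ n • iteratedDeriv n G 2 := by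
      funext j
      rw [Complex.ofReal_mul, hbl, hu, smul_eq_mul, smul_eq_mul, show (β:ℂ) - 2 = (-1) * ((2 - β : ℝ) : ℂ) by push_cast; ring, mul_pow]
      push_cast
      ring
    rw [e]; exact this
  have hGre : (G β).re = (riemannZeta β * H β).re + l / (u - 1) := by
    have hβne : (β:ℂ) ≠ 1 := by exact_mod_cast hβ1.ne
    rw [hGne β hβne]
    have : (l:ℂ) * ((β:ℂ) - 1)⁻¹ = ((l * (β - 1)⁻¹ : ℝ) : ℂ) := by push_cast; rfl
    rw [Complex.sub_re, this, Complex.ofReal_re, hu, show 2 - β - 1 = -(β - 1) by ring, div_neg, div_eq_mul_inv]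
    ring
  have hS := Complex.hasSum_re htay
  simp only [Complex.ofReal_re] at hS
  have hmain := ester_core b hb0 hb1 l (4 * K * M) u _ hbM (by linarith) (by linarith) hS
    (by rw [hGre]; linarith)
  have hfin := ester_J l (4 * K * M) u (by nlinarith) (by linarith) (by linarith) hmain
  rw [hu, show 2 - β - 1 = 1 - β by ring] at hfin
  rw [← hl]
  exact hfin
end E1148

namespace E1148
open Finset

noncomputable def TA (N : ℕ) [NeZero N] : ArithmeticFunction ℂ :=
  toArithmeticFunction (fun k : ℕ => chi N (k : ZMod (4 * N)))

theorem TA_apply (N : ℕ) [NeZero N] (k : ℕ) (hk : k ≠ 0) : TA N k = ((jv N k : ℤ) : ℂ) := by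
  unfold TA toArithmeticFunction
  simp only [ArithmeticFunction.coe_mk, hk, if_false]
  exact chi_apply N k

theorem jv_pow (N p k : ℕ) : jv N (p ^ k) = jv N p ^ k := by
  induction k with
  | zero => simp [jv_one]
  | succ k ih => rw [pow_succ, jv_mul, ih, pow_succ]

theorem TA_pow (N : ℕ) [NeZero N] (p : ℕ) (hp : p.Prime) (k : ℕ) : TA N (p ^ k) = ((jv N p : ℤ) : ℂ) ^ k := by
  rw [TA_apply N _ (pow_ne_zero _ hp.ne_zero), jv_pow]; push_cast; rfl

theorem conv_pp (A B : ArithmeticFunction ℂ) (p : ℕ) (hp : p.Prime) (k : ℕ) :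
    (A * B) (p ^ k) = ∑ i ∈ range (k + 1), A (p ^ i) * B (p ^ (k - i)) := by
  rw [ArithmeticFunction.mul_apply, Nat.sum_divisorsAntidiagonal (fun a b => A a * B b),
    Nat.sum_divisors_prime_pow hp]
  apply Finset.sum_congr rfl
  intro i hi
  rw [Nat.pow_div (by simp at hi; omega) hp.pos]

noncomputable def F4 (N M : ℕ) [NeZero N] [NeZero M] : ArithmeticFunction ℂ :=
  (DirichletCharacter.zetaMul (chi N)) * (TA M * TA (N * M))

theorem zm_pp (N : ℕ) [NeZero N] (p : ℕ) (hp : p.Prime) (k : ℕ) :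
    DirichletCharacter.zetaMul (chi N) (p ^ k) = ∑ i ∈ range (k + 1), ((jv N p : ℤ) : ℂ) ^ i := by
  have : DirichletCharacter.zetaMul (chi N) = TA N * ((ArithmeticFunction.zeta : ArithmeticFunction ℕ) : ArithmeticFunction ℂ) := by
    rw [mul_comm (TA N)]; rfl
  rw [this, conv_pp _ _ p hp]
  apply Finset.sum_congr rfl
  intro i hi
  rw [TA_pow N p hp, ArithmeticFunction.natCoe_apply, ArithmeticFunction.zeta_apply_ne (pow_ne_zero _ hp.ne_zero)]
  simp

theorem F4_pp (N M : ℕ) [NeZero N] [NeZero M] (p : ℕ) (hp : p.Prime) (k : ℕ) :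
    F4 N M (p ^ k) = ∑ i ∈ range (k + 1), DirichletCharacter.zetaMul (chi N) (p ^ i) *
      (((jv M p : ℤ) : ℂ) ^ (k - i) * DirichletCharacter.zetaMul (chi N) (p ^ (k - i))) := by
  unfold F4
  rw [conv_pp _ _ p hp]
  apply Finset.sum_congr rfl
  intro i _
  congr 1
  rw [mul_comm (TA M), conv_pp _ _ p hp, zm_pp N p hp, Finset.mul_sum]
  apply Finset.sum_congr rfl
  intro l hl
  have : (k - i) = l + (k - i - l) := by simp at hl; omega
  rw [TA_pow _ p hp, TA_pow _ p hp, jv_prod]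
  push_cast
  rw [mul_pow]
  conv_rhs => rw [this, pow_add]
  ring

theorem F4_comm (N M : ℕ) [NeZero N] [NeZero M] : F4 N M = F4 M N := by
  have h : TA (N * M) = TA (M * N) := by
    ext k
    by_cases hk : k = 0
    · rw [hk]; simp
    · rw [TA_apply _ _ hk, TA_apply _ _ hk, mul_comm N M]
  have h2 : ∀ N : ℕ, ∀ [NeZero N], DirichletCharacter.zetaMul (chi N) =
      ((ArithmeticFunction.zeta : ArithmeticFunction ℕ) : ArithmeticFunction ℂ) * TA N := by
    intro N _; rfl
  unfold F4
  rw [h, h2, h2]; ring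

open scoped ComplexOrder in
theorem F4_pp_nonneg (N M : ℕ) [NeZero N] [NeZero M] (p : ℕ) (hp : p.Prime) (k : ℕ) :
    0 ≤ F4 N M (p ^ k) := by
  have key : ∀ N M : ℕ, ∀ [NeZero N] [NeZero M], jv M p = 0 ∨ jv M p = 1 → 0 ≤ F4 N M (p ^ k) := by
    intro N M _ _ h
    rw [F4_pp _ _ p hp]
    refine Finset.sum_nonneg (fun i _ => ?_)
    have h1 := DirichletCharacter.zetaMul_nonneg (chi_sq N)
    refine mul_nonneg (h1 _) (mul_nonneg (pow_nonneg ?_ _) (h1 _))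
    rcases h with h | h <;> rw [h] <;> simp
  rcases jv_tri M p with h | h | h
  · exact key N M (Or.inl h)
  · exact key N M (Or.inr h)
  rcases jv_tri N p with h' | h' | h'
  · rw [F4_comm]; exact key M N (Or.inl h')
  · rw [F4_comm]; exact key M N (Or.inr h')
  rw [F4_pp _ _ p hp]
  refine Finset.sum_nonneg (fun i _ => ?_)
  have h1 := DirichletCharacter.zetaMul_nonneg (chi_sq N)
  refine mul_nonneg (h1 _) ?_
  rw [zm_pp N p hp, h, h']
  push_cast
  rw [neg_one_geom_sum]
  by_cases he : Even (k - i)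
  · rw [he.neg_one_pow, one_mul]
    split_ifs
    · exact le_rfl
    · exact zero_le_one
  · rw [if_pos (by rw [Nat.even_add_one]; exact he)]; simp

theorem TA_mult (N : ℕ) [NeZero N] : (TA N).IsMultiplicative :=
  DirichletCharacter.isMultiplicative_toArithmeticFunction (chi N)

theorem F4_mult (N M : ℕ) [NeZero N] [NeZero M] : (F4 N M).IsMultiplicative :=
  (DirichletCharacter.isMultiplicative_zetaMul (chi N)).mul ((TA_mult M).mul (TA_mult _))

open scoped ComplexOrder in
theorem F4_nonneg (N M : ℕ) [NeZero N] [NeZero M] (k : ℕ) : 0 ≤ F4 N M k := by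
  rcases eq_or_ne k 0 with rfl | hk
  · simp
  · rw [(F4_mult N M).multiplicative_factorization _ hk]
    exact Finset.prod_nonneg fun p hp => F4_pp_nonneg N M p (Nat.prime_of_mem_primeFactors hp) _

theorem TA_summable (N : ℕ) [NeZero N] {s : ℂ} (hs : 1 < s.re) : LSeriesSummable (fun k => TA N k) s := by
  refine LSeriesSummable_of_bounded_of_one_lt_re (m := 1) (fun n hn => ?_) hs
  rw [TA_apply N n hn]
  rcases jv_tri N n with h | h | h <;> rw [h] <;> simp

theorem TA_L (N : ℕ) [NeZero N] {s : ℂ} (hs : 1 < s.re) :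
    LSeries (fun k => TA N k) s = DirichletCharacter.LFunction (chi N) s := by
  rw [DirichletCharacter.LFunction_eq_LSeries _ hs]
  apply LSeries_congr
  intro n hn
  rw [TA_apply N n hn, chi_apply]

theorem zm_L (N : ℕ) [NeZero N] {s : ℂ} (hs : 1 < s.re) :
    LSeries (fun k => DirichletCharacter.zetaMul (chi N) k) s =
      riemannZeta s * DirichletCharacter.LFunction (chi N) s := by
  rw [← TA_L N hs, ← ArithmeticFunction.LSeries_zeta_eq_riemannZeta hs]
  exact ArithmeticFunction.LSeries_mul' (ArithmeticFunction.LSeriesSummable_zeta_iff.mpr hs) (TA_summable N hs)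

theorem F4_summable (N M : ℕ) [NeZero N] [NeZero M] {s : ℂ} (hs : 1 < s.re) :
    LSeriesSummable (fun k => F4 N M k) s :=
  ArithmeticFunction.LSeriesSummable_mul (DirichletCharacter.LSeriesSummable_zetaMul (chi N) hs)
    (ArithmeticFunction.LSeriesSummable_mul (TA_summable M hs) (TA_summable _ hs))

theorem F4_L (N M : ℕ) [NeZero N] [NeZero M] {s : ℂ} (hs : 1 < s.re) :
    LSeries (fun k => F4 N M k) s = riemannZeta s * (DirichletCharacter.LFunction (chi N) s *
      DirichletCharacter.LFunction (chi M) s * DirichletCharacter.LFunction (chi (N * M)) s) := by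
  have h1 := ArithmeticFunction.LSeries_mul' (DirichletCharacter.LSeriesSummable_zetaMul (chi N) hs)
    (ArithmeticFunction.LSeriesSummable_mul (TA_summable M hs) (TA_summable (N * M) hs))
  have h2 := ArithmeticFunction.LSeries_mul' (TA_summable M hs) (TA_summable (N * M) hs)
  unfold F4
  rw [h1, h2, zm_L N hs, TA_L M hs, TA_L (N * M) hs]
  ring
end E1148

namespace E1148
open Finset

noncomputable abbrev LL (N : ℕ) [NeZero N] : ℂ → ℂ := DirichletCharacter.LFunction (chi N)

theorem chi_im (N : ℕ) [NeZero N] (k : ℕ) : (chi N (k : ZMod (4 * N))).im = 0 := by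
  rw [chi_apply]; exact Complex.intCast_im _

theorem LL_im (N : ℕ) [NeZero N] (hsq : ¬ IsSquare N) (b : ℝ) (hb : 0 < b) : (LL N b).im = 0 :=
  L_real (chi N) (chi_ne_one N hsq) (chi_im N) b hb

open scoped ComplexOrder in
theorem LL_two (N : ℕ) [NeZero N] (hsq : ¬ IsSquare N) : 0 < (LL N (2:ℝ)).re := by
  have h1 : 0 < LSeries (fun k => DirichletCharacter.zetaMul (chi N) k) (2:ℝ) := by
    apply LSeries.positive
    · intro k; exact DirichletCharacter.zetaMul_nonneg (chi_sq N) k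
    · have := (DirichletCharacter.isMultiplicative_zetaMul (chi N)).map_one
      rw [this]; exact zero_lt_one
    · have : LSeries.abscissaOfAbsConv (fun k => DirichletCharacter.zetaMul (chi N) k) ≤ (1:ℝ) := by
        apply LSeries.abscissaOfAbsConv_le_of_forall_lt_LSeriesSummable
        intro y hy
        exact DirichletCharacter.LSeriesSummable_zetaMul (chi N) (by simpa using hy)
      exact lt_of_le_of_lt this (by exact_mod_cast one_lt_two)
  rw [zm_L N (by simp)] at h1
  have h2 := (Complex.lt_def.mp h1).1
  rw [Complex.mul_re, LL_im N hsq 2 (by norm_num)] at h2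
  have e : riemannZeta ((2:ℝ):ℂ) = ((Real.pi ^ 2 / 6 : ℝ) : ℂ) := by
    push_cast; exact riemannZeta_two
  rw [e, Complex.ofReal_re] at h2
  simp only [Complex.zero_re, mul_zero, sub_zero] at h2
  exact (mul_pos_iff_of_pos_left (by positivity)).mp h2

theorem LL_pos (N : ℕ) [NeZero N] (hsq : ¬ IsSquare N) (b : ℝ) (hb : 0 < b) (hb2 : b ≤ 2)
    (hz : ∀ x : ℝ, b ≤ x → x < 1 → LL N x ≠ 0) : 0 < (LL N b).re := by
  by_contra hneg
  push Not at hneg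
  have hc : Continuous (fun x : ℝ => (LL N x).re) :=
    Complex.continuous_re.comp ((DirichletCharacter.differentiable_LFunction (chi_ne_one N hsq)).continuous.comp
      Complex.continuous_ofReal)
  obtain ⟨x, hx, hx0⟩ := intermediate_value_Icc hb2 hc.continuousOn
    (show (0:ℝ) ∈ Set.Icc ((LL N b).re) ((LL N (2:ℝ)).re) from ⟨hneg, (LL_two N hsq).le⟩)
  have hx1 : LL N x = 0 := by
    apply Complex.ext
    · exact hx0
    · exact LL_im N hsq x (by linarith [hx.1])
  rcases lt_or_ge x 1 with h | h
  · exact hz x hx.1 h hx1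
  · exact DirichletCharacter.LFunction_ne_zero_of_one_le_re (chi N) (Or.inl (chi_ne_one N hsq)) (by simpa using h) hx1

theorem LL_one_pos (N : ℕ) [NeZero N] (hsq : ¬ IsSquare N) : 0 < (LL N 1).re := by
  have := LL_pos N hsq 1 one_pos one_le_two (fun x h1 h2 => by linarith)
  simpa using this

theorem zeta_neg (δ : ℝ) (hδ : 0 < δ) : ∃ β : ℝ, 7 / 8 ≤ β ∧ β < 1 ∧ 1 - δ ≤ β ∧
    ∀ x : ℝ, β ≤ x → x < 1 → (riemannZeta x).re < 0 := by
  have hc : Continuous (fun x : ℝ => (Zf x).re) :=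
    Complex.continuous_re.comp (Zf_diff.continuous.comp Complex.continuous_ofReal)
  have h1 : 0 < (Zf ((1:ℝ):ℂ)).re := by simp [Zf_one]
  have h2 := (hc.tendsto 1).eventually (lt_mem_nhds h1)
  obtain ⟨r, hr, h3⟩ := Metric.eventually_nhds_iff.mp h2
  refine ⟨max (7/8) (max (1 - δ) (1 - r / 2)), le_max_left _ _, ?_, ?_, ?_⟩
  · refine max_lt (by norm_num) (max_lt (by linarith) (by linarith))
  · exact (le_max_left _ _).trans (le_max_right _ _)
  · intro x hx hx1
    have h4 : 1 - r / 2 ≤ x := ((le_max_right _ _).trans (le_max_right _ _)).trans hx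
    have h5 := h3 (y := x) (by rw [Real.dist_eq, abs_lt]; constructor <;> linarith)
    have h6 : (x:ℂ) ≠ 1 := by exact_mod_cast hx1.ne
    rw [Zf_ne _ h6] at h5
    have : (x:ℂ) - 1 = ((x - 1 : ℝ) : ℂ) := by push_cast; rfl
    rw [this, Complex.re_ofReal_mul] at h5
    by_contra h7
    push Not at h7
    nlinarith

/-- zeros transfer between characters in the same square class -/
theorem zero_transfer (N M : ℕ) [NeZero N] [NeZero M] (hN : ¬ IsSquare N) (hM : ¬ IsSquare M)
    (hNM : IsSquare (N * M)) (β : ℝ) (hβ : 0 < β) (h0 : LL M β = 0) : LL N β = 0 := by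
  have dN : 4 * N ∣ 4 * (N * M) := ⟨M, by ring⟩
  have dM : 4 * M ∣ 4 * (N * M) := ⟨N, by ring⟩
  have hlev : DirichletCharacter.changeLevel dN (chi N) = DirichletCharacter.changeLevel dM (chi M) := by
    ext a
    rw [DirichletCharacter.changeLevel_eq_cast_of_dvd _ dN, DirichletCharacter.changeLevel_eq_cast_of_dvd _ dM]
    obtain ⟨m, hm⟩ : ∃ m : ℕ, m = (a : ZMod (4 * (N * M))).val := ⟨_, rfl⟩
    have ea : (a : ZMod (4 * (N * M))) = (m : ZMod (4 * (N * M))) := by rw [hm]; simp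
    have hcop : Nat.Coprime m (4 * (N * M)) := by rw [hm]; exact ZMod.val_coe_unit_coprime a
    rw [ea, ZMod.cast_natCast dN, ZMod.cast_natCast dM, chi_apply, chi_apply]
    obtain ⟨t, ht⟩ := hNM
    have h1 : jv N m * jv M m = jv t m * jv t m := by rw [← jv_prod, ht, jv_prod]
    have hu : ∀ K : ℕ, ∀ [NeZero K], K ∣ N * M → jv K m ≠ 0 := by
      intro K _ hK h
      have h2 := chi_apply K m
      rw [h] at h2
      have h3 : IsUnit (m : ZMod (4 * K)) := by
        rw [ZMod.isUnit_iff_coprime]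
        exact hcop.coprime_dvd_right (Nat.mul_dvd_mul_left 4 hK)
      have := (h3.map (chi K)).ne_zero
      rw [h2] at this; simp at this
    have hn := hu N (Dvd.intro _ rfl)
    have hm' := hu M (Dvd.intro_left _ rfl)
    congr 1
    rcases jv_tri N m with e | e | e <;> rcases jv_tri M m with e' | e' | e' <;> rw [e, e'] at h1 ⊢ <;>
      first | (exact absurd e hn) | (exact absurd e' hm') | nlinarith [mul_self_nonneg (jv t m)]
  have h1 := DirichletCharacter.LFunction_changeLevel dM (chi M) (s := β) (Or.inl (chi_ne_one M hM))
  have h2 := DirichletCharacter.LFunction_changeLevel dN (chi N) (s := β) (Or.inl (chi_ne_one N hN))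
  have h0' : DirichletCharacter.LFunction (chi M) (β:ℂ) = 0 := h0
  rw [h0', zero_mul, ← hlev, h2] at h1
  rcases mul_eq_zero.mp h1 with h | h
  · exact h
  · exfalso
    obtain ⟨p, hp, hp0⟩ := Finset.prod_eq_zero_iff.mp h
    have hpp := Nat.prime_of_mem_primeFactors hp
    have h3 : (chi N) (p : ZMod (4 * N)) * (p:ℂ) ^ (-(β:ℂ)) = 1 := by linear_combination -hp0
    have h4 : ‖(chi N) (p : ZMod (4 * N)) * (p:ℂ) ^ (-(β:ℂ))‖ < 1 := by
      rw [norm_mul, Complex.norm_natCast_cpow_of_pos hpp.pos]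
      have h5 : (p:ℝ) ^ ((-(β:ℂ)).re) < 1 := by
        apply Real.rpow_lt_one_of_one_lt_of_neg
        · exact_mod_cast hpp.one_lt
        · simpa using hβ
      have h6 : ‖(chi N) (p : ZMod (4 * N))‖ ≤ 1 := (chi N).norm_le_one _
      have h7 : 0 ≤ (p:ℝ) ^ ((-(β:ℂ)).re) := by positivity
      nlinarith [norm_nonneg ((chi N) (p : ZMod (4 * N)))]
    rw [h3] at h4; simp at h4
end E1148

namespace E1148
open Finset

noncomputable def C1 : ℝ := max (4 * cL) 1

theorem C1_ge : 1 ≤ C1 := le_max_right _ _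

theorem LL_bound (N : ℕ) [NeZero N] (hsq : ¬ IsSquare N) (s : ℂ) (hs : ‖s - 2‖ ≤ 3 / 2) :
    ‖LL N s‖ ≤ C1 * N := by
  have h := L_bound (chi N) (chi_ne_one N hsq) s hs
  push_cast at h
  have h2 : 4 * cL ≤ C1 := le_max_left _ _
  have h3 : (0:ℝ) ≤ N := Nat.cast_nonneg _
  calc _ ≤ _ := h
    _ = 4 * cL * N := by ring
    _ ≤ C1 * N := by gcongr

open scoped ComplexOrder in
theorem sieg2 : ∃ K : ℝ, 1 ≤ K ∧ ∀ (N : ℕ) [NeZero N], ¬ IsSquare N → ∀ β : ℝ, 7 / 8 ≤ β → β < 1 →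
    (riemannZeta β * LL N β).re ≤ 0 → (1 - β) / 4 * (K * N) ^ (-(4 * (1 - β))) ≤ (LL N 1).re := by
  obtain ⟨K, hK, h⟩ := estermann
  have hC := C1_ge
  refine ⟨8 * (K * C1), by nlinarith, ?_⟩
  intro N _ hsq β hb hb1 hre
  have hN : (1:ℝ) ≤ N := by exact_mod_cast NeZero.one_le
  have := h (fun k => DirichletCharacter.zetaMul (chi N) k) (LL N) (C1 * N) β
    (fun k => DirichletCharacter.zetaMul_nonneg (chi_sq N) k)
    (by have := (DirichletCharacter.isMultiplicative_zetaMul (chi N)).map_one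
        simp only [this]; exact le_rfl)
    (fun s hs => DirichletCharacter.LSeriesSummable_zetaMul (chi N) hs)
    (DirichletCharacter.differentiable_LFunction (chi_ne_one N hsq))
    (fun s hs => zm_L N hs) (fun s hs => LL_bound N hsq s hs)
    (by simpa using LL_im N hsq 1 one_pos) (by nlinarith) hb hb1 hre
  have e : 8 * (K * C1) * (N:ℝ) = 8 * (K * (C1 * N)) := by ring
  rw [e]; exact this

open scoped ComplexOrder in
theorem sieg4 : ∃ K : ℝ, 1 ≤ K ∧ ∀ (M N : ℕ) [NeZero M] [NeZero N], ¬ IsSquare M → ¬ IsSquare N →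
    ¬ IsSquare (M * N) → ∀ β : ℝ, 7 / 8 ≤ β → β < 1 →
    LL M β = 0 → (1 - β) / 4 * (K * M ^ 2 * N ^ 2) ^ (-(4 * (1 - β))) ≤
      (LL M 1).re * (LL N 1).re * (LL (M * N) 1).re := by
  obtain ⟨K, hK, h⟩ := estermann
  have hC := C1_ge
  have hC3 : 1 ≤ C1 ^ 3 := one_le_pow₀ hC
  refine ⟨8 * (K * C1 ^ 3), by nlinarith, ?_⟩
  intro M N _ _ hM hN hMN β hb hb1 hz
  have hN1 : (1:ℝ) ≤ N := by exact_mod_cast NeZero.one_le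
  have hM1 : (1:ℝ) ≤ M := by exact_mod_cast NeZero.one_le
  have i1 : (LL M 1).im = 0 := by simpa using LL_im M hM 1 one_pos
  have i2 : (LL N 1).im = 0 := by simpa using LL_im N hN 1 one_pos
  have i3 : (LL (M * N) 1).im = 0 := by simpa using LL_im (M * N) hMN 1 one_pos
  have := h (fun k => F4 M N k) (fun s => LL M s * LL N s * LL (M * N) s) (C1 ^ 3 * M ^ 2 * N ^ 2) β
    (fun k => F4_nonneg M N k)
    (by have := (F4_mult M N).map_one
        simp only [this]; exact le_rfl)
    (fun s hs => F4_summable M N hs)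
    (((DirichletCharacter.differentiable_LFunction (chi_ne_one M hM)).mul
      (DirichletCharacter.differentiable_LFunction (chi_ne_one N hN))).mul
      (DirichletCharacter.differentiable_LFunction (chi_ne_one _ hMN)))
    (fun s hs => F4_L M N hs)
    (fun s hs => by
      have a1 := LL_bound M hM s hs
      have a2 := LL_bound N hN s hs
      have a3 := LL_bound (M * N) hMN s hs
      push_cast at a3
      rw [norm_mul, norm_mul]
      calc _ ≤ C1 * M * (C1 * N) * (C1 * (M * N)) := by gcongr
        _ = _ := by ring)
    (by simp only [Complex.mul_im, Complex.mul_re, i1, i2, i3]; ring)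
    (by
      have : 1 ≤ (M:ℝ) ^ 2 := one_le_pow₀ hM1
      have h2 : 1 ≤ (N:ℝ) ^ 2 := one_le_pow₀ hN1
      calc (1:ℝ) = 1 * 1 * 1 := by norm_num
        _ ≤ _ := by gcongr) hb hb1 (by simp only [hz]; simp)
  have e : 8 * (K * C1 ^ 3) * (M:ℝ) ^ 2 * N ^ 2 = 8 * (K * (C1 ^ 3 * M ^ 2 * N ^ 2)) := by ring
  rw [e]
  refine this.trans (le_of_eq ?_)
  simp only [Complex.mul_im, Complex.mul_re, i1, i2, i3]; ring

theorem pow_low (A N e x : ℝ) (hA : 1 ≤ A) (hN : 1 ≤ N) (hx : x ≤ e) :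
    A ^ (-e) * N ^ (-e) ≤ (A * N) ^ (-x) := by
  rw [← Real.mul_rpow (by linarith) (by linarith)]
  exact Real.rpow_le_rpow_of_exponent_le (by nlinarith) (by linarith)

theorem siegel (ε : ℝ) (hε : 0 < ε) : ∃ c : ℝ, 0 < c ∧ ∀ (n : ℕ) [NeZero n], ¬ IsSquare n →
    c * (n:ℝ) ^ (-ε) ≤ (LL n 1).re := by
  obtain ⟨β0, hb, hb1, hbe, hz⟩ := zeta_neg (ε / 16) (by positivity)
  obtain ⟨K2, hK2, h2⟩ := sieg2
  obtain ⟨K4, hK4, h4⟩ := sieg4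
  have key2 : ∀ β : ℝ, β0 ≤ β → β < 1 → ∀ (n : ℕ) [NeZero n], ¬ IsSquare n →
      (riemannZeta β * LL n β).re ≤ 0 → ((1 - β) / 4 * K2 ^ (-ε)) * (n:ℝ) ^ (-ε) ≤ (LL n 1).re := by
    intro β hβ hβ1 n _ hn hre
    have hN : (1:ℝ) ≤ n := by exact_mod_cast NeZero.one_le
    refine le_trans ?_ (h2 n hn β (by linarith) hβ1 hre)
    rw [mul_assoc]
    refine mul_le_mul_of_nonneg_left ?_ (by linarith)
    exact pow_low K2 n ε _ hK2 hN (by linarith)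
  by_cases hA : ∃ (m : ℕ) (hm : NeZero m) (β : ℝ), ¬ IsSquare m ∧ β0 ≤ β ∧ β < 1 ∧ LL m β = 0
  swap
  · refine ⟨(1 - β0) / 4 * K2 ^ (-ε), by have : 0 < 1 - β0 := by linarith
                                         positivity, ?_⟩
    intro n _ hn
    apply key2 β0 le_rfl hb1 n hn
    have hp := LL_pos n hn β0 (by linarith) (by linarith)
      (fun x hx hx1 h0 => hA ⟨n, inferInstance, x, hn, hx, hx1, h0⟩)
    rw [Complex.mul_re, LL_im n hn β0 (by linarith)]
    nlinarith [hz β0 le_rfl hb1]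
  obtain ⟨m, hm, β, hmsq, hβ, hβ1, hz0⟩ := hA
  have hM : (1:ℝ) ≤ m := by exact_mod_cast NeZero.one_le
  have h1β : 0 < 1 - β := by linarith
  set L : ℝ := 3 + Real.log (4 * m) with hL
  have hL0 : 0 < L := by have := Real.log_nonneg (show (1:ℝ) ≤ 4 * m by linarith); linarith
  set B : ℝ := L + 1 / (ε / 2) with hB
  have hB0 : 0 < B := by positivity
  set A : ℝ := K4 * m ^ 2 with hAdef
  have hA1 : 1 ≤ A := by have : 1 ≤ (m:ℝ) ^ 2 := one_le_pow₀ hM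
                         rw [hAdef]; nlinarith
  set c4 : ℝ := (1 - β) / 4 * A ^ (-(ε / 4)) / (L * B) with hc4
  have hA0 : 0 < A := by linarith
  have hK20 : 0 < K2 := by linarith
  have hc40 : 0 < c4 := by positivity
  have hc20 : 0 < (1 - β) / 4 * K2 ^ (-ε) := by positivity
  refine ⟨min ((1 - β) / 4 * K2 ^ (-ε)) c4, lt_min hc20 hc40, ?_⟩
  intro n _ hn
  have hN : (1:ℝ) ≤ n := by exact_mod_cast NeZero.one_le
  have hNe : 0 < (n:ℝ) ^ (-ε) := by positivity
  by_cases hs : IsSquare (m * n)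
  · have hz1 : LL n β = 0 := zero_transfer n m hn hmsq (by rwa [mul_comm]) β (by linarith) hz0
    refine le_trans ?_ (key2 β hβ hβ1 n hn (by rw [hz1]; simp))
    gcongr; exact min_le_left _ _
  · have h := h4 m n hmsq hn hs β (by linarith) hβ1 hz0
    have p1 := LL_one_pos m hmsq
    have p2 := LL_one_pos n hn
    have p3 := LL_one_pos (m * n) hs
    have u1 : (LL m 1).re ≤ L := by
      have := L_one_le (chi m) (chi_ne_one m hmsq)
      push_cast at this
      exact (Complex.re_le_norm _).trans this
    have u3 : (LL (m * n) 1).re ≤ B * (n:ℝ) ^ (ε / 2) := by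
      have := L_one_le (chi (m * n)) (chi_ne_one _ hs)
      push_cast at this
      refine (Complex.re_le_norm _).trans (this.trans ?_)
      have e1 : Real.log (4 * (m * n)) = Real.log (4 * m) + Real.log n := by
        rw [← Real.log_mul (by positivity) (by positivity)]; ring_nf
      have e2 := Real.log_le_rpow_div (show (0:ℝ) ≤ n by linarith) (show 0 < ε / 2 by positivity)
      have e3 : 1 ≤ (n:ℝ) ^ (ε / 2) := Real.one_le_rpow hN (by positivity)
      rw [e1, hB, add_mul]
      have e4 : L ≤ L * (n:ℝ) ^ (ε / 2) := by nlinarith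
      have e5 : 1 / (ε / 2) * (n:ℝ) ^ (ε / 2) = (n:ℝ) ^ (ε / 2) / (ε / 2) := by ring
      rw [e5]; linarith
    have lowb : A ^ (-(ε / 4)) * ((n:ℝ) ^ (2:ℕ)) ^ (-(ε / 4)) ≤ (K4 * m ^ 2 * n ^ 2) ^ (-(4 * (1 - β))) :=
      pow_low A (n ^ 2) (ε / 4) _ hA1 (one_le_pow₀ hN) (by linarith)
    have e6 : ((n:ℝ) ^ (2:ℕ)) ^ (-(ε / 4)) = (n:ℝ) ^ (-(ε / 2)) := by
      rw [← Real.rpow_natCast, ← Real.rpow_mul (by linarith)]; congr 1; push_cast; ring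
    rw [e6] at lowb
    have h5 : (1 - β) / 4 * (A ^ (-(ε / 4)) * (n:ℝ) ^ (-(ε / 2))) ≤ L * (LL n 1).re * (B * (n:ℝ) ^ (ε / 2)) := by
      refine le_trans ?_ (h.trans ?_)
      · exact mul_le_mul_of_nonneg_left lowb (by linarith)
      · gcongr
    have h6 : (n:ℝ) ^ (-ε) * (n:ℝ) ^ (ε / 2) = (n:ℝ) ^ (-(ε / 2)) := by
      rw [← Real.rpow_add (by linarith)]; congr 1; ring
    refine le_trans (mul_le_mul_of_nonneg_right (min_le_right _ _) hNe.le) ?_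
    have hq : 0 < (n:ℝ) ^ (ε / 2) := by positivity
    rw [← h6] at h5
    have h7 : (1 - β) / 4 * A ^ (-(ε / 4)) = c4 * (L * B) := by rw [hc4]; field_simp
    have h8 : (c4 * (n:ℝ) ^ (-ε)) * (L * B * (n:ℝ) ^ (ε / 2)) ≤ (LL n 1).re * (L * B * (n:ℝ) ^ (ε / 2)) := by
      calc _ = (1 - β) / 4 * A ^ (-(ε / 4)) * ((n:ℝ) ^ (-ε) * (n:ℝ) ^ (ε / 2)) := by rw [h7]; ring
        _ = (1 - β) / 4 * (A ^ (-(ε / 4)) * ((n:ℝ) ^ (-ε) * (n:ℝ) ^ (ε / 2))) := by ring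
        _ ≤ _ := h5
        _ = _ := by ring
    exact le_of_mul_le_mul_right h8 (by positivity)
end E1148

namespace E1148
open Finset

noncomputable def Rn (n : ℕ) : ℕ := ∑ a ∈ Icc 1 (Nat.sqrt n), #(rootSet n a)

noncomputable def Rset (n : ℕ) : Finset (ℕ × ℕ) :=
  ((Icc 1 (Nat.sqrt n)) ×ˢ (Icc 1 (Nat.sqrt n))).filter
    (fun p => Nat.sqrt n < p.1 + p.2 ∧ (p.1:ℤ) ∣ (n:ℤ) - (p.2:ℤ) ^ 2)

theorem Rn_le (n : ℕ) : Rn n ≤ #(Rset n) := by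
  unfold Rn
  rw [← card_sigma]
  set S := Nat.sqrt n with hS
  refine card_le_card_of_injOn (fun p => (p.1, (S - (S + (p.1 - p.2)) % p.1))) ?_ ?_
  · rintro ⟨a, r⟩ h
    simp only [coe_sigma, Set.mem_sigma_iff, mem_coe, mem_Icc, rootSet, mem_filter, mem_range] at h
    obtain ⟨⟨h1, h2⟩, h3, h4⟩ := h
    have hm := Nat.mod_lt (S + (a - r)) (show 0 < a by omega)
    simp only [Rset, coe_filter, mem_product, mem_Icc, Set.mem_ofPred_eq, ← hS]
    refine ⟨⟨⟨h1, h2⟩, by omega, by omega⟩, by omega, ?_⟩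
    have h5 := Nat.div_add_mod (S + (a - r)) a
    set m := (S + (a - r)) % a
    set t := (S + (a - r)) / a
    have h6 : ((S - m : ℕ) : ℤ) = r + a * (t - 1) := by
      zify [show m ≤ S by omega]
      zify [show r ≤ a by omega] at h5
      linarith
    rw [h6]
    have : (n:ℤ) - (r + a * (t - 1)) ^ 2 = -(r ^ 2 - n) - a * ((t - 1) * (2 * r + a * (t - 1))) := by ring
    rw [this]
    exact dvd_sub (dvd_neg.mpr h4) (dvd_mul_right _ _)
  · rintro ⟨a, r⟩ h ⟨a', r'⟩ h' heq
    simp only [coe_sigma, Set.mem_sigma_iff, mem_coe, mem_Icc, rootSet, mem_filter, mem_range] at h h'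
    obtain ⟨⟨h1, h2⟩, h3, h4⟩ := h
    obtain ⟨⟨h1', h2'⟩, h3', h4'⟩ := h'
    simp only [Prod.mk.injEq] at heq
    obtain ⟨rfl, e⟩ := heq
    have hm := Nat.mod_lt (S + (a - r)) (show 0 < a by omega)
    have hm' := Nat.mod_lt (S + (a - r')) (show 0 < a by omega)
    have e2 : (S + (a - r)) % a = (S + (a - r')) % a := by omega
    have e3 : (S + (a - r)) ≡ (S + (a - r')) [MOD a] := e2
    have e4 : a - r ≡ a - r' [MOD a] := Nat.ModEq.add_left_cancel' S e3
    have e5 : r ≡ r' [MOD a] := by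
      have q1 : r + (a - r) ≡ r' + (a - r') [MOD a] := by
        rw [Nat.add_sub_cancel' h3.le, Nat.add_sub_cancel' h3'.le]
      exact Nat.ModEq.add_right_cancel e4 q1
    have := Nat.ModEq.eq_of_lt_of_lt e5 h3 h3'
    subst this; rfl

theorem R_facts (n : ℕ) (hsq : ¬ IsSquare n) (hbad : ¬ Rep n) (p : ℕ × ℕ) (hp : p ∈ Rset n) :
    ∃ b : ℤ, (n:ℤ) - (p.2:ℤ) ^ 2 = p.1 * b ∧ 0 < b ∧ 0 < (p.1:ℤ) ∧
      ((Odd p.1 ∧ IsP n p.1 p.2) ∨ (¬ Odd p.1 ∧ IsP n b p.2)) := by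
  obtain ⟨a, x⟩ := p
  simp only [Rset, mem_filter, mem_product, mem_Icc] at hp
  obtain ⟨⟨⟨h1, h2⟩, h3, h4⟩, h5, b, hb⟩ := hp
  have s1 := Nat.sqrt_le' n
  have s2 := Nat.lt_succ_sqrt' n
  set S := Nat.sqrt n with hS
  have s3 : S ^ 2 < n := lt_of_le_of_ne s1 (fun e => hsq ⟨S, by rw [← e]; ring⟩)
  have hx : (x:ℤ) ^ 2 < n := by
    have : x ^ 2 ≤ S ^ 2 := Nat.pow_le_pow_left h4 2
    exact_mod_cast lt_of_le_of_lt this s3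
  have ha : (0:ℤ) < a := by exact_mod_cast h1
  have hx0 : (0:ℤ) < x := by exact_mod_cast h3
  have hbpos : 0 < b := by
    by_contra hneg
    push Not at hneg
    nlinarith
  have g1 : (n:ℤ) < (a + x) ^ 2 := by
    have : (S + 1) ^ 2 ≤ (a + x) ^ 2 := Nat.pow_le_pow_left h5 2
    have := lt_of_lt_of_le s2 this
    exact_mod_cast this
  have g2 : ((a:ℤ) - x) ^ 2 < n := by
    have q : ((a:ℤ) - x) ^ 2 ≤ S ^ 2 := by
      apply sq_le_sq'
      · have : (x:ℤ) ≤ S := by exact_mod_cast h4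
        linarith
      · have : (a:ℤ) ≤ S := by exact_mod_cast h2
        linarith
    have : (S:ℤ) ^ 2 < n := by exact_mod_cast s3
    linarith
  set s : ℝ := √(n:ℝ) with hs
  have hss : s ^ 2 = n := Real.sq_sqrt (Nat.cast_nonneg n)
  have hs0 : 0 ≤ s := Real.sqrt_nonneg _
  have haR : (0:ℝ) < a := by exact_mod_cast ha
  have hxR : (0:ℝ) < x := by exact_mod_cast hx0
  have hbR : (0:ℝ) < b := by exact_mod_cast hbpos
  have t1 : (x:ℝ) < s := by
    have : (x:ℝ) ^ 2 < s ^ 2 := by rw [hss]; exact_mod_cast hx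
    exact lt_of_pow_lt_pow_left₀ 2 hs0 this
  have t2 : s < a + x := by
    have : s ^ 2 < (a + x : ℝ) ^ 2 := by rw [hss]; exact_mod_cast g1
    exact lt_of_pow_lt_pow_left₀ 2 (by positivity) this
  have t3 : (a:ℝ) - x < s := by
    have : (a - x : ℝ) ^ 2 < s ^ 2 := by rw [hss]; exact_mod_cast g2
    exact lt_of_pow_lt_pow_left₀ 2 hs0 this
  have t4 : (s - x) * (s + x) = a * b := by
    have : (n:ℝ) - x ^ 2 = a * b := by exact_mod_cast hb
    rw [← hss] at this; linarith
  have t5 : (b:ℝ) < s + x := by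
    by_contra hneg; push Not at hneg
    nlinarith
  have t6 : s - x < b := by
    by_contra hneg; push Not at hneg
    nlinarith
  have hpar : ¬ (2:ℤ) ∣ a - b := by
    intro hd
    apply hbad
    refine rep_of_AB n x a b (by linarith) ha hbpos hd ?_
    have : |(a:ℝ) - b| < 2 * x := by rw [abs_lt]; constructor <;> linarith
    rw [abs_of_pos hx0]
    exact_mod_cast this
  refine ⟨b, hb, hbpos, ha, ?_⟩
  rcases Nat.even_or_odd a with he | ho
  · right
    refine ⟨Nat.not_odd_iff_even.mpr he, ?_, hbpos, hx0, ?_, hx, ?_, ?_⟩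
    · rw [← Int.not_even_iff_odd]
      intro hbe
      exact hpar (dvd_sub (by exact_mod_cast he.two_dvd) hbe.two_dvd)
    · rw [hb, mul_comm (a:ℤ)]
      rw [mul_comm 2]
      exact mul_dvd_mul_left b (by exact_mod_cast he.two_dvd)
    · have : s ^ 2 < (b + x : ℝ) ^ 2 := by
        apply pow_lt_pow_left₀ _ hs0 two_ne_zero
        linarith
      rw [hss] at this; exact_mod_cast this
    · have : (b - x : ℝ) ^ 2 < s ^ 2 := by
        apply sq_lt_sq' <;> linarith
      rw [hss] at this; exact_mod_cast this
  · left
    refine ⟨ho, by exact_mod_cast ho, ha, hx0, ?_, hx, g1, g2⟩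
    have hbe : Even b := by
      rw [← Int.not_odd_iff_even]
      intro hbo
      have hoz : Odd (a:ℤ) := by exact_mod_cast ho
      exact hpar (hoz.sub_odd hbo).two_dvd
    rw [hb, mul_comm 2]
    exact mul_dvd_mul_left _ hbe.two_dvd

theorem Rn_le_P (n : ℕ) (hsq : ¬ IsSquare n) (hbad : ¬ Rep n) : Rn n ≤ 2 * #(Pset n) := by
  refine (Rn_le n).trans ?_
  choose! b hb hb0 ha0 hor using R_facts n hsq hbad
  rw [← card_filter_add_card_filter_not (s := Rset n) (fun p => Odd p.1), two_mul]
  apply add_le_add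
  · refine card_le_card_of_injOn (fun p => ((p.1:ℤ), (p.2:ℤ))) ?_ ?_
    · intro p hp
      simp only [coe_filter, Set.mem_ofPred_eq] at hp
      rw [mem_coe, mem_Pset]
      rcases hor p hp.1 with h | h
      · exact h.2
      · exact absurd hp.2 h.1
    · intro p _ q _ h
      simp only [Prod.mk.injEq, Nat.cast_inj] at h
      exact Prod.ext h.1 h.2
  · refine card_le_card_of_injOn (fun p => (b p, (p.2:ℤ))) ?_ ?_
    · intro p hp
      simp only [coe_filter, Set.mem_ofPred_eq] at hp
      rw [mem_coe, mem_Pset]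
      rcases hor p hp.1 with h | h
      · exact absurd h.1 hp.2
      · exact h.2
    · intro p hp q hq h
      simp only [coe_filter, Set.mem_ofPred_eq] at hp hq
      simp only [Prod.mk.injEq, Nat.cast_inj] at h
      have e1 := hb p hp.1
      have e2 := hb q hq.1
      rw [h.1, h.2] at e1
      rw [e2] at e1
      have e3 := mul_right_cancel₀ (hb0 q hq.1).ne' e1
      exact Prod.ext (by exact_mod_cast e3.symm) h.2
end E1148

namespace E1148
open Finset

theorem reduce (n d : ℕ) (hsq : ¬ IsSquare n) (hd : Nat.sqrt n < d) (x : ℤ) (hx : (d:ℤ) ∣ x ^ 2 - n) :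
    ∃ a ∈ Icc 1 (Nat.sqrt n), ∃ r ∈ rootSet n a, ∃ Y : ℕ, ∃ z : ℤ, 1 ≤ Y ∧ (Y:ℝ) ^ 2 * √(n:ℝ) ≤ d ∧
      (a:ℤ) ∣ z + Y * r ∧ (a:ℤ) * d = |z ^ 2 - n * (Y:ℤ) ^ 2| := by
  set s : ℝ := √(n:ℝ) with hs
  have hn0 : 0 < n := by
    rcases Nat.eq_zero_or_pos n with h | h
    · exact absurd (h ▸ IsSquare.zero) hsq
    · exact h
  have hss : s ^ 2 = n := Real.sq_sqrt (Nat.cast_nonneg n)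
  have hs0 : 0 < s := Real.sqrt_pos.mpr (by exact_mod_cast hn0)
  have hsd : s < d := by
    have : s ^ 2 < (d:ℝ) ^ 2 := by
      rw [hss]
      have := Nat.lt_succ_sqrt' n
      have h2 : (Nat.sqrt n + 1) ^ 2 ≤ d ^ 2 := Nat.pow_le_pow_left hd 2
      exact_mod_cast lt_of_lt_of_le this h2
    exact lt_of_pow_lt_pow_left₀ 2 (Nat.cast_nonneg d) this
  have hd0 : (0:ℝ) < d := by linarith
  set V : ℕ := ⌊√(d / s)⌋₊ with hV
  have hV1 : 1 ≤ V := by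
    apply Nat.le_floor
    rw [Nat.cast_one]
    apply Real.one_le_sqrt.mpr
    rw [le_div_iff₀ hs0]; linarith
  have hVl : (V:ℝ) ^ 2 * s ≤ d := by
    have h1 : (V:ℝ) ≤ √(d / s) := Nat.floor_le (Real.sqrt_nonneg _)
    have h2 : (V:ℝ) ^ 2 ≤ d / s := by
      have := pow_le_pow_left₀ (Nat.cast_nonneg V) h1 2
      rwa [Real.sq_sqrt (by positivity)] at this
    rwa [le_div_iff₀ hs0] at h2
  have hVu : (d:ℝ) < (V + 1) ^ 2 * s := by
    have h1 : √(d / s) < V + 1 := Nat.lt_floor_add_one _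
    have h2 : d / s < ((V:ℝ) + 1) ^ 2 := by
      have := pow_lt_pow_left₀ h1 (Real.sqrt_nonneg _) two_ne_zero
      rwa [Real.sq_sqrt (by positivity)] at this
    rwa [div_lt_iff₀ hs0] at h2
  obtain ⟨q, hq, hqV⟩ := Real.exists_rat_abs_sub_le_and_den_le ((x:ℝ) / d) (show 0 < V by omega)
  have hYpos : (0:ℝ) < q.den := by exact_mod_cast q.den_pos
  obtain ⟨c, hc⟩ := hx
  obtain ⟨u', w', huw⟩ : ∃ u w : ℤ, q.num * w - (q.den:ℤ) * u = 1 := by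
    have hcop : IsCoprime q.num (q.den:ℤ) := by
      rw [Int.isCoprime_iff_gcd_eq_one]; exact q.reduced
    obtain ⟨α, β, h⟩ := hcop
    exact ⟨-β, α, by linarith⟩
  set X : ℤ := q.num with hX
  set Y : ℕ := q.den with hY
  set z : ℤ := d * X - x * Y with hz
  set a0 : ℤ := d * X ^ 2 - 2 * x * X * Y + c * Y ^ 2 with ha0
  set B : ℤ := d * X * u' - x * (X * w' + Y * u') + c * Y * w' with hB
  have e1 : a0 * d = z ^ 2 - n * Y ^ 2 := by
    have : (n:ℤ) = x ^ 2 - d * c := by linarith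
    rw [this, ha0, hz]; ring
  have e2 : B ^ 2 - n = a0 * (d * u' ^ 2 - 2 * x * u' * w' + c * w' ^ 2) := by
    have : (n:ℤ) = (x ^ 2 - d * c) * (X * w' - Y * u') ^ 2 := by rw [huw]; linarith
    rw [this, ha0, hB]; ring
  have e3 : z + Y * B = w' * a0 := by
    have : z = z * (X * w' - Y * u') := by rw [huw, mul_one]
    rw [this, ha0, hB, hz]; ring
  have hzb : |(z:ℝ)| * (V + 1) ≤ d := by
    have h1 : (z:ℝ) = -((x:ℝ) / d - q) * (d * Y) := by
      have : (q:ℝ) = X / Y := by rw [hX, hY]; exact_mod_cast (Rat.num_div_den q).symm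
      rw [this, hz]; push_cast; field_simp; ring
    rw [h1, abs_mul, abs_neg, abs_of_pos (show (0:ℝ) < d * Y by positivity)]
    calc _ ≤ 1 / (((V:ℝ) + 1) * Y) * (d * Y) * (V + 1) := by gcongr
      _ = d := by field_simp
  have hz2 : (z:ℝ) ^ 2 ≤ d * s := by
    have h1 : (|(z:ℝ)| * (V + 1)) ^ 2 ≤ d ^ 2 := pow_le_pow_left₀ (by positivity) hzb 2
    rw [mul_pow, sq_abs] at h1
    have hp : (0:ℝ) < (V + 1) ^ 2 := by positivity
    have : (z:ℝ) ^ 2 * (V + 1) ^ 2 ≤ d * s * (V + 1) ^ 2 := by nlinarith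
    exact le_of_mul_le_mul_right this hp
  have hYV : (Y:ℝ) ^ 2 ≤ V ^ 2 := by
    have : (Y:ℝ) ≤ V := by exact_mod_cast hqV
    gcongr
  have hYs : (Y:ℝ) ^ 2 * s ≤ d := le_trans (by gcongr) hVl
  have hnY : (n:ℝ) * Y ^ 2 ≤ d * s := by rw [← hss]; nlinarith
  have ha0R : |(a0:ℝ)| * d ≤ s * d := by
    have : (a0:ℝ) * d = z ^ 2 - n * Y ^ 2 := by exact_mod_cast e1
    rw [← abs_of_pos hd0, ← abs_mul, abs_of_pos hd0, this, abs_le]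
    have p1 : 0 ≤ (z:ℝ) ^ 2 := by positivity
    have p2 : 0 ≤ (n:ℝ) * Y ^ 2 := by positivity
    constructor <;> linarith
  have ha0s : |(a0:ℝ)| ≤ s := le_of_mul_le_mul_right ha0R hd0
  have ha0ne : a0 ≠ 0 := by
    intro h
    rw [h, zero_mul] at e1
    have := (nonsq_zero n hsq z Y (by linarith)).2
    have hh : (0:ℤ) < Y := by exact_mod_cast q.den_pos
    omega
  refine ⟨a0.natAbs, ?_, (B % (a0.natAbs:ℤ)).toNat, ?_, Y, z, q.den_pos, hYs, ?_, ?_⟩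
  · rw [mem_Icc]
    refine ⟨Int.natAbs_pos.mpr ha0ne, ?_⟩
    rw [Nat.le_sqrt']
    have : |(a0:ℝ)| ^ 2 ≤ s ^ 2 := pow_le_pow_left₀ (abs_nonneg _) ha0s 2
    rw [hss, sq_abs] at this
    have h2 : a0 ^ 2 ≤ n := by exact_mod_cast this
    have h3 : ((a0.natAbs ^ 2 : ℕ) : ℤ) = a0 ^ 2 := by push_cast; rw [sq_abs]
    exact_mod_cast h3.trans_le h2
  all_goals
    have hA : (0:ℤ) < (a0.natAbs:ℤ) := by exact_mod_cast Int.natAbs_pos.mpr ha0ne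
    have hr0 := Int.emod_nonneg B hA.ne'
    have hr1 := Int.emod_lt_of_pos B hA
    have hBr : B = (a0.natAbs:ℤ) * (B / a0.natAbs) + (((B % (a0.natAbs:ℤ)).toNat : ℕ) : ℤ) := by
      rw [Int.toNat_of_nonneg hr0]; exact (Int.mul_ediv_add_emod B _).symm
    have hdv : (a0.natAbs:ℤ) ∣ a0 := Int.natAbs_dvd.mpr dvd_rfl
  · simp only [rootSet, mem_filter, mem_range]
    refine ⟨by omega, ?_⟩
    have h1 : (a0.natAbs:ℤ) ∣ B ^ 2 - n := by rw [e2]; exact Dvd.dvd.mul_right hdv _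
    have h2 : ((((B % (a0.natAbs:ℤ)).toNat : ℕ) : ℤ)) = B - (a0.natAbs:ℤ) * (B / a0.natAbs) := by linarith
    rw [h2]
    have h3 : (B - (a0.natAbs:ℤ) * (B / a0.natAbs)) ^ 2 - n = (B ^ 2 - n) +
      (a0.natAbs:ℤ) * ((B / a0.natAbs) * ((a0.natAbs:ℤ) * (B / a0.natAbs) - 2 * B)) := by ring
    rw [h3]
    exact dvd_add h1 (dvd_mul_right _ _)
  · have h1 : (a0.natAbs:ℤ) ∣ z + Y * B := by rw [e3]; exact Dvd.dvd.mul_left hdv _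
    have h2 : ((((B % (a0.natAbs:ℤ)).toNat : ℕ) : ℤ)) = B - (a0.natAbs:ℤ) * (B / a0.natAbs) := by linarith
    rw [h2]
    have h3 : z + Y * (B - (a0.natAbs:ℤ) * (B / a0.natAbs)) = (z + Y * B) -
      (a0.natAbs:ℤ) * (Y * (B / a0.natAbs)) := by ring
    rw [h3]
    exact dvd_sub h1 (dvd_mul_right _ _)
  · rw [← e1, abs_mul, Int.natCast_natAbs]; simp
end E1148

namespace E1148
open Finset

theorem cong_count (T : Finset ℤ) (a : ℕ) (ha : 0 < a) (c : ℤ) (α β : ℝ) (hab : α ≤ β)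
    (h : ∀ z ∈ T, α ≤ (z:ℝ) ∧ (z:ℝ) ≤ β) (hc : ∀ z ∈ T, (a:ℤ) ∣ z + c) :
    (#T : ℝ) ≤ (β - α) / a + 1 := by
  have haR : (0:ℝ) < a := by exact_mod_cast ha
  have hle : #T ≤ #(Icc ⌈(α + c) / a⌉ ⌊(β + c) / a⌋) := by
    refine card_le_card_of_injOn (fun z => (z + c) / a) ?_ ?_
    · intro z hz
      obtain ⟨k, hk⟩ := hc z hz
      obtain ⟨h1, h2⟩ := h z hz
      have e : (z + c) / (a:ℤ) = k := by rw [hk]; exact Int.mul_ediv_cancel_left _ (by omega)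
      simp only [e, coe_Icc, Set.mem_Icc, Int.ceil_le, Int.le_floor]
      have hk' : (z:ℝ) + c = a * k := by exact_mod_cast hk
      rw [div_le_iff₀ haR, le_div_iff₀ haR]
      constructor <;> linarith
    · intro z hz z' hz' he
      obtain ⟨k, hk⟩ := hc z hz
      obtain ⟨k', hk'⟩ := hc z' hz'
      simp only [hk, hk'] at he
      rw [Int.mul_ediv_cancel_left _ (by omega), Int.mul_ediv_cancel_left _ (by omega)] at he
      rw [he, ← hk'] at hk
      linarith
  rw [Int.card_Icc] at hle
  have h3 : (#T : ℝ) ≤ ((⌊(β + c) / a⌋ + 1 - ⌈(α + c) / a⌉).toNat : ℝ) := by exact_mod_cast hle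
  refine h3.trans ?_
  have e0 : (β - α) / a = (β + c) / a - (α + c) / a := by ring
  have h0 : 0 ≤ (β - α) / a := div_nonneg (by linarith) haR.le
  rcases le_total (⌊(β + c) / a⌋ + 1 - ⌈(α + c) / a⌉) 0 with h | h
  · rw [Int.toNat_of_nonpos h]; push_cast; linarith
  · have : (((⌊(β + c) / a⌋ + 1 - ⌈(α + c) / a⌉).toNat : ℕ) : ℝ) = ⌊(β + c) / a⌋ + 1 - ⌈(α + c) / a⌉ := by
      have := Int.toNat_of_nonneg h
      exact_mod_cast this
    rw [this, e0]
    have q1 := Int.floor_le ((β + c) / a)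
    have q2 := Int.le_ceil ((α + c) / a)
    linarith

noncomputable def Zset (n D a r Y : ℕ) : Finset ℤ :=
  (Icc (-(a * D + n * Y ^ 2 : ℤ)) (a * D + n * Y ^ 2)).filter
    (fun z => (a:ℤ) ∣ z + Y * r ∧ |z ^ 2 - n * (Y:ℤ) ^ 2| ≤ a * D)

theorem Zset_card (n D a r Y : ℕ) (hn : 0 < n) (ha : 0 < a) (hY : 0 < Y) :
    (#(Zset n D a r Y) : ℝ) ≤ 4 * (D / √(n:ℝ)) * (1 / Y) + 2 := by
  set s : ℝ := √(n:ℝ) with hs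
  have hss : s ^ 2 = n := Real.sq_sqrt (Nat.cast_nonneg n)
  have hs0 : 0 < s := Real.sqrt_pos.mpr (by exact_mod_cast hn)
  have haR : (0:ℝ) < a := by exact_mod_cast ha
  have hYR : (0:ℝ) < Y := by exact_mod_cast hY
  set δ : ℝ := a * D / (s * Y) with hδ
  have hδ0 : 0 ≤ δ := by positivity
  rw [← card_filter_add_card_filter_not (s := Zset n D a r Y) (fun z => 0 ≤ z)]
  have key : ∀ z ∈ Zset n D a r Y, |(|(z:ℝ)| - s * Y)| ≤ δ := by
    intro z hz
    have h := (mem_filter.mp hz).2.2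
    have h1 : |(z:ℝ) ^ 2 - n * (Y:ℝ) ^ 2| ≤ a * D := by exact_mod_cast h
    have e : (z:ℝ) ^ 2 - n * (Y:ℝ) ^ 2 = (|(z:ℝ)| - s * Y) * (|(z:ℝ)| + s * Y) := by
      rw [← hss, ← sq_abs (z:ℝ)]; ring
    have hp : 0 < |(z:ℝ)| + s * Y := by positivity
    rw [e, abs_mul, abs_of_pos hp] at h1
    rw [hδ, le_div_iff₀ (by positivity)]
    refine le_trans ?_ h1
    gcongr
    linarith [abs_nonneg (z:ℝ)]
  have hdv : ∀ z ∈ Zset n D a r Y, (a:ℤ) ∣ z + Y * r := fun z hz => (mem_filter.mp hz).2.1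
  have c1 := cong_count ((Zset n D a r Y).filter (fun z => 0 ≤ z)) a ha (Y * r) (s * Y - δ) (s * Y + δ)
    (by linarith) (by
      intro z hz
      obtain ⟨h1, h2⟩ := mem_filter.mp hz
      have h3 := key z h1
      rw [abs_of_nonneg (show (0:ℝ) ≤ z by exact_mod_cast h2), abs_le] at h3
      constructor <;> linarith [h3.1, h3.2]) (fun z hz => hdv z (mem_filter.mp hz).1)
  have c2 := cong_count ((Zset n D a r Y).filter (fun z => ¬ 0 ≤ z)) a ha (Y * r) (-(s * Y) - δ) (-(s * Y) + δ)
    (by linarith) (by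
      intro z hz
      obtain ⟨h1, h2⟩ := mem_filter.mp hz
      have h3 := key z h1
      push Not at h2
      rw [abs_of_neg (show (z:ℝ) < 0 by exact_mod_cast h2), abs_le] at h3
      constructor <;> linarith [h3.1, h3.2]) (fun z hz => hdv z (mem_filter.mp hz).1)
  have e2 : 4 * (D / s) * (1 / Y) = (2 * δ / a) * 2 := by rw [hδ]; field_simp; ring
  push_cast
  rw [e2]
  have e3 : (s * Y + δ - (s * Y - δ)) / a = 2 * δ / a := by ring
  have e4 : (-(s * Y) + δ - (-(s * Y) - δ)) / a = 2 * δ / a := by ring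
  rw [e3] at c1
  rw [e4] at c2
  linarith

open Classical in
noncomputable def Gset (n y : ℕ) : Finset ℕ := (Icc 1 y).filter (fun d => ∃ x : ℤ, (d:ℤ) ∣ x ^ 2 - n)

theorem G_le (n y : ℕ) (hsq : ¬ IsSquare n) (hy : 1 ≤ y) :
    (#(Gset n y) : ℝ) ≤ Nat.sqrt n + Rn n * ((y / √(n:ℝ)) * (6 + 4 * Real.log y)) := by
  classical
  set s : ℝ := √(n:ℝ) with hs
  have hn0 : 0 < n := by
    rcases Nat.eq_zero_or_pos n with h | h
    · exact absurd (h ▸ IsSquare.zero) hsq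
    · exact h
  have hs1 : 1 ≤ s := Real.one_le_sqrt.mpr (by exact_mod_cast hn0)
  have hlog : 0 ≤ Real.log y := Real.log_nonneg (by exact_mod_cast hy)
  set S := Nat.sqrt n with hS
  rcases le_or_gt y S with hyS | hyS
  · have h1 : #(Gset n y) ≤ S := by
      refine (card_filter_le _ _).trans ?_
      simpa using hyS
    have h2 : (#(Gset n y) : ℝ) ≤ S := by exact_mod_cast h1
    have : 0 ≤ Rn n * ((y / s) * (6 + 4 * Real.log y)) := by positivity
    linarith
  have hss : s ^ 2 = n := Real.sq_sqrt (Nat.cast_nonneg n)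
  set Ym : ℕ := ⌊(y:ℝ) / s⌋₊ with hYm
  have hsplit : #(Gset n y) ≤ S + #((Gset n y).filter (fun d => S < d)) := by
    rw [← card_filter_add_card_filter_not (s := Gset n y) (fun d => S < d), add_comm]
    gcongr
    calc _ ≤ #(Icc 1 S) := by
          apply card_le_card
          intro d hd
          simp only [Gset, mem_filter, mem_Icc] at hd ⊢
          omega
      _ = S := by simp
  set U : Finset (Σ _ : ℕ, Σ _ : ℕ, Σ _ : ℕ, ℤ) := (Icc 1 S).sigma (fun a => (rootSet n a).sigma
    (fun r => (Icc 1 Ym).sigma (fun Y => Zset n y a r Y))) with hU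
  have hinj : #((Gset n y).filter (fun d => S < d)) ≤ #U := by
    have hex : ∀ d ∈ (Gset n y).filter (fun d => S < d), ∃ p ∈ U,
        (p.1:ℤ) * d = |p.2.2.2 ^ 2 - n * (p.2.2.1:ℤ) ^ 2| ∧ 0 < p.1 := by
      intro d hd
      simp only [Gset, mem_filter, mem_Icc] at hd
      obtain ⟨⟨⟨hd1, hd2⟩, x, hx⟩, hd3⟩ := hd
      obtain ⟨a, ha, r, hr, Y, z, hY1, hYs, hdv, heq⟩ := reduce n d hsq hd3 x hx
      have had : (a:ℤ) * d ≤ a * y := by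
        have : (d:ℤ) ≤ y := by exact_mod_cast hd2
        gcongr
      refine ⟨⟨a, r, Y, z⟩, ?_, heq, by rw [mem_Icc] at ha; exact ha.1⟩
      simp only [hU, mem_sigma]
      refine ⟨ha, hr, ?_, ?_⟩
      · rw [mem_Icc]
        refine ⟨hY1, Nat.le_floor ?_⟩
        rw [le_div_iff₀ (by linarith)]
        have h1 : (1:ℝ) ≤ Y := by exact_mod_cast hY1
        have h2 : (d:ℝ) ≤ y := by exact_mod_cast hd2
        have h3 : (Y:ℝ) ≤ Y ^ 2 := by nlinarith
        have h4 : (Y:ℝ) * s ≤ Y ^ 2 * s := by gcongr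
        linarith
      · simp only [Zset, mem_filter, mem_Icc]
        have hb : |z ^ 2 - n * (Y:ℤ) ^ 2| ≤ a * y := by rw [← heq]; exact had
        refine ⟨?_, hdv, hb⟩
        rw [← abs_le]
        have h1 : |z| ≤ z ^ 2 := by
          rw [← sq_abs]
          rcases eq_or_ne z 0 with h | h
          · simp [h]
          · have : 1 ≤ |z| := Int.one_le_abs h
            nlinarith
        have := (abs_le.mp hb).2
        linarith
    choose! f hf hfe hf0 using hex
    refine card_le_card_of_injOn f (fun d hd => hf d hd) ?_
    intro d hd d' hd' he
    have h1 := hfe d hd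
    have h2 := hfe d' hd'
    rw [he, ← h2] at h1
    have h3 : ((f d').1 : ℤ) ≠ 0 := by have := hf0 d' hd'; omega
    exact_mod_cast mul_left_cancel₀ h3 h1
  have hUc : (#U : ℝ) ≤ Rn n * ((y / s) * (6 + 4 * Real.log y)) := by
    have hYl : (Ym:ℝ) ≤ y / s := Nat.floor_le (by positivity)
    have hYy : (Ym:ℝ) ≤ y := hYl.trans (div_le_self (by positivity) hs1)
    have hlogY : Real.log Ym ≤ Real.log y := by
      rcases Nat.eq_zero_or_pos Ym with h | h
      · rw [h]; simpa using hlog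
      · exact Real.log_le_log (by exact_mod_cast h) hYy
    have hin : ∀ a ∈ Icc 1 S, ∀ r ∈ rootSet n a, ∑ Y ∈ Icc 1 Ym, (#(Zset n y a r Y) : ℝ) ≤
        (y / s) * (6 + 4 * Real.log y) := by
      intro a ha r hr
      rw [mem_Icc] at ha
      calc _ ≤ ∑ Y ∈ Icc 1 Ym, (4 * (y / s) * (1 / Y) + 2) := by
            apply sum_le_sum
            intro Y hY
            exact Zset_card n y a r Y hn0 ha.1 (mem_Icc.mp hY).1
        _ = 4 * (y / s) * (∑ Y ∈ Icc 1 Ym, (1:ℝ) / Y) + Ym * 2 := by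
            rw [sum_add_distrib, ← mul_sum]; simp
        _ ≤ 4 * (y / s) * (1 + Real.log y) + (y / s) * 2 := by
            gcongr
            exact (harm_le Ym).trans (by linarith)
        _ = _ := by ring
    rw [hU, card_sigma]
    simp only [card_sigma]
    unfold Rn
    push_cast
    rw [sum_mul]
    apply sum_le_sum
    intro a ha
    rw [← nsmul_eq_mul]
    exact sum_le_card_nsmul _ _ _ (hin a ha)
  have f1 : (#(Gset n y) : ℝ) ≤ S + #((Gset n y).filter (fun d => S < d)) := by exact_mod_cast hsplit
  have f2 : (#((Gset n y).filter (fun d => S < d)) : ℝ) ≤ #U := by exact_mod_cast hinj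
  linarith
end E1148

namespace E1148
open Finset

theorem sum_div_swap (c : ℕ → ℂ) (D : ℕ) :
    ∑ d ∈ Icc 1 D, ∑ e ∈ d.divisors, c e = ∑ e ∈ Icc 1 D, c e * ((D / e : ℕ) : ℂ) := by
  have h1 : ∀ d ∈ Icc 1 D, ∑ e ∈ d.divisors, c e = ∑ e ∈ Icc 1 D, if e ∣ d then c e else 0 := by
    intro d hd
    rw [mem_Icc] at hd
    rw [← sum_filter]
    apply sum_congr _ (fun _ _ => rfl)
    ext e
    simp only [Nat.mem_divisors, mem_filter, mem_Icc]
    constructor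
    · rintro ⟨h, h0⟩
      have := Nat.le_of_dvd (by omega) h
      have := Nat.pos_of_dvd_of_pos h (by omega)
      exact ⟨⟨this, by omega⟩, h⟩
    · rintro ⟨_, h⟩
      exact ⟨h, by omega⟩
  rw [sum_congr rfl h1, sum_comm]
  apply sum_congr rfl
  intro e _
  rw [← sum_filter, sum_const, nsmul_eq_mul, mul_comm]
  congr 2
  have := Nat.Ioc_filter_dvd_card_eq_div D e
  rw [← this]
  rfl

theorem hyper (q : ℕ) [NeZero q] (χ : DirichletCharacter ℂ q) (hχ : χ ≠ 1) (D E : ℕ) (hE : 1 ≤ E) (hED : E ≤ D) :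
    ‖∑ d ∈ Icc 1 D, ∑ e ∈ d.divisors, cf χ e - D * DirichletCharacter.LFunction χ 1‖ ≤
      E + D * (2 * q / (E + 1)) + 2 * q * (D / E) := by
  rw [sum_div_swap]
  have hdisj : Disjoint (Icc 1 E) (Ioc E D) := by
    rw [disjoint_left]; intro x hx hx'
    rw [mem_Icc] at hx; rw [mem_Ioc] at hx'; omega
  have hun : Icc 1 D = Icc 1 E ∪ Ioc E D := by
    ext x; simp only [mem_union, mem_Icc, mem_Ioc]; omega
  rw [hun, sum_union hdisj]
  have p1 : ‖∑ e ∈ Icc 1 E, cf χ e * ((D / e : ℕ) : ℂ) - D * ∑ k ∈ Icc 1 E, χ (k : ZMod q) / k‖ ≤ E := by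
    rw [mul_sum, ← sum_sub_distrib]
    calc _ ≤ ∑ e ∈ Icc 1 E, (1:ℝ) := by
          apply norm_sum_le_of_le
          intro e he
          rw [mem_Icc] at he
          have e1 : cf χ e * ((D / e : ℕ) : ℂ) - D * (χ (e : ZMod q) / e) =
              χ (e : ZMod q) * (((((D / e : ℕ) : ℝ) - D / e : ℝ)) : ℂ) := by
            push_cast; unfold cf; ring
          rw [e1, norm_mul, Complex.norm_real, Real.norm_eq_abs]
          have h1 := DirichletCharacter.norm_le_one χ (e : ZMod q)
          have h2 : |((D / e : ℕ) : ℝ) - D / e| ≤ 1 := by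
            have a1 : ((D / e : ℕ) : ℝ) ≤ D / e := Nat.cast_div_le
            have a2 : (D:ℝ) / e < (D / e : ℕ) + 1 := by
              rw [div_lt_iff₀ (by exact_mod_cast he.1)]
              have h3 := Nat.div_add_mod D e
              have h4 := Nat.mod_lt D (show 0 < e by omega)
              have : D < (D / e + 1) * e := by nlinarith
              exact_mod_cast this
            rw [abs_le]; constructor <;> linarith
          calc _ ≤ (1:ℝ) * 1 := by gcongr
            _ = 1 := by norm_num
      _ = E := by simp
  have p2 : ‖(D:ℂ) * (∑ k ∈ Icc 1 E, χ (k : ZMod q) / k) - D * DirichletCharacter.LFunction χ 1‖ ≤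
      D * (2 * q / (E + 1)) := by
    rw [← mul_sub, norm_mul, Complex.norm_natCast, norm_sub_rev]
    gcongr
    exact L_tail χ hχ E
  have p3 : ‖∑ e ∈ Ioc E D, cf χ e * ((D / e : ℕ) : ℂ)‖ ≤ 2 * q * (D / E) := by
    have e1 : ∑ e ∈ Ioc E D, cf χ e * ((D / e : ℕ) : ℂ) =
        ∑ m ∈ Icc 1 (D / E), (pA (cf χ) (D / m) - pA (cf χ) E) := by
      have h1 : ∀ e ∈ Ioc E D, cf χ e * ((D / e : ℕ) : ℂ) =
          ∑ m ∈ Icc 1 (D / E), if m ≤ D / e then cf χ e else 0 := by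
        intro e he
        rw [mem_Ioc] at he
        rw [← sum_filter, sum_const, nsmul_eq_mul, mul_comm]
        congr 2
        have : (Icc 1 (D / E)).filter (fun m => m ≤ D / e) = Icc 1 (D / e) := by
          ext m
          simp only [mem_filter, mem_Icc]
          have : D / e ≤ D / E := Nat.div_le_div_left (by omega) (by omega)
          omega
        rw [this]; simp
      rw [sum_congr rfl h1, sum_comm]
      apply sum_congr rfl
      intro m hm
      rw [mem_Icc] at hm
      have hmE : E ≤ D / m := by
        rw [Nat.le_div_iff_mul_le (by omega), mul_comm, ← Nat.le_div_iff_mul_le (by omega)]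
        exact hm.2
      have hmD : D / m ≤ D := Nat.div_le_self _ _
      unfold pA
      have hu : Icc 1 (D / m) = Icc 1 E ∪ Ioc E (D / m) := by
        ext x; simp only [mem_union, mem_Icc, mem_Ioc]; omega
      have hd2 : Disjoint (Icc 1 E) (Ioc E (D / m)) := by
        rw [disjoint_left]; intro x hx hx'
        rw [mem_Icc] at hx; rw [mem_Ioc] at hx'; omega
      rw [hu, sum_union hd2, add_sub_cancel_left, ← sum_filter]
      apply sum_congr _ (fun _ _ => rfl)
      ext e
      simp only [mem_filter, mem_Ioc]
      constructor
      · rintro ⟨⟨a1, a2⟩, a3⟩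
        refine ⟨a1, ?_⟩
        rw [Nat.le_div_iff_mul_le (by omega)] at a3 ⊢
        rwa [mul_comm]
      · rintro ⟨a1, a2⟩
        refine ⟨⟨a1, by omega⟩, ?_⟩
        rw [Nat.le_div_iff_mul_le (by omega)] at a2 ⊢
        rwa [mul_comm]
    rw [e1]
    calc _ ≤ ∑ m ∈ Icc 1 (D / E), (2 * q : ℝ) := by
          apply norm_sum_le_of_le
          intro m _
          have b1 := pA_le χ hχ (D / m)
          have b2 := pA_le χ hχ E
          exact (norm_sub_le _ _).trans (by linarith)
      _ = 2 * q * ((D / E : ℕ) : ℝ) := by rw [sum_const, nsmul_eq_mul]; simp; ring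
      _ ≤ _ := by gcongr; exact Nat.cast_div_le
  calc _ = ‖(∑ e ∈ Icc 1 E, cf χ e * ((D / e : ℕ) : ℂ) - D * ∑ k ∈ Icc 1 E, χ (k : ZMod q) / k) +
        ((D:ℂ) * (∑ k ∈ Icc 1 E, χ (k : ZMod q) / k) - D * DirichletCharacter.LFunction χ 1) +
        ∑ e ∈ Ioc E D, cf χ e * ((D / e : ℕ) : ℂ)‖ := by congr 1; ring
    _ ≤ _ := by
      refine (norm_add₃_le).trans ?_
      linarith
end E1148

namespace E1148
open Finset

theorem zm_eq (n : ℕ) [NeZero n] (d : ℕ) :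
    DirichletCharacter.zetaMul (chi n) d = ∑ e ∈ d.divisors, cf (chi n) e := by
  have : DirichletCharacter.zetaMul (chi n) =
    ((ArithmeticFunction.zeta : ArithmeticFunction ℕ) : ArithmeticFunction ℂ) * TA n := rfl
  rw [this, ArithmeticFunction.coe_zeta_mul_apply]
  apply sum_congr rfl
  intro e he
  rw [TA_apply n e (Nat.pos_of_mem_divisors he).ne', ← chi_apply]

theorem zmod2_sq (a : ZMod 2) : IsSquare a := by
  revert a; decide

theorem sq_mod_prime (n p : ℕ) (hp : p.Prime) (h : jv n p ≠ -1) : ∃ x : ℤ, (p:ℤ) ∣ x ^ 2 - n := by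
  have : Fact p.Prime := ⟨hp⟩
  have hsq : IsSquare ((n:ℕ) : ZMod p) := by
    rcases hp.eq_two_or_odd' with h2 | hodd
    · subst h2
      exact zmod2_sq _
    · by_cases h0 : ((n:ℕ) : ZMod p) = 0
      · rw [h0]; exact IsSquare.zero
      · have h1 : jv n p = legendreSym p n := by
          unfold jv
          rw [if_neg (Nat.not_even_iff_odd.mpr hodd), ← jacobiSym.legendreSym.to_jacobiSym]
        rw [h1] at h
        rcases legendreSym.eq_one_or_neg_one p (a := n) (by exact_mod_cast h0) with h2 | h2
        · exact (legendreSym.eq_one_iff' p h0).mp h2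
        · exact absurd h2 h
  obtain ⟨y, hy⟩ := hsq
  refine ⟨(y.val : ℤ), ?_⟩
  rw [← ZMod.intCast_zmod_eq_zero_iff_dvd]
  push_cast
  rw [ZMod.natCast_zmod_val, hy]; ring

theorem sq_mod_sqf (n : ℕ) : ∀ d : ℕ, Squarefree d → (∀ p, p.Prime → p ∣ d → jv n p ≠ -1) →
    ∃ x : ℤ, (d:ℤ) ∣ x ^ 2 - n := by
  intro d
  induction d using Nat.strong_induction_on with
  | _ d ih =>
    intro hsf hp
    rcases eq_or_ne d 1 with rfl | h1
    · exact ⟨0, by simp⟩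
    have hpp := Nat.minFac_prime h1
    obtain ⟨m, hm⟩ := Nat.minFac_dvd d
    set p := d.minFac with hpd
    have hd0 : d ≠ 0 := hsf.ne_zero
    have hm0 : 0 < m := by
      rcases Nat.eq_zero_or_pos m with h | h
      · rw [h, mul_zero] at hm; exact absurd hm hd0
      · exact h
    have hlt : m < d := by rw [hm]; have := hpp.two_le; nlinarith
    have hsf' : Squarefree (p * m) := by rw [← hm]; exact hsf
    have hcop : Nat.Coprime p m := (Nat.squarefree_mul_iff.mp hsf').1
    obtain ⟨x1, hx1⟩ := sq_mod_prime n p hpp (hp p hpp ⟨m, hm⟩)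
    obtain ⟨x2, hx2⟩ := ih m hlt (Nat.squarefree_mul_iff.mp hsf').2.2
      (fun q hq hqm => hp q hq (hm ▸ Dvd.dvd.mul_left hqm p))
    have hcz : IsCoprime (p:ℤ) (m:ℤ) := Nat.isCoprime_iff_coprime.mpr hcop
    obtain ⟨α, β, hab⟩ := hcz
    refine ⟨x1 * (β * m) + x2 * (α * p), ?_⟩
    have e1 : x1 * (β * m) + x2 * (α * p) = x1 + p * (α * (x2 - x1)) := by
      linear_combination (x1) * hab
    have e2 : x1 * (β * m) + x2 * (α * p) = x2 + m * (β * (x1 - x2)) := by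
      linear_combination (x2) * hab
    have d1 : (p:ℤ) ∣ (x1 * (β * m) + x2 * (α * p)) ^ 2 - n := by
      rw [e1]
      have : (x1 + p * (α * (x2 - x1))) ^ 2 - (n:ℤ) = (x1 ^ 2 - n) +
        p * ((α * (x2 - x1)) * (2 * x1 + p * (α * (x2 - x1)))) := by ring
      rw [this]; exact dvd_add hx1 (dvd_mul_right _ _)
    have d2 : (m:ℤ) ∣ (x1 * (β * m) + x2 * (α * p)) ^ 2 - n := by
      rw [e2]
      have : (x2 + m * (β * (x1 - x2))) ^ 2 - (n:ℤ) = (x2 ^ 2 - n) +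
        m * ((β * (x1 - x2)) * (2 * x2 + m * (β * (x1 - x2)))) := by ring
      rw [this]; exact dvd_add hx2 (dvd_mul_right _ _)
    have := IsCoprime.mul_dvd ⟨α, β, hab⟩ d1 d2
    rw [hm]; push_cast; exact this

theorem zm_ne (n : ℕ) [NeZero n] (g d : ℕ) (hg : g ≠ 0) (hsf : Squarefree d)
    (h : DirichletCharacter.zetaMul (chi n) (g ^ 2 * d) ≠ 0) : ∃ x : ℤ, (d:ℤ) ∣ x ^ 2 - n := by
  apply sq_mod_sqf n d hsf
  intro p hp hpd hj
  apply h
  have hd0 := hsf.ne_zero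
  have hne : g ^ 2 * d ≠ 0 := mul_ne_zero (pow_ne_zero _ hg) hd0
  rw [ArithmeticFunction.IsMultiplicative.multiplicative_factorization _
    (DirichletCharacter.isMultiplicative_zetaMul (chi n)) hne]
  apply prod_eq_zero (i := p)
  · rw [Nat.support_factorization, Nat.mem_primeFactors]
    exact ⟨hp, Dvd.dvd.mul_left hpd _, hne⟩
  · beta_reduce
    rw [zm_pp n p hp, hj]
    have hf : (g ^ 2 * d).factorization p = 2 * g.factorization p + 1 := by
      rw [Nat.factorization_mul (pow_ne_zero _ hg) hd0, Nat.factorization_pow]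
      have : d.factorization p = 1 := by
        apply le_antisymm (hsf.natFactorization_le_one p)
        exact (hp.dvd_iff_one_le_factorization hd0).mp hpd
      simp [this]
    rw [hf]
    push_cast
    rw [neg_one_geom_sum, if_pos ⟨g.factorization p + 1, by ring⟩]

theorem S_upper (n : ℕ) [NeZero n] (D Tb : ℕ)
    (hT : ∀ d, 0 < d → d ≤ D → d.divisors.card ≤ Tb) :
    ‖∑ d ∈ Icc 1 D, ∑ e ∈ d.divisors, cf (chi n) e‖ ≤
      Tb * ∑ g ∈ Icc 1 (Nat.sqrt D), (#(Gset n (D / g ^ 2)) : ℝ) := by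
  classical
  set W := (Icc 1 D).filter (fun d => DirichletCharacter.zetaMul (chi n) d ≠ 0) with hW
  have h1 : ∑ d ∈ Icc 1 D, ∑ e ∈ d.divisors, cf (chi n) e = ∑ d ∈ W, ∑ e ∈ d.divisors, cf (chi n) e := by
    symm
    apply sum_subset (filter_subset _ _)
    intro d hd hdW
    rw [← zm_eq]
    by_contra hne
    exact hdW (mem_filter.mpr ⟨hd, hne⟩)
  have h2 : ‖∑ d ∈ W, ∑ e ∈ d.divisors, cf (chi n) e‖ ≤ #W * Tb := by
    rw [← nsmul_eq_mul, ← sum_const]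
    apply norm_sum_le_of_le
    intro d hd
    have hd' := mem_Icc.mp (mem_filter.mp hd).1
    calc _ ≤ ∑ e ∈ d.divisors, (1:ℝ) := by
          apply norm_sum_le_of_le
          intro e _
          exact DirichletCharacter.norm_le_one (chi n) _
      _ = d.divisors.card := by simp
      _ ≤ Tb := by exact_mod_cast hT d hd'.1 hd'.2
  have h3 : #W ≤ ∑ g ∈ Icc 1 (Nat.sqrt D), #(Gset n (D / g ^ 2)) := by
    rw [← card_sigma]
    refine card_le_card_of_surjOn (fun p : (Σ _ : ℕ, ℕ) => p.1 ^ 2 * p.2) ?_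
    intro d hd
    obtain ⟨hd1, hd2⟩ := mem_filter.mp hd
    rw [mem_Icc] at hd1
    obtain ⟨b, g, hb0, hg0, hbg, hsf⟩ := Nat.sq_mul_squarefree_of_pos (show 0 < d by omega)
    rw [← hbg] at hd2
    have hx := zm_ne n g b hg0.ne' hsf hd2
    have hle : g ^ 2 * b ≤ D := by rw [hbg]; exact hd1.2
    refine ⟨⟨g, b⟩, ?_, hbg⟩
    simp only [coe_sigma, Set.mem_sigma_iff, mem_coe, mem_Icc, Gset, mem_filter]
    refine ⟨⟨hg0, ?_⟩, ⟨hb0, ?_⟩, hx⟩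
    · rw [Nat.le_sqrt']
      nlinarith [Nat.zero_le (g ^ 2)]
    · rw [Nat.le_div_iff_mul_le (by positivity), mul_comm]; exact hle
  rw [h1]
  refine h2.trans ?_
  rw [mul_comm]
  gcongr
  exact_mod_cast h3
end E1148

namespace E1148
open Finset

theorem inv_sq_sum (N : ℕ) : ∑ g ∈ Icc 1 N, (1:ℝ) / (g:ℝ) ^ 2 ≤ 2 := by
  have : ∀ N : ℕ, ∑ g ∈ Icc 1 N, (1:ℝ) / (g:ℝ) ^ 2 ≤ 2 - 1 / (N + 1) := by
    intro N
    induction N with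
    | zero => simp
    | succ N ih =>
      rw [sum_Icc_succ_top (by omega)]
      rcases Nat.eq_zero_or_pos N with h | h
      · subst h; norm_num
      · have hN : (0:ℝ) < N := by exact_mod_cast h
        have h3 : ∑ g ∈ Icc 1 N, (1:ℝ) / (g:ℝ) ^ 2 ≤ 2 - 1 / N := by
          clear ih
          induction N, h using Nat.le_induction with
          | base => norm_num
          | succ M hM ih2 =>
            have hM0 : (0:ℝ) < M := by exact_mod_cast hM
            rw [sum_Icc_succ_top (by omega)]
            have := ih2 hM0
            push_cast
            have e : (1:ℝ) / (M + 1) ^ 2 ≤ 1 / M - 1 / (M + 1) := by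
              rw [div_sub_div _ _ hM0.ne' (by positivity), div_le_div_iff₀ (by positivity) (by positivity)]
              nlinarith
            linarith
        push_cast
        have e : (1:ℝ) / (N + 1) ^ 2 ≤ 1 / N - 1 / (N + 1 + 1) := by
          rw [div_sub_div _ _ hN.ne' (by positivity), div_le_div_iff₀ (by positivity) (by positivity)]
          nlinarith
        linarith
  refine (this N).trans ?_
  have : (0:ℝ) ≤ 1 / (N + 1) := by positivity
  linarith

theorem final_ineq (n : ℕ) [NeZero n] (hsq : ¬ IsSquare n) (Tb : ℕ)
    (hT : ∀ d, 0 < d → d ≤ n ^ 4 → d.divisors.card ≤ Tb) :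
    (n:ℝ) ^ 4 * (LL n 1).re ≤ Tb * ((n:ℝ) ^ 2 * √(n:ℝ) +
      2 * Rn n * ((n:ℝ) ^ 4 / √(n:ℝ) * (6 + 16 * Real.log n))) + 17 * (n:ℝ) ^ 3 := by
  have hn1 : 1 ≤ n := NeZero.one_le
  have hnR : (1:ℝ) ≤ n := by exact_mod_cast hn1
  have hE : 1 ≤ n ^ 2 := Nat.one_le_pow _ _ hn1
  have h1 := hyper (4 * n) (chi n) (chi_ne_one n hsq) (n ^ 4) (n ^ 2) hE
    (Nat.pow_le_pow_right hn1 (by norm_num))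
  have h2 := S_upper n (n ^ 4) Tb hT
  set s : ℝ := √(n:ℝ) with hs
  have hs1 : 1 ≤ s := Real.one_le_sqrt.mpr hnR
  have hlog : 0 ≤ Real.log n := Real.log_nonneg hnR
  set Q : ℝ := (n:ℝ) ^ 4 / s * (6 + 16 * Real.log n) with hQ
  have hQ0 : 0 ≤ Q := by positivity
  have h3 : ∑ g ∈ Icc 1 (Nat.sqrt (n ^ 4)), (#(Gset n (n ^ 4 / g ^ 2)) : ℝ) ≤
      (n:ℝ) ^ 2 * s + 2 * Rn n * Q := by
    have e0 : Nat.sqrt (n ^ 4) = n ^ 2 := by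
      rw [show n ^ 4 = (n ^ 2) ^ 2 by ring]; exact Nat.sqrt_eq' _
    rw [e0]
    have hSs : (Nat.sqrt n : ℝ) ≤ s := Real.nat_sqrt_le_real_sqrt
    calc _ ≤ ∑ g ∈ Icc 1 (n ^ 2), (s + Rn n * Q * (1 / (g:ℝ) ^ 2)) := by
          apply sum_le_sum
          intro g hg
          rw [mem_Icc] at hg
          have hg2 : g ^ 2 ≤ n ^ 4 := by
            calc g ^ 2 ≤ (n ^ 2) ^ 2 := Nat.pow_le_pow_left hg.2 2
              _ = n ^ 4 := by ring
          have hg0 : (0:ℝ) < (g:ℝ) ^ 2 := by have : (0:ℝ) < g := by exact_mod_cast hg.1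
                                             positivity
          have hy : 1 ≤ n ^ 4 / g ^ 2 := by
            rw [Nat.le_div_iff_mul_le (pow_pos hg.1 2)]; omega
          refine (G_le n _ hsq hy).trans ?_
          have y1 : ((n ^ 4 / g ^ 2 : ℕ) : ℝ) ≤ (n:ℝ) ^ 4 / (g:ℝ) ^ 2 := by
            have := @Nat.cast_div_le ℝ _ _ _ (n ^ 4) (g ^ 2)
            push_cast at this; exact this
          have y2 : Real.log ((n ^ 4 / g ^ 2 : ℕ) : ℝ) ≤ 4 * Real.log n := by
            have : ((n ^ 4 / g ^ 2 : ℕ) : ℝ) ≤ (n:ℝ) ^ 4 := by exact_mod_cast Nat.div_le_self _ _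
            have h := Real.log_le_log (by exact_mod_cast hy) this
            rw [Real.log_pow] at h
            exact_mod_cast h
          have y3 : 0 ≤ Real.log ((n ^ 4 / g ^ 2 : ℕ) : ℝ) := Real.log_nonneg (by exact_mod_cast hy)
          have y4 : Rn n * Q * (1 / (g:ℝ) ^ 2) =
              Rn n * ((n:ℝ) ^ 4 / (g:ℝ) ^ 2 / s * (6 + 4 * (4 * Real.log n))) := by
            rw [hQ]; field_simp; ring
          rw [y4]
          gcongr
      _ = (n:ℝ) ^ 2 * s + Rn n * Q * ∑ g ∈ Icc 1 (n ^ 2), 1 / (g:ℝ) ^ 2 := by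
          rw [sum_add_distrib, ← mul_sum]; simp
      _ ≤ (n:ℝ) ^ 2 * s + Rn n * Q * 2 := by gcongr; exact inv_sq_sum _
      _ = _ := by ring
  have h4 : (n:ℝ) ^ 4 * (LL n 1).re ≤ ‖((n ^ 4 : ℕ) : ℂ) * LL n 1‖ := by
    rw [norm_mul, Complex.norm_natCast]
    push_cast
    gcongr
    exact Complex.re_le_norm _
  have h5 : ‖((n ^ 4 : ℕ) : ℂ) * LL n 1‖ ≤ ‖∑ d ∈ Icc 1 (n ^ 4), ∑ e ∈ d.divisors, cf (chi n) e‖ +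
      ‖∑ d ∈ Icc 1 (n ^ 4), ∑ e ∈ d.divisors, cf (chi n) e - ((n ^ 4 : ℕ) : ℂ) * LL n 1‖ := by
    have := norm_sub_le (∑ d ∈ Icc 1 (n ^ 4), ∑ e ∈ d.divisors, cf (chi n) e)
      (∑ d ∈ Icc 1 (n ^ 4), ∑ e ∈ d.divisors, cf (chi n) e - ((n ^ 4 : ℕ) : ℂ) * LL n 1)
    rwa [sub_sub_cancel] at this
  have h6 : ((n ^ 2 : ℕ) : ℝ) + ((n ^ 4 : ℕ) : ℝ) * (2 * ((4 * n : ℕ) : ℝ) / (((n ^ 2 : ℕ) : ℝ) + 1)) +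
      2 * ((4 * n : ℕ) : ℝ) * (((n ^ 4 : ℕ) : ℝ) / ((n ^ 2 : ℕ) : ℝ)) ≤ 17 * (n:ℝ) ^ 3 := by
    push_cast
    have n0 : (0:ℝ) < n := by linarith
    have a1 : (n:ℝ) ^ 4 * (2 * (4 * n) / ((n:ℝ) ^ 2 + 1)) ≤ 8 * (n:ℝ) ^ 3 := by
      rw [← mul_div_assoc, div_le_iff₀ (by positivity)]
      have : (0:ℝ) < (n:ℝ) ^ 3 := by positivity
      nlinarith
    have a2 : 2 * (4 * (n:ℝ)) * ((n:ℝ) ^ 4 / (n:ℝ) ^ 2) = 8 * (n:ℝ) ^ 3 := by field_simp; ring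
    have a3 : (n:ℝ) ^ 2 ≤ (n:ℝ) ^ 3 := pow_le_pow_right₀ hnR (by norm_num)
    linarith
  have h7 : (Tb:ℝ) * ∑ g ∈ Icc 1 (Nat.sqrt (n ^ 4)), (#(Gset n (n ^ 4 / g ^ 2)) : ℝ) ≤
      Tb * ((n:ℝ) ^ 2 * s + 2 * Rn n * Q) := by gcongr
  linarith
end E1148

namespace E1148
open Finset Filter

theorem T4_eventually (η : ℝ) (hη : 0 < η) : ∀ᶠ n : ℕ in atTop,
    ∀ m : ℕ, 0 < m → m ≤ n ^ 4 → (m.divisors.card : ℝ) ≤ (n:ℝ) ^ η := by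
  obtain ⟨C, hC1, hC⟩ := divisor_bound (η / 8) (by positivity)
  have h1 : Tendsto (fun n : ℕ => (n:ℝ) ^ (η / 2)) atTop atTop :=
    (tendsto_rpow_atTop (by positivity)).comp tendsto_natCast_atTop_atTop
  filter_upwards [h1.eventually_ge_atTop C] with n hn m hm hle
  have h2 : (m:ℝ) ≤ (n:ℝ) ^ 4 := by exact_mod_cast hle
  calc (m.divisors.card : ℝ) ≤ C * (m:ℝ) ^ (η/8) := hC m hm
    _ ≤ C * ((n:ℝ) ^ 4) ^ (η/8) := by gcongr
    _ = C * (n:ℝ) ^ (η/2) := by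
      rw [← Real.rpow_natCast (n:ℝ) 4, ← Real.rpow_mul (by positivity)]
      congr 2; push_cast; ring
    _ ≤ (n:ℝ) ^ (η/2) * (n:ℝ) ^ (η/2) := by gcongr
    _ = (n:ℝ) ^ η := by
      rw [← Real.rpow_add_of_nonneg (by positivity) (by positivity) (by positivity)]; congr 1; ring

theorem Rep_eventually : ∀ᶠ n : ℕ in atTop, ¬ IsSquare n → Rep n := by
  obtain ⟨c, hc0, hc⟩ := siegel (1 / 10000) (by norm_num)
  have h1 : Tendsto (fun n : ℕ => (n:ℝ) ^ (7 / 10000 : ℝ)) atTop atTop :=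
    (tendsto_rpow_atTop (by norm_num)).comp tendsto_natCast_atTop_atTop
  filter_upwards [h1.eventually_gt_atTop (82 / c), eventually_ge_atTop 1, P_upper,
    T4_eventually (1 / 10000) (by norm_num), log_eventually (1 / 10000) (by norm_num)] with n g1 g2 g3 g4 g5 hsq
  by_contra hbad
  have : NeZero n := ⟨by omega⟩
  have n1 : (1:ℝ) ≤ n := by exact_mod_cast g2
  have n0 : (0:ℝ) < n := by linarith
  have hP := g3 hsq hbad
  have hR : (Rn n : ℝ) ≤ 2 * (n:ℝ) ^ (1 / 2 - 1 / 1000 : ℝ) := by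
    have : (Rn n : ℝ) ≤ 2 * #(Pset n) := by exact_mod_cast Rn_le_P n hsq hbad
    linarith
  have hS := hc n hsq
  set Tb : ℕ := ⌊(n:ℝ) ^ (1 / 10000 : ℝ)⌋₊ with hTb
  have hTl : (Tb:ℝ) ≤ (n:ℝ) ^ (1 / 10000 : ℝ) := Nat.floor_le (by positivity)
  have hm := final_ineq n hsq Tb (fun d hd hd4 => Nat.le_floor (g4 d hd hd4))
  have hlog0 : 0 ≤ Real.log n := Real.log_nonneg n1
  have hlog : 6 + 16 * Real.log n ≤ 16 * (n:ℝ) ^ (1 / 10000 : ℝ) := by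
    have : Real.log n ≤ Real.log (4 * n) := Real.log_le_log n0 (by linarith)
    linarith
  have hsr : √(n:ℝ) = (n:ℝ) ^ (1 / 2 : ℝ) := Real.sqrt_eq_rpow _
  have i1 : c * (n:ℝ) ^ (4 - 1 / 10000 : ℝ) ≤ (n:ℝ) ^ 4 * (LL n 1).re := by
    have e : c * (n:ℝ) ^ (4 - 1 / 10000 : ℝ) = (n:ℝ) ^ 4 * (c * (n:ℝ) ^ (-(1 / 10000) : ℝ)) := by
      rw [← Real.rpow_natCast (n:ℝ) 4, sub_eq_add_neg, Real.rpow_add n0]; push_cast; ring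
    rw [e]
    gcongr
  have i2 : Tb * ((n:ℝ) ^ 2 * √(n:ℝ) + 2 * Rn n * ((n:ℝ) ^ 4 / √(n:ℝ) * (6 + 16 * Real.log n))) ≤
      65 * (n:ℝ) ^ (4 - 8 / 10000 : ℝ) := by
    calc _ ≤ (n:ℝ) ^ (1 / 10000 : ℝ) * ((n:ℝ) ^ 2 * √(n:ℝ) + 2 * (2 * (n:ℝ) ^ (1 / 2 - 1 / 1000 : ℝ)) *
          ((n:ℝ) ^ 4 / √(n:ℝ) * (16 * (n:ℝ) ^ (1 / 10000 : ℝ)))) := by gcongr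
      _ = (n:ℝ) ^ (1 / 10000 + 2 + 1 / 2 : ℝ) + 64 * (n:ℝ) ^ (4 - 8 / 10000 : ℝ) := by
        have e1 : (n:ℝ) ^ (1 / 10000 + 2 + 1 / 2 : ℝ) = (n:ℝ) ^ (1 / 10000 : ℝ) * (n:ℝ) ^ 2 * (n:ℝ) ^ (1 / 2 : ℝ) := by
          rw [Real.rpow_add n0, Real.rpow_add n0]; norm_num
        have e2 : (n:ℝ) ^ (4 - 8 / 10000 : ℝ) = (n:ℝ) ^ (1 / 10000 : ℝ) * (n:ℝ) ^ (1 / 2 - 1 / 1000 : ℝ) *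
            ((n:ℝ) ^ 4 / (n:ℝ) ^ (1 / 2 : ℝ)) * (n:ℝ) ^ (1 / 10000 : ℝ) := by
          rw [← Real.rpow_natCast (n:ℝ) 4, ← Real.rpow_sub n0, ← Real.rpow_add n0, ← Real.rpow_add n0,
            ← Real.rpow_add n0]
          congr 1; push_cast; norm_num
        rw [e1, e2, hsr]; ring
      _ ≤ (n:ℝ) ^ (4 - 8 / 10000 : ℝ) + 64 * (n:ℝ) ^ (4 - 8 / 10000 : ℝ) := by
        gcongr
        norm_num
      _ = _ := by ring
  have i3 : 17 * (n:ℝ) ^ 3 ≤ 17 * (n:ℝ) ^ (4 - 8 / 10000 : ℝ) := by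
    rw [← Real.rpow_natCast (n:ℝ) 3]
    gcongr
    norm_num
  have i4 : c * (n:ℝ) ^ (4 - 1 / 10000 : ℝ) ≤ 82 * (n:ℝ) ^ (4 - 8 / 10000 : ℝ) := by linarith
  have e : (n:ℝ) ^ (4 - 1 / 10000 : ℝ) = (n:ℝ) ^ (7 / 10000 : ℝ) * (n:ℝ) ^ (4 - 8 / 10000 : ℝ) := by
    rw [← Real.rpow_add n0]; congr 1; norm_num
  rw [e, ← mul_assoc] at i4
  have i5 := le_of_mul_le_mul_right i4 (by positivity)
  rw [div_lt_iff₀ hc0] at g1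
  linarith

end E1148

theorem erdos_1148_nonsquare_strict :
    ∃ N : ℕ, ∀ n : ℤ, (N : ℤ) ≤ n → ¬ IsSquare n →
      ∃ x y z : ℤ, n = x ^ 2 + y ^ 2 - z ^ 2 ∧ max (x ^ 2) (max (y ^ 2) (z ^ 2)) < n := by
  obtain ⟨N, hN⟩ := Filter.eventually_atTop.mp E1148.Rep_eventually
  refine ⟨N, fun n hn hsq => ?_⟩
  obtain ⟨m, rfl⟩ := Int.eq_ofNat_of_zero_le (show 0 ≤ n by omega)
  refine hN m (by exact_mod_cast hn) (fun h => hsq ?_)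
  obtain ⟨r, hr⟩ := h
  exact ⟨r, by exact_mod_cast hr⟩
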